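/- arXiv:2502.07100 — 3 statements merged into one kernel-verified Lean document; each statement's English description precedes it below -/
import Mathlib

section
/- Let Γ be a subgroup of ℝ^* of finite rank and let n ≥ 3 be an integer with n ≡ 0 or 1 (mod 4). Define β(n) = (3n² − n)/4. Then there exists a constant C > 0, depending only on n and the rank of Γ, such that for every monic polynomial f = Σ_{k=0}^{n} c_k T^k ∈ ℝ[T] of degree n and every finite subset A of Γ of cardinality A = #A: (i) if c_{n−1} ≠ 0 and c_{n−1}² = 2c_{n−2} (equivalently, the prescribed trace is non-zero and the prescribed trace of the square is zero), then #P_n(A; f) ≤ C·A^{β(n) − 2} when n ≡ 0 (mod 4) and #P_n(A; f) ≤ C·A^{β(n) − 3/2} when n ≡ 1 (mod 4); (ii) if n = 5 and c_4 = c_3 = 0, then #P_5(A; f) ≤ C·A^{β(5) − 3/2}. -/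
/-- A subgroup `Γ` of a (commutative) group has finite rank `ρ` if there is a finitely
generated subgroup `Γ₀ ≤ Γ`, generated by `ρ` elements, such that every `x ∈ Γ` has a
positive power lying in `Γ₀`. -/
def FinRank {G : Type*} [CommGroup G] (Γ : Subgroup G) (ρ : ℕ) : Prop :=
  ∃ S : Finset G, S.card = ρ ∧ (S : Set G) ⊆ (Γ : Set G) ∧
    ∀ x ∈ Γ, ∃ k : ℕ, 0 < k ∧ x ^ k ∈ Subgroup.closure (S : Set G)

/-- `β(n) = (3n² - n)/4`. -/
noncomputable def betaExp (n : ℕ) : ℝ := (3 * (n : ℝ) ^ 2 - n) / 4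

/-- A finite system of absolute values on a field together with a subring of elements whose
nonzero members have nonnegative total logarithmic size. -/
structure PlaceSystem (K : Type) [Field K] where
  V : Type
  fin : Fintype V
  ab : V → AbsoluteValue K ℝ
  w : V → ℝ
  place : ∀ v, (w v = 0 ∧ IsNonarchimedean (ab v)) ∨ (w v = 1 ∧ ∀ n : ℕ, ab v n = n)
  O : Subring K
  prod : ∀ x ∈ O, x ≠ 0 → 0 ≤ ∑ v, Real.log (ab v x)
  deg_pos : 0 < ∑ v, w v

namespace PlaceSystem

variable {K : Type} [Field K] (S : PlaceSystem K)

instance : Fintype S.V := S.fin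

/-- The number of archimedean members. -/
def deg : ℝ := ∑ v, S.w v

lemma deg_pos' : 0 < S.deg := S.deg_pos

/-- The logarithmic vector. -/
noncomputable def L (x : K) : S.V → ℝ := fun v => Real.log (S.ab v x)

/-- The `ℓ¹` norm. -/
def nrm (p : S.V → ℝ) : ℝ := ∑ v, |p v|

/-- Units of the ring `O`. -/
def IsU (x : K) : Prop := x ≠ 0 ∧ x ∈ S.O ∧ x⁻¹ ∈ S.O

lemma w_nonneg (v : S.V) : 0 ≤ S.w v := by
  rcases S.place v with h | h <;> simp [h.1]

lemma nrm_add (p q : S.V → ℝ) : S.nrm (p + q) ≤ S.nrm p + S.nrm q := by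
  unfold nrm
  rw [← Finset.sum_add_distrib]
  exact Finset.sum_le_sum fun v _ => abs_add_le _ _

lemma nrm_neg (p : S.V → ℝ) : S.nrm (-p) = S.nrm p := by
  simp [nrm]

lemma nrm_sub (p q : S.V → ℝ) : S.nrm (p - q) ≤ S.nrm p + S.nrm q := by
  rw [sub_eq_add_neg, ← S.nrm_neg q]
  exact S.nrm_add _ _

lemma nrm_smul (c : ℝ) (p : S.V → ℝ) : S.nrm (c • p) = |c| * S.nrm p := by
  simp [nrm, Finset.mul_sum, abs_mul]

lemma nrm_sum {ι : Type*} (s : Finset ι) (p : ι → S.V → ℝ) :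
    S.nrm (∑ i ∈ s, p i) ≤ ∑ i ∈ s, S.nrm (p i) := by
  classical
  induction s using Finset.induction_on with
  | empty => simp [nrm]
  | insert a s ha ih =>
    rw [Finset.sum_insert ha, Finset.sum_insert ha]
    exact (S.nrm_add _ _).trans (by gcongr)

lemma ab_pos {x : K} (hx : x ≠ 0) (v : S.V) : 0 < S.ab v x := (S.ab v).pos hx

lemma exp_L {x : K} (hx : x ≠ 0) (v : S.V) : Real.exp (S.L x v) = S.ab v x :=
  Real.exp_log (S.ab_pos hx v)

lemma L_mul {x y : K} (hx : x ≠ 0) (hy : y ≠ 0) : S.L (x * y) = S.L x + S.L y := by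
  ext v
  simp [L, Real.log_mul (S.ab_pos hx v).ne' (S.ab_pos hy v).ne']

lemma L_one : S.L 1 = 0 := by ext v; simp [L]

lemma L_inv (x : K) : S.L x⁻¹ = -S.L x := by
  ext v
  simp [L, map_inv₀]

lemma L_div {x y : K} (hx : x ≠ 0) (hy : y ≠ 0) : S.L (x / y) = S.L x - S.L y := by
  rw [div_eq_mul_inv, S.L_mul hx (inv_ne_zero hy), L_inv, sub_eq_add_neg]

lemma L_neg (x : K) : S.L (-x) = S.L x := by
  ext v
  simp [L, (S.ab v).map_neg]

lemma L_pow (x : K) (n : ℕ) : S.L (x ^ n) = (n : ℝ) • S.L x := by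
  ext v
  simp [L]

lemma L_prod {ι : Type*} (s : Finset ι) (f : ι → K) (hf : ∀ i ∈ s, f i ≠ 0) :
    S.L (∏ i ∈ s, f i) = ∑ i ∈ s, S.L (f i) := by
  ext v
  simp only [L, map_prod, Finset.sum_apply]
  exact Real.log_prod fun i hi => (S.ab_pos (hf i hi) v).ne'

variable {S}

lemma IsU.one : S.IsU 1 := ⟨one_ne_zero, S.O.one_mem, by simp⟩

lemma IsU.mul {x y : K} (hx : S.IsU x) (hy : S.IsU y) : S.IsU (x * y) :=
  ⟨mul_ne_zero hx.1 hy.1, S.O.mul_mem hx.2.1 hy.2.1, by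
    rw [mul_inv]; exact S.O.mul_mem hx.2.2 hy.2.2⟩

lemma IsU.inv {x : K} (hx : S.IsU x) : S.IsU x⁻¹ :=
  ⟨inv_ne_zero hx.1, hx.2.2, by rw [inv_inv]; exact hx.2.1⟩

lemma IsU.div {x y : K} (hx : S.IsU x) (hy : S.IsU y) : S.IsU (x / y) := by
  rw [div_eq_mul_inv]; exact hx.mul hy.inv

lemma IsU.neg {x : K} (hx : S.IsU x) : S.IsU (-x) :=
  ⟨neg_ne_zero.2 hx.1, S.O.neg_mem hx.2.1, by rw [inv_neg]; exact S.O.neg_mem hx.2.2⟩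

lemma IsU.pow {x : K} (hx : S.IsU x) (n : ℕ) : S.IsU (x ^ n) :=
  ⟨pow_ne_zero _ hx.1, S.O.pow_mem hx.2.1 n, by rw [← inv_pow]; exact S.O.pow_mem hx.2.2 n⟩

lemma IsU.prod {ι : Type*} {s : Finset ι} {f : ι → K} (h : ∀ i ∈ s, S.IsU (f i)) :
    S.IsU (∏ i ∈ s, f i) :=
  Finset.prod_induction f S.IsU (fun _ _ => IsU.mul) IsU.one h

lemma IsU.sum_L {x : K} (hx : S.IsU x) : ∑ v, S.L x v = 0 := by
  have h1 := S.prod x hx.2.1 hx.1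
  have h2 := S.prod x⁻¹ hx.2.2 (inv_ne_zero hx.1)
  have h3 : ∑ v, Real.log (S.ab v x⁻¹) = - ∑ v, Real.log (S.ab v x) := by
    rw [← Finset.sum_neg_distrib]
    exact Finset.sum_congr rfl fun v _ => congrFun (S.L_inv x) v
  simp only [L]
  linarith

variable (S)

/-- Bound for a sum of `n` terms at one place. -/
lemma ab_sum_le {ι : Type*} (s : Finset ι) (hs : s.Nonempty) (f : ι → K) (v : S.V) (B : ℝ)
    (h : ∀ i ∈ s, S.ab v (f i) ≤ B) :
    S.ab v (∑ i ∈ s, f i) ≤ Real.exp (S.w v * Real.log s.card) * B := by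
  have hc : 0 < (s.card : ℝ) := by exact_mod_cast hs.card_pos
  rcases S.place v with ⟨h0, hna⟩ | ⟨h1, -⟩
  · rw [h0, zero_mul, Real.exp_zero, one_mul]
    obtain ⟨i, hi, hle⟩ := hna.finset_image_add_of_nonempty f hs
    exact hle.trans (h i hi)
  · rw [h1, one_mul, Real.exp_log hc]
    refine ((S.ab v).sum_le s f).trans ?_
    refine (Finset.sum_le_sum h).trans ?_
    simp

/-- Logarithmic bound for a nonzero sum of `n` terms at one place. -/
lemma L_sum_le {ι : Type*} (s : Finset ι) (f : ι → K) (v : S.V) (B : ℝ)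
    (h0 : ∑ i ∈ s, f i ≠ 0)
    (h : ∀ i ∈ s, f i ≠ 0 → S.L (f i) v ≤ B) :
    S.L (∑ i ∈ s, f i) v ≤ S.w v * Real.log s.card + B := by
  have hs : s.Nonempty := by
    by_contra hne
    rw [Finset.not_nonempty_iff_eq_empty] at hne
    simp [hne] at h0
  have := S.ab_sum_le s hs f v (Real.exp B) (fun i hi => by
    by_cases hf : f i = 0
    · rw [hf]; simp [Real.exp_nonneg]
    · rw [← S.exp_L hf]; exact Real.exp_le_exp.2 (h i hi hf))
  rw [← Real.exp_add] at this
  rw [L]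
  exact (Real.log_le_iff_le_exp (S.ab_pos h0 v)).2 this

lemma abs_eq_two_max (a : ℝ) : |a| = 2 * max 0 a - a := by
  rcases le_total 0 a with h | h
  · rw [abs_of_nonneg h, max_eq_right h]; ring
  · rw [abs_of_nonpos h, max_eq_left h]; ring

lemma nrm_eq_two_mul_sum_max (p : S.V → ℝ) (hp : ∑ v, p v = 0) :
    S.nrm p = 2 * ∑ v, max 0 (p v) := by
  simp only [nrm, abs_eq_two_max]
  rw [Finset.sum_sub_distrib, hp, sub_zero, Finset.mul_sum]

lemma nrm_L_one_sub_le {x y : K} (hx : S.IsU x) (hy : S.IsU y) (h : x + y = 1) :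
    S.nrm (S.L y) ≤ S.nrm (S.L x) + 2 * S.deg * Real.log 2 := by
  rw [S.nrm_eq_two_mul_sum_max _ hx.sum_L, S.nrm_eq_two_mul_sum_max _ hy.sum_L]
  have : ∀ v, max 0 (S.L y v) ≤ max 0 (S.L x v) + S.w v * Real.log 2 := by
    intro v
    have hw := mul_nonneg (S.w_nonneg v) (Real.log_nonneg one_le_two)
    refine max_le (by positivity) ?_
    have hy' : y = ∑ i : Fin 2, ![1, -x] i := by simp [← h]
    have := S.L_sum_le Finset.univ ![1, -x] v (max 0 (S.L x v)) (hy' ▸ hy.1) (by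
      intro i _ _
      fin_cases i
      · simp [L_one]
      · simp [L_neg])
    rw [← hy'] at this
    simp at this
    linarith
  have := Finset.sum_le_sum fun v (_ : v ∈ Finset.univ) => this v
  rw [Finset.sum_add_distrib, ← Finset.sum_mul] at this
  change _ ≤ _ + S.deg * _ at this
  linarith

lemma IsU.of_sign {x : K} (hx : S.IsU x) (u : ℤˣ) : S.IsU (u • x) ∧ S.L (u • x) = S.L x := by
  rcases Int.units_eq_one_or u with rfl | rfl
  · simpa using hx
  · simpa [L_neg] using hx.neg

/-- Vectors of sum one whose logarithms are close to each other, compared to their size, are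
linearly dependent. -/
lemma det_eq_zero_of_close {ι : Type*} [Fintype ι] [DecidableEq ι] (τ : Matrix ι ι K)
    (hU : ∀ j i, S.IsU (τ j i)) (hsum : ∀ j, ∑ i, τ j i = 1) (P : ι → S.V → ℝ)
    (hP : ∀ i, ∑ v, P i v = 0) (i₀ : ι) (H : ℝ) (hH : H ≤ S.nrm (P i₀))
    (hlarge : 4 * S.deg * Real.log (Fintype.card ι).factorial < H)
    (hclose : ∀ j i, S.nrm (S.L (τ j i) - P i) ≤ H / (4 * (Fintype.card ι : ℝ) ^ 2)) :
    τ.det = 0 := by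
  by_contra hdet
  have hO : τ.det ∈ S.O := by
    rw [Matrix.det_apply]
    refine S.O.sum_mem fun σ _ => ?_
    exact (IsU.of_sign S (IsU.prod fun i _ => hU (σ i) i) (Equiv.Perm.sign σ)).1.2.1
  have hpr := S.prod _ hO hdet
  set err : S.V → ℝ := fun v => ∑ j, ∑ i, |(S.L (τ j i) - P i) v| with herr
  have hle : ∀ j i v, S.L (τ j i) v ≤ P i v + ∑ j, |(S.L (τ j i) - P i) v| := by
    intro j i v
    have h1 := Finset.single_le_sum (f := fun j => |(S.L (τ j i) - P i) v|)
      (fun j _ => abs_nonneg _) (Finset.mem_univ j)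
    have h2 := le_abs_self ((S.L (τ j i) - P i) v)
    simp only [Pi.sub_apply] at h1 h2 ⊢
    linarith
  have herr' : ∀ v, err v = ∑ i, ∑ j, |(S.L (τ j i) - P i) v| := fun v => Finset.sum_comm
  have hcard : (Finset.univ : Finset (Equiv.Perm ι)).card = (Fintype.card ι).factorial := by
    rw [Finset.card_univ, Fintype.card_perm]
  have key : ∀ v, S.L τ.det v ≤
      S.w v * Real.log (Fintype.card ι).factorial + (∑ i, P i v - max 0 (P i₀ v) + err v) := by
    intro v
    rcases le_total (P i₀ v) 0 with hneg | hpos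
    · rw [max_eq_left hneg, sub_zero, ← hcard]
      rw [Matrix.det_apply] at hdet ⊢
      refine S.L_sum_le _ _ v _ hdet fun σ _ _ => ?_
      rw [(IsU.of_sign S (IsU.prod fun i _ => hU (σ i) i) _).2,
        S.L_prod _ _ (fun i _ => (hU _ _).1), Finset.sum_apply, herr', ← Finset.sum_add_distrib]
      exact Finset.sum_le_sum fun i _ => hle _ _ _
    · rw [max_eq_right hpos, ← hcard]
      have hd : τ.det = (τ.updateCol i₀ fun _ => 1).det := by
        have := Matrix.det_updateCol_sum τ i₀ (fun _ => 1)
        simpa [hsum] using this.symm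
      rw [hd, Matrix.det_apply] at hdet ⊢
      refine S.L_sum_le _ _ v _ hdet fun σ _ _ => ?_
      have hU' : ∀ j i, S.IsU ((τ.updateCol i₀ fun _ => 1) j i) := by
        intro j i
        by_cases hi : i = i₀
        · subst hi; simpa using IsU.one
        · simpa [Matrix.updateCol_ne hi] using hU j i
      rw [(IsU.of_sign S (IsU.prod fun i _ => hU' (σ i) i) _).2,
        S.L_prod _ _ (fun i _ => (hU' _ _).1), Finset.sum_apply, herr',
        ← Finset.sum_erase_add _ _ (Finset.mem_univ i₀),
        ← Finset.sum_erase_add _ (fun i => P i v) (Finset.mem_univ i₀),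
        ← Finset.sum_erase_add _ (fun i => ∑ j, |(S.L (τ j i) - P i) v|) (Finset.mem_univ i₀)]
      have h1 : ∑ i ∈ Finset.univ.erase i₀, S.L ((τ.updateCol i₀ fun _ => 1) (σ i) i) v ≤
          ∑ i ∈ Finset.univ.erase i₀, (P i v + ∑ j, |(S.L (τ j i) - P i) v|) := by
        refine Finset.sum_le_sum fun i hi => ?_
        rw [Matrix.updateCol_ne (Finset.ne_of_mem_erase hi)]
        exact hle _ _ _
      rw [Finset.sum_add_distrib] at h1
      have h2 : 0 ≤ ∑ j, |(S.L (τ j i₀) - P i₀) v| := Finset.sum_nonneg fun _ _ => abs_nonneg _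
      have h3 : S.L ((τ.updateCol i₀ fun _ => 1) (σ i₀) i₀) v = 0 := by simp [L_one]
      linarith
  have htot := Finset.sum_le_sum fun v (_ : v ∈ Finset.univ) => key v
  have hr : 0 < (Fintype.card ι : ℝ) := by exact_mod_cast Fintype.card_pos_iff.2 ⟨i₀⟩
  have herrsum : ∑ v, err v ≤ H / 4 := by
    rw [herr, Finset.sum_comm]
    have : ∀ j, ∑ v, ∑ i, |(S.L (τ j i) - P i) v| = ∑ i, S.nrm (S.L (τ j i) - P i) :=
      fun j => Finset.sum_comm
    simp_rw [this]
    refine (Finset.sum_le_sum fun j _ => Finset.sum_le_sum fun i _ => hclose j i).trans ?_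
    simp only [Finset.sum_const, Finset.card_univ, nsmul_eq_mul]
    field_simp
    exact le_rfl
  rw [Finset.sum_add_distrib, Finset.sum_add_distrib, Finset.sum_sub_distrib, Finset.sum_comm,
    ← Finset.sum_mul] at htot
  simp only [hP, Finset.sum_const_zero] at htot
  have := S.nrm_eq_two_mul_sum_max _ (hP i₀)
  change _ ≤ S.deg * _ + _ at htot
  change 0 ≤ ∑ v, S.L τ.det v at hpr
  linarith

/-- A set of vectors all of whose maximal minors vanish lies in a hyperplane. -/
lemma exists_hyperplane_of_det_eq_zero {ι : Type*} [Fintype ι] [DecidableEq ι]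
    (Y : Set (ι → K)) (h : ∀ τ : Matrix ι ι K, (∀ j, τ j ∈ Y) → τ.det = 0) :
    ∃ b : ι → K, b ≠ 0 ∧ ∀ y ∈ Y, ∑ i, b i * y i = 0 := by
  by_cases htop : Submodule.span K Y = ⊤
  · exfalso
    let B := Module.Basis.ofSpan htop.ge
    have hsub : Set.range B ⊆ Y := Module.Basis.ofSpan_subset htop.ge
    let B' := B.reindex (B.indexEquiv (Pi.basisFun K ι))
    have hdet := h (fun j => B' j) (fun j => by
      rw [Module.Basis.reindex_apply]
      exact hsub ⟨_, rfl⟩)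
    have hli : LinearIndependent K (fun j => B' j) := B'.linearIndependent
    have := (Matrix.linearIndependent_rows_iff_isUnit (A := (Matrix.of fun j => B' j))).1 hli
    rw [Matrix.isUnit_iff_isUnit_det] at this
    exact this.ne_zero hdet
  · obtain ⟨f, hf0, hf⟩ := Submodule.exists_le_ker_of_lt_top _ (lt_top_iff_ne_top.2 htop)
    refine ⟨fun i => f (Pi.single i 1), fun h0 => hf0 ?_, fun y hy => ?_⟩
    · refine LinearMap.pi_ext' fun i => LinearMap.ext_ring ?_
      simpa using congrFun h0 i
    · have h1 : f y = 0 := hf (Submodule.subset_span hy)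
      rw [← h1, LinearMap.pi_apply_eq_sum_univ f y]
      exact Finset.sum_congr rfl fun i _ => by
        rw [smul_eq_mul, mul_comm]
        have : (Pi.single i 1 : ι → K) = fun j => if i = j then 1 else 0 := by
          ext j
          simp [Pi.single_apply, eq_comm]
        simp only [this]

/-- Vectors of sum one in a small cell far from the origin lie on a hyperplane. -/
lemma exists_hyperplane_of_close {ι : Type*} [Fintype ι] [DecidableEq ι] [Nonempty ι]
    (Y : Set (ι → K)) (hU : ∀ y ∈ Y, ∀ i, S.IsU (y i)) (hsum : ∀ y ∈ Y, ∑ i, y i = 1)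
    (H : ℝ) (hlarge : 4 * S.deg * Real.log (Fintype.card ι).factorial < H)
    (hbig : ∀ y ∈ Y, ∃ i, H ≤ S.nrm (S.L (y i)))
    (hclose : ∀ y ∈ Y, ∀ z ∈ Y, ∀ i,
      S.nrm (S.L (y i) - S.L (z i)) ≤ H / (4 * (Fintype.card ι : ℝ) ^ 2)) :
    ∃ b : ι → K, b ≠ 0 ∧ ∀ y ∈ Y, ∑ i, b i * y i = 0 := by
  refine exists_hyperplane_of_det_eq_zero Y fun τ hτ => ?_
  obtain ⟨j₀⟩ := ‹Nonempty ι›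
  obtain ⟨i₀, hi₀⟩ := hbig _ (hτ j₀)
  exact S.det_eq_zero_of_close τ (fun j i => hU _ (hτ j) i) (fun j => hsum _ (hτ j))
    (fun i => S.L (τ j₀ i)) (fun i => (hU _ (hτ j₀) i).sum_L) i₀ H hi₀ hlarge
    (fun j i => hclose _ (hτ j) _ (hτ j₀) i)

end PlaceSystem

namespace PlaceSystem

variable {K : Type} [Field K] (S : PlaceSystem K)

lemma natCast_ne_zero {K : Type} [Field K] (S : PlaceSystem K) {n : ℕ} (hn : n ≠ 0) : (n : K) ≠ 0 := by
  obtain ⟨v, hv⟩ : ∃ v, S.w v ≠ 0 := by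
    by_contra! h
    have := S.deg_pos
    simp [h] at this
  rcases S.place v with h | h
  · exact absurd h.1 hv
  · intro h0
    have := h.2 n
    rw [h0, map_zero] at this
    exact hn (by exact_mod_cast this.symm)

/-- The closed unit ball of a nonarchimedean absolute value. -/
def unitBall (v : S.V) (h : IsNonarchimedean (S.ab v)) : Subring K where
  carrier := {x | S.ab v x ≤ 1}
  mul_mem' {a b} ha hb := by
    simp only [Set.mem_ofPred_eq, map_mul] at *
    exact mul_le_one₀ ha ((S.ab v).nonneg _) hb
  one_mem' := by simp
  add_mem' {a b} ha hb := (h a b).trans (max_le ha hb)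
  zero_mem' := by simp
  neg_mem' {a} ha := by
    simp only [Set.mem_ofPred_eq, (S.ab v).map_neg] at *
    exact ha

lemma exists_sum_pow_eq {R ι : Type*} [CommRing R] {p : ℕ} (hp : p.Prime) (A : Subring R)
    (s : Finset ι) (f : ι → R) (hf : ∀ i ∈ s, f i ∈ A) :
    ∃ z ∈ A, (∑ i ∈ s, f i) ^ p = ∑ i ∈ s, f i ^ p + p * z := by
  classical
  induction s using Finset.induction_on with
  | empty => exact ⟨0, A.zero_mem, by simp [hp.ne_zero]⟩
  | insert a s ha ih =>
    obtain ⟨z, hz, h⟩ := ih fun i hi => hf i (Finset.mem_insert_of_mem hi)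
    have h1 : f a ∈ A := hf a (Finset.mem_insert_self a s)
    have h2 : ∑ i ∈ s, f i ∈ A := A.sum_mem fun i hi => hf i (Finset.mem_insert_of_mem hi)
    obtain ⟨y, hy⟩ := exists_add_pow_prime_eq hp (⟨f a, h1⟩ : A) ⟨∑ i ∈ s, f i, h2⟩
    have hy' := congrArg A.subtype hy
    simp only [map_pow, map_add, map_mul, map_natCast, Subring.subtype_apply] at hy'
    refine ⟨f a * (∑ i ∈ s, f i) * y + z, A.add_mem (A.mul_mem (A.mul_mem h1 h2) y.2) hz, ?_⟩
    rw [Finset.sum_insert ha, Finset.sum_insert ha, hy', h]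
    ring

/-- Passing from exponent `q` to exponent `q * p` in vanishing power sums. -/
lemma sum_pow_mul_prime_eq_zero {ι : Type*} [Fintype ι] [Nonempty ι] (m : ι → K)
    (hU : ∀ i, S.IsU (m i)) (ε : ℝ) (hε : ∀ i, S.nrm (S.L (m i)) ≤ ε * S.deg) {p q : ℕ}
    (hp : p.Prime) (hlt : (q * p : ℕ) * (Fintype.card ι * ε) < Real.log (p / Fintype.card ι))
    (hq : ∑ i, m i ^ q = 0) :
    ∑ i, m i ^ (q * p) = 0 := by
  have hp0 : (p : K) ≠ 0 := S.natCast_ne_zero hp.ne_zero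
  have hpR : 0 < (p : ℝ) := by exact_mod_cast hp.pos
  have hn : 0 < (Fintype.card ι : ℝ) := by exact_mod_cast Fintype.card_pos
  obtain ⟨z, hz, h⟩ := exists_sum_pow_eq hp S.O Finset.univ (fun i => m i ^ q)
    fun i _ => ((hU i).pow q).2.1
  simp only [hq, ← pow_mul, zero_pow hp.ne_zero] at h
  have hsum : ∑ i, m i ^ (q * p) = p * -z := by linear_combination -h
  by_contra hne
  have hz0 : -z ≠ 0 := by
    intro h0
    rw [h0, mul_zero] at hsum
    exact hne hsum
  have hpr := S.prod (-z) (S.O.neg_mem hz) hz0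
  have hle : ∀ i v, S.L (m i ^ (q * p)) v ≤ (q * p : ℕ) * ∑ i, |S.L (m i) v| := by
    intro i v
    rw [L_pow, Pi.smul_apply, smul_eq_mul]
    gcongr
    exact (le_abs_self _).trans
      (Finset.single_le_sum (f := fun i => |S.L (m i) v|) (fun _ _ => abs_nonneg _)
        (Finset.mem_univ i))
  have key : ∀ v, S.L (-z) v ≤ S.w v * -Real.log (p / Fintype.card ι) +
      (q * p : ℕ) * ∑ i, |S.L (m i) v| := by
    intro v
    rcases S.place v with ⟨h0, hna⟩ | ⟨h1, hnat⟩
    · rw [h0, zero_mul, zero_add]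
      obtain ⟨j, -, hj⟩ := Finset.exists_max_image Finset.univ (fun i => S.ab v (m i))
        Finset.univ_nonempty
      have hj' : 0 < S.ab v (m j) := S.ab_pos (hU j).1 v
      obtain ⟨y, hy, hy'⟩ := exists_sum_pow_eq hp (S.unitBall v hna) Finset.univ
        (fun i => m i ^ q / m j ^ q) (fun i _ => by
          change S.ab v _ ≤ 1
          rw [map_div₀, map_pow, map_pow]
          exact div_le_one_of_le₀ (by gcongr; exact hj i (Finset.mem_univ i)) (by positivity))
      simp only [div_pow, ← Finset.sum_div, hq, zero_div, zero_pow hp.ne_zero, ← pow_mul,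
        hsum] at hy'
      have hzy : -z = -y * m j ^ (q * p) := by
        have hm : m j ^ (q * p) ≠ 0 := pow_ne_zero _ (hU j).1
        have h3 : (p : K) * (-z / m j ^ (q * p) + y) = 0 := by linear_combination -hy'
        have h4 := (mul_eq_zero.1 h3).resolve_left hp0
        field_simp at h4
        linear_combination h4
      refine le_trans ?_ (hle j v)
      refine Real.log_le_log (S.ab_pos hz0 v) ?_
      rw [hzy, map_mul, (S.ab v).map_neg]
      exact mul_le_of_le_one_left ((S.ab v).nonneg _) hy
    · rw [h1, one_mul]
      have h2 := S.L_sum_le Finset.univ (fun i => m i ^ (q * p)) v _ hne fun i _ _ => hle i v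
      rw [hsum, L_mul S hp0 hz0, h1, one_mul, Finset.card_univ, Pi.add_apply] at h2
      rw [Real.log_div hpR.ne' hn.ne']
      have h3 : S.L (p : K) v = Real.log p := by rw [L, hnat]
      linarith
  have htot := Finset.sum_le_sum fun v (_ : v ∈ Finset.univ) => key v
  rw [Finset.sum_add_distrib, ← Finset.sum_mul, ← Finset.mul_sum, Finset.sum_comm] at htot
  change _ ≤ S.deg * _ + _ * ∑ i, S.nrm (S.L (m i)) at htot
  change 0 ≤ ∑ v, S.L (-z) v at hpr
  have h5 : ∑ i, S.nrm (S.L (m i)) ≤ Fintype.card ι * (ε * S.deg) := by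
    refine (Finset.sum_le_sum fun i _ => hε i).trans ?_
    simp
  have h6 : (q * p : ℕ) * ∑ i, S.nrm (S.L (m i)) ≤
      (q * p : ℕ) * (Fintype.card ι * (ε * S.deg)) := by gcongr
  have h7 := mul_lt_mul_of_pos_left hlt S.deg_pos'
  linarith

/-- Vanishing sums of few units of small relative height split into vanishing sums over classes
modulo roots of unity. -/
lemma sum_class_eq_zero {ι : Type*} [Fintype ι] [Nonempty ι] [DecidableEq K] (m : ι → K)
    (hU : ∀ i, S.IsU (m i)) (ε : ℝ) (hε0 : 0 ≤ ε)
    (hε : ∀ i, S.nrm (S.L (m i)) ≤ ε * S.deg)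
    (hlt : (1 + Fintype.card ι * (Fintype.card ι).factorial : ℕ) * (Fintype.card ι * ε) <
      Real.log ((Fintype.card ι + 1) / Fintype.card ι))
    (hsum : ∑ i, m i = 0) (y : K) :
    ∑ i with m i ^ (Fintype.card ι).factorial = y, m i = 0 := by
  set n := Fintype.card ι with hn
  have hnpos : 0 < n := Fintype.card_pos
  have hnR : 0 < (n : ℝ) := by exact_mod_cast hnpos
  have h1 : ∀ q, q ≠ 0 → q ≤ 1 + n * n.factorial → (∀ p, p.Prime → p ∣ q → n < p) →
      ∑ i, m i ^ q = 0 := by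
    intro q
    induction q using Nat.strong_induction_on with
    | _ q ih =>
      intro hq0 hqQ hq
      by_cases hq1 : q = 1
      · simpa [hq1] using hsum
      · have hp := Nat.minFac_prime hq1
        have hdvd := Nat.minFac_dvd q
        set p := q.minFac
        obtain ⟨c, hc⟩ := hdvd
        have hc0 : c ≠ 0 := by rintro rfl; simp [hc] at hq0
        have hclt : c < q := by
          rw [hc]; exact lt_mul_of_one_lt_left (Nat.pos_of_ne_zero hc0) hp.one_lt
        have hih := ih c hclt hc0 (hclt.le.trans hqQ)
          (fun p' hp' hd => hq p' hp' (hc ▸ hd.mul_left p))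
        rw [hc, mul_comm]
        refine S.sum_pow_mul_prime_eq_zero m hU ε hε hp ?_ hih
        have hnp : n + 1 ≤ p := hq p hp (Nat.minFac_dvd q)
        have hcp : c * p ≤ 1 + n * n.factorial := by rw [mul_comm, ← hc]; exact hqQ
        calc ((c * p : ℕ) : ℝ) * (n * ε) ≤ (1 + n * n.factorial : ℕ) * (n * ε) := by
              gcongr
          _ < Real.log ((n + 1) / n) := hlt
          _ ≤ Real.log (p / n) := by
              gcongr
              exact_mod_cast hnp
  have h2 : ∀ j < n, ∑ i, m i * (m i ^ n.factorial) ^ j = 0 := by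
    intro j hj
    have := h1 (1 + n.factorial * j) (by omega) (by nlinarith [n.factorial_pos]) (by
      intro p hp hd
      by_contra hle
      have h3 : p ∣ n.factorial * j := ((hp.dvd_factorial).2 (not_lt.1 hle)).mul_right j
      have h4 := (Nat.dvd_add_left h3).1 hd
      exact hp.one_lt.ne' (Nat.dvd_one.1 h4))
    rw [← this]
    exact Finset.sum_congr rfl fun i _ => by rw [pow_add, pow_one, pow_mul]
  have h3 : ∀ P : Polynomial K, P.natDegree < n → ∑ i, m i * P.eval (m i ^ n.factorial) = 0 := by
    intro P hP
    simp_rw [Polynomial.eval_eq_sum_range' hP, Finset.mul_sum]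
    rw [Finset.sum_comm]
    refine Finset.sum_eq_zero fun j hj => ?_
    have := h2 j (Finset.mem_range.1 hj)
    calc ∑ i, m i * (P.coeff j * (m i ^ n.factorial) ^ j)
        = P.coeff j * ∑ i, m i * (m i ^ n.factorial) ^ j := by
          rw [Finset.mul_sum]
          exact Finset.sum_congr rfl fun i _ => by ring
      _ = 0 := by rw [this, mul_zero]
  set W := Finset.univ.image fun i => m i ^ n.factorial with hW
  by_cases hy : y ∈ W
  · have h4 := h3 (∏ z ∈ W.erase y, (Polynomial.X - Polynomial.C z)) (by
      rw [Polynomial.natDegree_finsetProd_X_sub_C_eq_card, Finset.card_erase_of_mem hy]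
      have : W.card ≤ n := Finset.card_image_le
      omega)
    simp only [Polynomial.eval_prod, Polynomial.eval_sub, Polynomial.eval_X,
      Polynomial.eval_C] at h4
    rw [← Finset.sum_filter_add_sum_filter_not Finset.univ
      (fun i => m i ^ n.factorial = y)] at h4
    have h5 : ∑ i with ¬ m i ^ n.factorial = y,
        m i * ∏ z ∈ W.erase y, (m i ^ n.factorial - z) = 0 := by
      refine Finset.sum_eq_zero fun i hi => ?_
      rw [Finset.prod_eq_zero (i := m i ^ n.factorial), mul_zero]
      · exact Finset.mem_erase.2 ⟨(Finset.mem_filter.1 hi).2,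
          Finset.mem_image_of_mem _ (Finset.mem_univ i)⟩
      · exact sub_self _
    have h6 : ∑ i with m i ^ n.factorial = y, m i * ∏ z ∈ W.erase y, (m i ^ n.factorial - z)
        = (∑ i with m i ^ n.factorial = y, m i) * ∏ z ∈ W.erase y, (y - z) := by
      rw [Finset.sum_mul]
      exact Finset.sum_congr rfl fun i hi => by rw [(Finset.mem_filter.1 hi).2]
    rw [h5, h6, add_zero] at h4
    refine (mul_eq_zero.1 h4).resolve_right (Finset.prod_ne_zero_iff.2 fun z hz => ?_)
    exact sub_ne_zero.2 (Finset.ne_of_mem_erase hz).symm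
  · rw [Finset.filter_false_of_mem, Finset.sum_empty]
    intro i _ hi
    exact hy (hi ▸ Finset.mem_image_of_mem _ (Finset.mem_univ i))

end PlaceSystem

namespace PlaceSystem

variable {K : Type} [Field K] (S : PlaceSystem K)

lemma exists_some_of_ne {ι : Type*} {σ : Equiv.Perm (Option ι)} (h : σ none ≠ none) :
    ∃ i, σ (some i) = none := by
  obtain ⟨k, hk⟩ := σ.surjective none
  cases k with
  | none => exact absurd hk h
  | some i => exact ⟨i, hk⟩

section bordered

variable {ι : Type*} [Fintype ι] [DecidableEq ι]

/-- The matrix `τ` with an additional first row `(1, y)` and first column of ones. -/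
def bordered (τ : Matrix ι ι K) (y : ι → K) : Matrix (Option ι) (Option ι) K :=
  fun j i => match j, i with
    | none, none => 1
    | none, some i => y i
    | some _, none => 1
    | some j, some i => τ j i

/-- The monomials of the determinant of the bordered matrix. -/
def monom (τ : Matrix ι ι K) (y : ι → K) (σ : Equiv.Perm (Option ι)) : K :=
  Equiv.Perm.sign σ • ∏ i, bordered τ y (σ i) i

lemma sum_monom (τ : Matrix ι ι K) (y : ι → K) :
    ∑ σ, monom τ y σ = (bordered τ y).det := by
  rw [Matrix.det_apply]
  rfl

lemma det_bordered_eq_zero (τ : Matrix ι ι K) (y : ι → K) (hτ : ∀ j, ∑ i, τ j i = 1)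
    (hy : ∑ i, y i = 1) : (bordered τ y).det = 0 := by
  refine Matrix.exists_mulVec_eq_zero_iff.1 ⟨fun i => i.elim (-1) fun _ => 1, fun h => ?_, ?_⟩
  · simpa using congrFun h none
  · ext j
    rw [Matrix.mulVec, dotProduct, Fintype.sum_option]
    cases j <;> simp [bordered, hτ, hy]

lemma monom_of_none {τ : Matrix ι ι K} (y : ι → K) {σ : Equiv.Perm (Option ι)}
    (h : σ none = none) : monom τ y σ = monom τ 1 σ := by
  unfold monom
  congr 1
  refine Finset.prod_congr rfl fun i _ => ?_
  cases i with
  | none => cases hσ : σ none <;> rfl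
  | some i =>
    cases hσ : σ (some i) with
    | none => exact absurd (σ.injective (hσ.trans h.symm)) (by simp)
    | some j => rfl

lemma monom_of_some {τ : Matrix ι ι K} (y : ι → K) {σ : Equiv.Perm (Option ι)} {i : ι}
    (h : σ (some i) = none) : monom τ y σ = y i * monom τ 1 σ := by
  unfold monom
  rw [mul_smul_comm]
  congr 1
  rw [← Finset.mul_prod_erase _ _ (Finset.mem_univ (some i)),
    ← Finset.mul_prod_erase _ (fun i => bordered τ 1 (σ i) i) (Finset.mem_univ (some i)), h,
    ← mul_assoc]
  congr 1
  · simp [bordered]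
  · refine Finset.prod_congr rfl fun k hk => ?_
    cases hσ : σ k with
    | none => exact absurd (σ.injective (hσ.trans h.symm)) (Finset.ne_of_mem_erase hk)
    | some j => cases k <;> rfl

lemma sum_monom_none_ne_zero {τ : Matrix ι ι K} (y : ι → K) (hτ : τ.det ≠ 0) :
    ∑ σ : Equiv.Perm (Option ι) with σ none = none, monom τ y σ ≠ 0 := by
  have h1 : ∑ σ : Equiv.Perm (Option ι) with σ none = none, monom τ y σ
      = (bordered τ 0).det := by
    rw [← sum_monom, ← Finset.sum_filter_add_sum_filter_not Finset.univ
      (fun σ : Equiv.Perm (Option ι) => σ none = none) (monom τ 0)]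
    rw [Finset.sum_congr rfl fun σ hσ => monom_of_none y (Finset.mem_filter.1 hσ).2,
      Finset.sum_congr rfl fun σ hσ =>
        monom_of_none (τ := τ) 0 (Finset.mem_filter.1 hσ).2, left_eq_add]
    refine Finset.sum_eq_zero fun σ hσ => ?_
    obtain ⟨i, hi⟩ := exists_some_of_ne (Finset.mem_filter.1 hσ).2
    rw [monom_of_some 0 hi, Pi.zero_apply, zero_mul]
  rw [h1]
  intro h
  obtain ⟨v, hv, hv'⟩ := Matrix.exists_mulVec_eq_zero_iff.2 h
  have h2 : v none = 0 := by
    have := congrFun hv' none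
    simpa [Matrix.mulVec, dotProduct, Fintype.sum_option, bordered] using this
  refine hτ (Matrix.exists_mulVec_eq_zero_iff.1 ⟨fun i => v (some i), fun h3 => hv ?_, ?_⟩)
  · ext i
    cases i with
    | none => exact h2
    | some i => exact congrFun h3 i
  · ext j
    have := congrFun hv' (some j)
    simpa [Matrix.mulVec, dotProduct, Fintype.sum_option, bordered, h2] using this

lemma IsU.monom {τ : Matrix ι ι K} {y : ι → K} (hτ : ∀ j i, S.IsU (τ j i))
    (hy : ∀ i, S.IsU (y i)) (σ : Equiv.Perm (Option ι)) : S.IsU (monom τ y σ) := by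
  refine (IsU.of_sign S (IsU.prod fun i _ => ?_) _).1
  cases σ i <;> cases i
  exacts [IsU.one, hy _, IsU.one, hτ _ _]

lemma nrm_monom_sub_le {τ : Matrix ι ι K} {y : ι → K} (hτ : ∀ j i, S.IsU (τ j i))
    (hy : ∀ i, S.IsU (y i)) (c : ℝ) (hc0 : 0 ≤ c)
    (h1 : ∀ j i, S.nrm (S.L (τ j i) - S.L (y i)) ≤ c)
    (σ : Equiv.Perm (Option ι)) :
    S.nrm (S.L (monom τ y σ) - ∑ i, S.L (y i)) ≤ Fintype.card ι * c := by
  have hB : ∀ j i, S.IsU (bordered τ y j i) := by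
    intro j i
    cases j <;> cases i
    exacts [IsU.one, hy _, IsU.one, hτ _ _]
  have h2 : S.L (PlaceSystem.monom τ y σ) - ∑ i, S.L (y i)
      = ∑ i, (S.L (bordered τ y (σ (some i)) (some i)) - S.L (y i)) := by
    have h3 : S.L (bordered τ y (σ none) none) = 0 := by
      cases σ none <;> exact S.L_one
    rw [PlaceSystem.monom, (IsU.of_sign S (IsU.prod fun i _ => hB _ _) _).2,
      S.L_prod _ _ (fun i _ => (hB _ _).1), Fintype.sum_option, h3, zero_add,
      Finset.sum_sub_distrib]
  rw [h2]
  refine (S.nrm_sum _ _).trans ?_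
  refine (Finset.sum_le_sum (g := fun _ => c) fun i _ => ?_).trans (by simp)
  cases σ (some i) with
  | none => simpa [bordered, nrm] using hc0
  | some j => exact h1 j i

/-- Vectors of units of sum one in a cell of small radius lie on a bounded number of
hyperplanes. -/
lemma exists_hyperplanes_of_small (hcard : 2 ≤ Fintype.card ι) (ε : ℝ) (hε0 : 0 ≤ ε)
    (hlt : (1 + (Fintype.card ι + 1).factorial * (Fintype.card ι + 1).factorial.factorial : ℕ) *
      ((Fintype.card ι + 1).factorial * (2 * Fintype.card ι * ε)) <
      Real.log (((Fintype.card ι + 1).factorial + 1) / (Fintype.card ι + 1).factorial))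
    (Y : Set (ι → K)) (hU : ∀ y ∈ Y, ∀ i, S.IsU (y i)) (hsum : ∀ y ∈ Y, ∑ i, y i = 1)
    (hclose : ∀ y ∈ Y, ∀ z ∈ Y, ∀ i, S.nrm (S.L (y i) - S.L (z i)) ≤ ε * S.deg) :
    ∃ B : Finset (ι → K), B.card ≤ Fintype.card ι * ((Fintype.card ι + 1).factorial *
        (Fintype.card ι + 1).factorial) * (Fintype.card ι + 1).factorial.factorial ∧
      (∀ b ∈ B, b ≠ 0) ∧ ∀ y ∈ Y, ∃ b ∈ B, ∑ i, b i * y i = 0 := by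
  classical
  have hn : Fintype.card (Equiv.Perm (Option ι)) = (Fintype.card ι + 1).factorial := by
    rw [Fintype.card_perm, Fintype.card_option]
  set n := (Fintype.card ι + 1).factorial with hn'
  have hM : 0 < n.factorial := Nat.factorial_pos _
  by_cases hdet : ∀ τ : Matrix ι ι K, (∀ j, τ j ∈ Y) → τ.det = 0
  · obtain ⟨b, hb0, hb⟩ := exists_hyperplane_of_det_eq_zero Y hdet
    refine ⟨{b}, ?_, by simpa using hb0, fun y hy => ⟨b, by simp, hb y hy⟩⟩
    rw [Finset.card_singleton]
    have : 0 < n := Nat.factorial_pos _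
    exact Nat.succ_le_of_lt (by positivity)
  push Not at hdet
  obtain ⟨τ, hτ, hdet⟩ := hdet
  let F : ι × (Equiv.Perm (Option ι) × Equiv.Perm (Option ι)) → Finset (ι → K) := fun p =>
    (Polynomial.nthRoots n.factorial
      ((monom τ 1 p.2.1 / monom τ 1 p.2.2) ^ n.factorial)).toFinset.image
      fun ξ => Pi.single p.1 1 - fun _ => ξ
  refine ⟨Finset.univ.biUnion F, ?_, ?_, ?_⟩
  · refine (Finset.card_biUnion_le_card_mul _ _ n.factorial fun p _ => ?_).trans ?_
    · exact Finset.card_image_le.trans ((Multiset.toFinset_card_le _).trans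
        (Polynomial.card_nthRoots _ _))
    · rw [Finset.card_univ, Fintype.card_prod, Fintype.card_prod, hn]
  · intro b hb hb0
    obtain ⟨p, -, hp⟩ := Finset.mem_biUnion.1 hb
    obtain ⟨ξ, -, rfl⟩ := Finset.mem_image.1 hp
    obtain ⟨j, hj⟩ := Fintype.exists_ne_of_one_lt_card hcard p.1
    have h1 := congrFun hb0 p.1
    have h2 := congrFun hb0 j
    simp only [Pi.sub_apply, Pi.single_apply, hj, Pi.zero_apply, if_true, if_false] at h1 h2
    rw [zero_sub, neg_eq_zero] at h2
    rw [h2, sub_zero] at h1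
    exact one_ne_zero h1
  · intro y hy
    have hτU : ∀ j i, S.IsU (τ j i) := fun j => hU _ (hτ j)
    have hyU := hU y hy
    set m₀ := monom τ y 1 with hm₀
    have hmU := fun σ => IsU.monom S hτU hyU σ
    have hd : 0 ≤ ε * S.deg := mul_nonneg hε0 S.deg_pos'.le
    have hnear := S.nrm_monom_sub_le hτU hyU (ε * S.deg) hd
      (fun j i => hclose _ (hτ j) _ hy i)
    have hvan := S.sum_class_eq_zero (fun σ => monom τ y σ / m₀)
      (fun σ => (hmU σ).div (hmU 1)) (2 * Fintype.card ι * ε) (by positivity)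
      (fun σ => by
        rw [S.L_div (hmU σ).1 (hmU 1).1]
        have := S.nrm_sub (S.L (monom τ y σ) - ∑ i, S.L (y i))
          (S.L (monom τ y 1) - ∑ i, S.L (y i))
        rw [sub_sub_sub_cancel_right] at this
        linarith [hnear σ, hnear 1]) (by rw [hn]; exact hlt)
      (by rw [← Finset.sum_div, sum_monom, det_bordered_eq_zero τ y (fun j => hsum _ (hτ j))
        (hsum y hy), zero_div])
    rw [hn] at hvan
    have hco : ∃ σ σ' : Equiv.Perm (Option ι), σ none = none ∧ σ' none ≠ none ∧
        (monom τ y σ' / m₀) ^ n.factorial = (monom τ y σ / m₀) ^ n.factorial := by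
      by_contra! hno
      refine sum_monom_none_ne_zero y hdet ?_
      have h3 : ∑ σ : Equiv.Perm (Option ι) with σ none = none, monom τ y σ / m₀ = 0 := by
        rw [← Finset.sum_fiberwise_of_maps_to (t := (Finset.univ.filter
          fun σ : Equiv.Perm (Option ι) => σ none = none).image
            fun σ => (monom τ y σ / m₀) ^ n.factorial)
          (g := fun σ => (monom τ y σ / m₀) ^ n.factorial)
          (fun σ hσ => Finset.mem_image_of_mem _ hσ)]
        refine Finset.sum_eq_zero fun z hz => ?_
        obtain ⟨σ, hσ, rfl⟩ := Finset.mem_image.1 hz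
        rw [← hvan ((monom τ y σ / m₀) ^ n.factorial)]
        refine Finset.sum_congr ?_ fun _ _ => rfl
        ext σ'
        simp only [Finset.mem_filter, Finset.mem_univ, true_and, and_iff_right_iff_imp]
        intro h
        by_contra h'
        exact hno σ σ' (Finset.mem_filter.1 hσ).2 h' h
      rw [← Finset.sum_div, div_eq_zero_iff] at h3
      exact h3.resolve_right (hmU 1).1
    obtain ⟨σ, σ', hσ, hσ', heq⟩ := hco
    obtain ⟨i, hi⟩ := exists_some_of_ne hσ'
    have h1U : ∀ σ, S.IsU (monom τ 1 σ) := fun σ => IsU.monom S hτU (fun _ => IsU.one) σ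
    rw [div_pow, div_pow, div_left_inj' (pow_ne_zero _ (hmU 1).1), monom_of_none y hσ,
      monom_of_some y hi] at heq
    have hroot : y i ^ n.factorial = (monom τ 1 σ / monom τ 1 σ') ^ n.factorial := by
      rw [div_pow, eq_div_iff (pow_ne_zero _ (h1U σ').1), ← mul_pow, heq]
    refine ⟨Pi.single i 1 - fun _ => y i, ?_, ?_⟩
    · refine Finset.mem_biUnion.2 ⟨(i, σ, σ'), Finset.mem_univ _, Finset.mem_image.2 ⟨y i, ?_, rfl⟩⟩
      rw [Multiset.mem_toFinset, Polynomial.mem_nthRoots hM]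
      exact hroot
    · simp only [Pi.sub_apply, sub_mul, Finset.sum_sub_distrib, ← Finset.mul_sum, hsum y hy]
      simp [Pi.single_apply]

end bordered

end PlaceSystem

namespace PlaceSystem

open Polynomial

variable {K : Type} [Field K]

/-- The integral of a polynomial over the unit interval. -/
noncomputable def unitIntegral : K[X] →ₗ[K] K :=
  Polynomial.lsum fun k => ((k : K) + 1)⁻¹ • LinearMap.id

lemma unitIntegral_C_mul (a : K) (P : K[X]) :
    unitIntegral (C a * P) = a * unitIntegral P := by
  rw [← smul_eq_C_mul, map_smul, smul_eq_mul]

lemma unitIntegral_eq_sum (P : K[X]) {M : ℕ} (hM : P.natDegree < M) :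
    unitIntegral P = ∑ k ∈ Finset.range M, ((k : K) + 1)⁻¹ * P.coeff k := by
  rw [unitIntegral, Polynomial.lsum_apply]
  exact P.sum_over_range' (fun k => by simp) M hM

lemma unitIntegral_derivative [CharZero K] (P : K[X]) :
    unitIntegral (derivative P) = P.eval 1 - P.eval 0 := by
  induction P using Polynomial.induction_on' with
  | add p q hp hq => simp only [map_add, hp, hq, eval_add]; ring
  | monomial n a =>
    rw [derivative_monomial, unitIntegral, Polynomial.lsum_apply, Polynomial.sum_monomial_index]
    · rcases n with _ | n
      · simp
      · have : (n : K) + 1 ≠ 0 := by exact_mod_cast n.succ_ne_zero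
        simp
        field_simp
    · simp

lemma exists_derivative_eq [CharZero K] (P : K[X]) :
    ∃ H : K[X], derivative H = P ∧ H.eval 0 = 0 := by
  induction P using Polynomial.induction_on' with
  | add p q hp hq =>
    obtain ⟨A, hA, hA'⟩ := hp
    obtain ⟨B, hB, hB'⟩ := hq
    exact ⟨A + B, by simp [hA, hB], by simp [hA', hB']⟩
  | monomial n a =>
    have : (n : K) + 1 ≠ 0 := by exact_mod_cast n.succ_ne_zero
    refine ⟨monomial (n + 1) (a / (n + 1)), ?_, by simp⟩
    rw [derivative_monomial]
    congr 1
    push_cast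
    field_simp

lemma mul_unitIntegral_comp [CharZero K] {H G : K[X]} (h : derivative H = G) (e c : K) :
    e * unitIntegral (G.comp (C e * X + C c)) = H.eval (e + c) - H.eval c := by
  have := unitIntegral_derivative (H.comp (C e * X + C c))
  rw [derivative_comp, h] at this
  simp only [derivative_add, derivative_mul, derivative_C, zero_mul, derivative_X, mul_one,
    zero_add, add_zero, eval_comp, eval_add, eval_mul, eval_C, eval_X, mul_zero] at this
  rw [← this, unitIntegral_C_mul]

/-- The products of linear factors occurring as integrands. -/
noncomputable def integrand (N : ℕ) (α β γ δ : K) : K[X] :=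
  (C 1 * X + C 0) ^ N * ((C 1 * X + C (-1)) ^ N * ((C α * X + C β) ^ N * (C γ * X + C δ)))

lemma integrand_comp_left (N : ℕ) (x γ δ : K) :
    (integrand N 1 (-x) γ δ).comp (C x * X + C 0) =
      C (x ^ (2 * N)) * integrand N x (-1) (γ * x) δ := by
  simp only [integrand, mul_comp, pow_comp, add_comp, C_comp, X_comp]
  simp only [C_0, C_1, C_neg, C_mul, C_pow, one_mul, add_zero, pow_mul, sq]
  rw [show C x * X + -C x = C x * (X + -1) by ring]
  simp only [mul_pow]
  ring

lemma integrand_comp_right (N : ℕ) {x y : K} (h : x + y = 1) (γ δ : K) :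
    (integrand N 1 (-x) γ δ).comp (C y * X + C x) =
      C (y ^ (2 * N)) * integrand N y x (γ * y) (γ * x + δ) := by
  have h1 : (C x + C y : K[X]) = 1 := by rw [← C_add, h, C_1]
  simp only [integrand, mul_comp, pow_comp, add_comp, C_comp, X_comp]
  simp only [C_0, C_1, C_neg, C_mul, C_add, C_pow, one_mul, add_zero, pow_mul, sq]
  rw [show C y * X + C x + -1 = C y * (X + -1) by linear_combination h1,
    show C y * X + C x + -C x = C y * X by ring]
  simp only [mul_pow]
  ring

lemma natDegree_integrand_lt (N : ℕ) (α β γ δ : K) :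
    (integrand N α β γ δ).natDegree < 3 * N + 2 := by
  have h (α β : K) : (C α * X + C β).natDegree ≤ 1 := natDegree_linear_le
  have h' (α β : K) : ((C α * X + C β) ^ N).natDegree ≤ N := by
    refine natDegree_pow_le.trans ?_
    nlinarith [h α β]
  unfold integrand
  refine Nat.lt_succ_of_le ?_
  refine natDegree_mul_le.trans ?_
  have h1 := natDegree_mul_le (p := (C (1 : K) * X + C (-1)) ^ N)
    (q := (C α * X + C β) ^ N * (C γ * X + C δ))
  have h2 := natDegree_mul_le (p := (C α * X + C β) ^ N) (q := C γ * X + C δ)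
  have := h' 1 0
  have := h' 1 (-1)
  have := h' α β
  have := h γ δ
  omega

lemma integrals_of_antiderivative [CharZero K] (N : ℕ) {x y : K} (h : x + y = 1) (γ δ : K)
    {H : K[X]} (hH : derivative H = integrand N 1 (-x) γ δ) (hH0 : H.eval 0 = 0) :
    unitIntegral (integrand N 1 (-x) γ δ) = H.eval 1 ∧
      x ^ (2 * N + 1) * unitIntegral (integrand N x (-1) (γ * x) δ) = H.eval x ∧
      y ^ (2 * N + 1) * unitIntegral (integrand N y x (γ * y) (γ * x + δ)) =
        H.eval 1 - H.eval x := by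
  have h1 := unitIntegral_derivative H
  have h2 := mul_unitIntegral_comp hH x 0
  have h3 := mul_unitIntegral_comp hH y x
  rw [integrand_comp_left, unitIntegral_C_mul, add_zero] at h2
  rw [integrand_comp_right N h, unitIntegral_C_mul, add_comm y, h] at h3
  rw [hH] at h1
  refine ⟨by rw [h1, hH0, sub_zero], ?_, ?_⟩
  · rw [← sub_zero (H.eval x), ← hH0, ← h2]; ring
  · rw [← h3]; ring

/-- A polynomial of degree at most `3N + 2` cannot vanish to order `N + 1` at three points. -/
lemma eq_zero_of_derivative [CharZero K] (N : ℕ) {x : K} (hx0 : x ≠ 0) (hx1 : x ≠ 1) (γ δ : K)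
    {H : K[X]} (hH : derivative H = integrand N 1 (-x) γ δ) (hH0 : H.eval 0 = 0)
    (hHx : H.eval x = 0) (hH1 : H.eval 1 = 0) : γ = 0 ∧ δ = 0 := by
  by_contra hne
  have hlin : (C γ * X + C δ : K[X]) ≠ 0 := by
    intro h0
    refine hne ⟨?_, ?_⟩
    · simpa using congrArg (fun p => coeff p 1) h0
    · simpa using congrArg (fun p => coeff p 0) h0
  have hl (β : K) : (C 1 * X + C β : K[X]) ^ N ≠ 0 := by
    refine pow_ne_zero _ fun h0 => ?_
    simpa using congrArg (fun p => coeff p 1) h0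
  have hI : integrand N 1 (-x) γ δ ≠ 0 :=
    mul_ne_zero (hl _) (mul_ne_zero (hl _) (mul_ne_zero (hl _) hlin))
  have hHne : H ≠ 0 := by rintro rfl; exact hI (by rw [← hH, derivative_zero])
  classical
  have hroot : ∀ r, H.eval r = 0 → (X - C r) ^ N ∣ integrand N 1 (-x) γ δ →
      N + 1 ≤ H.roots.count r := by
    intro r hr hd
    rw [count_roots]
    have h1 := (le_rootMultiplicity_iff hI).2 hd
    rw [← hH, derivative_rootMultiplicity_of_root hr] at h1
    have h2 := (rootMultiplicity_pos hHne).2 hr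
    omega
  have h0 := hroot 0 hH0 (by
    rw [show (X - C 0 : K[X]) = C 1 * X + C 0 by simp]
    exact dvd_mul_right _ _)
  have h1 := hroot 1 hH1 (by
    rw [show (X - C 1 : K[X]) = C 1 * X + C (-1) by simp [sub_eq_add_neg]]
    exact (dvd_mul_right _ _).mul_left _)
  have hx := hroot x hHx (by
    rw [show (X - C x : K[X]) = C 1 * X + C (-x) by simp [sub_eq_add_neg]]
    exact ((dvd_mul_right _ _).mul_left _).mul_left _)
  have hcard : H.roots.card ≤ 3 * N + 2 := by
    refine (card_roots' H).trans ?_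
    have h3 := natDegree_integrand_lt N 1 (-x) γ δ
    rw [← hH, natDegree_derivative] at h3
    omega
  have hle : ∑ r ∈ ({0, 1, x} : Finset K), H.roots.count r ≤ H.roots.card := by
    refine (Finset.sum_le_sum_of_ne_zero (t := H.roots.toFinset) ?_).trans
      (Multiset.toFinset_sum_count_eq _).le
    intro r _ hr
    rw [Multiset.mem_toFinset]
    exact Multiset.count_ne_zero.1 hr
  rw [Finset.sum_insert (by simp [hx0.symm]), Finset.sum_insert (by simp [hx1.symm]),
    Finset.sum_singleton] at hle
  omega

/-- For one of the two integrands the linear form in integrals does not vanish. -/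
lemma exists_form_ne_zero [CharZero K] (N : ℕ) {x y : K} (hx0 : x ≠ 0) (hy0 : y ≠ 0)
    (h : x + y = 1) (x' : K) :
    ∃ γ δ : K, ((γ = 0 ∧ δ = 1) ∨ (γ = 1 ∧ δ = 0)) ∧
      x' * unitIntegral (integrand N 1 (-x) γ δ) -
        x ^ (2 * N + 1) * unitIntegral (integrand N x (-1) (γ * x) δ) ≠ 0 := by
  have hx1 : x ≠ 1 := by
    rintro rfl
    exact hy0 (by linear_combination h)
  by_contra! hno
  obtain ⟨A, hA, hA0⟩ := exists_derivative_eq (integrand N 1 (-x) 0 1)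
  obtain ⟨B, hB, hB0⟩ := exists_derivative_eq (integrand N 1 (-x) 1 0)
  have hA' := hno 0 1 (Or.inl ⟨rfl, rfl⟩)
  have hB' := hno 1 0 (Or.inr ⟨rfl, rfl⟩)
  rw [(integrals_of_antiderivative N h 0 1 hA hA0).1,
    (integrals_of_antiderivative N h 0 1 hA hA0).2.1] at hA'
  rw [(integrals_of_antiderivative N h 1 0 hB hB0).1,
    (integrals_of_antiderivative N h 1 0 hB hB0).2.1] at hB'
  by_cases hA1 : A.eval 1 = 0
  · have := eq_zero_of_derivative N hx0 hx1 0 1 hA hA0 (by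
      rw [hA1, mul_zero, zero_sub, neg_eq_zero] at hA'; exact hA') hA1
    exact one_ne_zero this.2
  · have := eq_zero_of_derivative N hx0 hx1 (A.eval 1) (-B.eval 1)
      (H := C (A.eval 1) * B - C (B.eval 1) * A) (by
        simp only [derivative_sub, derivative_mul, derivative_C, zero_mul, zero_add, hA, hB,
          integrand, C_0, C_1, C_neg]
        ring) (by simp [hA0, hB0])
      (by
        simp only [eval_sub, eval_mul, eval_C]
        linear_combination (A.eval 1) * (-hB') + (B.eval 1) * hA')
      (by simp only [eval_sub, eval_mul, eval_C]; ring)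
    exact hA1 this.1

end PlaceSystem

namespace PlaceSystem

open Polynomial

variable {K : Type} [Field K] (S : PlaceSystem K)

lemma charZero {K : Type} [Field K] (S : PlaceSystem K) : CharZero K :=
  charZero_of_inj_zero fun n hn => by
    by_contra h
    exact S.natCast_ne_zero h hn

lemma ab_natCast_le {n : ℕ} (hn : n ≠ 0) (v : S.V) :
    S.ab v n ≤ Real.exp (S.w v * Real.log n) := by
  have := S.ab_sum_le (Finset.range n) (by simpa using hn) (fun _ => (1 : K)) v 1 (by simp)
  simpa using this

lemma ab_add_le {a b : K} {v : S.V} {B : ℝ} (ha : S.ab v a ≤ B) (hb : S.ab v b ≤ B) :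
    S.ab v (a + b) ≤ Real.exp (S.w v * Real.log 2) * B := by
  have := S.ab_sum_le Finset.univ Finset.univ_nonempty ![a, b] v B (by
    intro i _; fin_cases i <;> simpa)
  simpa using this

lemma coeff_linear_mul_le {v : S.V} {P : K[X]} {α β : K} {μ B : ℝ}
    (hP : ∀ k, S.ab v (P.coeff k) ≤ B) (hα : S.ab v α ≤ μ) (hβ : S.ab v β ≤ μ) (k : ℕ) :
    S.ab v (((C α * X + C β) * P).coeff k) ≤ Real.exp (S.w v * Real.log 2) * (μ * B) := by
  have hμ : 0 ≤ μ := ((S.ab v).nonneg _).trans hα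
  have hB : 0 ≤ B := ((S.ab v).nonneg _).trans (hP 0)
  rw [add_mul, coeff_add, mul_assoc, coeff_C_mul, coeff_C_mul]
  refine S.ab_add_le ?_ ?_
  · cases k with
    | zero => simp; positivity
    | succ k =>
      rw [coeff_X_mul, map_mul]
      exact mul_le_mul hα (hP k) ((S.ab v).nonneg _) hμ
  · rw [map_mul]
    exact mul_le_mul hβ (hP k) ((S.ab v).nonneg _) hμ

lemma coeff_linear_pow_mul_le {v : S.V} {P : K[X]} {α β : K} {μ B : ℝ}
    (hP : ∀ k, S.ab v (P.coeff k) ≤ B) (hα : S.ab v α ≤ μ) (hβ : S.ab v β ≤ μ) (n k : ℕ) :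
    S.ab v (((C α * X + C β) ^ n * P).coeff k) ≤
      (Real.exp (S.w v * Real.log 2) * μ) ^ n * B := by
  induction n generalizing k with
  | zero => simpa using hP k
  | succ n ih =>
    rw [pow_succ', mul_assoc]
    refine (S.coeff_linear_mul_le ih hα hβ k).trans_eq ?_
    ring

lemma coeff_integrand_le {v : S.V} (N : ℕ) {α β γ δ : K} {μ ν : ℝ} (hα : S.ab v α ≤ μ)
    (hβ : S.ab v β ≤ μ) (hγ : S.ab v γ ≤ ν) (hδ : S.ab v δ ≤ ν) (k : ℕ) :
    S.ab v ((integrand N α β γ δ).coeff k) ≤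
      Real.exp (S.w v * (3 * N * Real.log 2)) * (μ ^ N * ν) := by
  have h0 : ∀ k, S.ab v ((C γ * X + C δ).coeff k) ≤ ν := by
    intro k
    have hν : 0 ≤ ν := ((S.ab v).nonneg _).trans hγ
    match k with
    | 0 => simpa using hδ
    | 1 => simpa using hγ
    | k + 2 => simpa [coeff_X, coeff_C] using hν
  have h1 := S.coeff_linear_pow_mul_le h0 hα hβ N
  have h2 := S.coeff_linear_pow_mul_le (α := 1) (β := -1) (μ := 1) h1
    (by simp) (by simp [(S.ab v).map_neg]) N
  have h3 := S.coeff_linear_pow_mul_le (α := 1) (β := 0) (μ := 1) h2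
    (by simp) (by simp) N
  refine (h3 k).trans_eq ?_
  rw [show S.w v * (3 * N * Real.log 2) = (3 * N : ℕ) * (S.w v * Real.log 2) by push_cast; ring,
    Real.exp_nat_mul]
  ring

lemma integrand_mem_lifts (N : ℕ) {α β γ δ : K} (hα : α ∈ S.O) (hβ : β ∈ S.O) (hγ : γ ∈ S.O)
    (hδ : δ ∈ S.O) (k : ℕ) : (integrand N α β γ δ).coeff k ∈ S.O := by
  have hl : ∀ {α β : K}, α ∈ S.O → β ∈ S.O → C α * X + C β ∈ liftsRing S.O.subtype := by
    intro α β hα hβ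
    exact add_mem (mul_mem (C'_mem_lifts ⟨⟨α, hα⟩, rfl⟩) (X_mem_lifts _))
      (C'_mem_lifts ⟨⟨β, hβ⟩, rfl⟩)
  have h : integrand N α β γ δ ∈ liftsRing S.O.subtype :=
    mul_mem (pow_mem (hl S.O.one_mem S.O.zero_mem) N)
      (mul_mem (pow_mem (hl S.O.one_mem (S.O.neg_mem S.O.one_mem)) N)
        (mul_mem (pow_mem (hl hα hβ) N) (hl hγ hδ)))
  obtain ⟨z, hz⟩ := (lifts_iff_coeff_lifts _).1 ((lifts_iff_liftsRing _ _).2 h) k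
  rw [← hz]
  exact z.2

lemma mul_unitIntegral_eq_sum [CharZero K] (P : K[X]) {M D : ℕ} (hM : P.natDegree < M)
    (hD : ∀ k < M, k + 1 ∣ D) :
    D * unitIntegral P = ∑ k ∈ Finset.range M, ((D / (k + 1) : ℕ) : K) * P.coeff k := by
  rw [unitIntegral_eq_sum P hM, Finset.mul_sum]
  refine Finset.sum_congr rfl fun k hk => ?_
  rw [Nat.cast_div (hD k (Finset.mem_range.1 hk)) (by exact_mod_cast k.succ_ne_zero)]
  push_cast
  ring

/-- The common denominator of the integrals. -/
noncomputable def denom (N : ℕ) : ℕ := Nat.lcmUpto (3 * N + 2)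

lemma dvd_denom {N k : ℕ} (hk : k < 3 * N + 2) : k + 1 ∣ denom N :=
  Finset.dvd_lcm (f := id) (show k + 1 ∈ Finset.Icc 1 (3 * N + 2) from
    Finset.mem_Icc.2 ⟨by omega, by omega⟩)

lemma denom_ne_zero (N : ℕ) : denom N ≠ 0 := Nat.lcmUpto_ne_zero _

lemma log_denom_le {N : ℕ} (hN : 1 ≤ N) : Real.log (denom N) ≤ 28 * N := by
  rw [denom, ← Chebyshev.psi_eq_log_lcmUpto]
  refine (Chebyshev.psi_le_const_mul_self (by positivity)).trans ?_
  have h4 : Real.log 4 ≤ 1.4 := by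
    rw [show (4 : ℝ) = 2 ^ 2 by norm_num, Real.log_pow]
    have := Real.log_two_lt_d9
    norm_num
    linarith
  have hN' : (1 : ℝ) ≤ N := by exact_mod_cast hN
  push_cast
  nlinarith

lemma denom_mul_mem [CharZero K] (N : ℕ) {α β γ δ : K} (hα : α ∈ S.O) (hβ : β ∈ S.O)
    (hγ : γ ∈ S.O) (hδ : δ ∈ S.O) :
    denom N * unitIntegral (integrand N α β γ δ) ∈ S.O := by
  rw [mul_unitIntegral_eq_sum _ (natDegree_integrand_lt N α β γ δ) fun k => dvd_denom]
  exact S.O.sum_mem fun k _ =>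
    S.O.mul_mem (natCast_mem S.O _) (S.integrand_mem_lifts N hα hβ hγ hδ k)

lemma denom_mul_le [CharZero K] {N : ℕ} (hN : 1 ≤ N) {v : S.V} {α β γ δ : K} {μ ν : ℝ}
    (hα : S.ab v α ≤ μ) (hβ : S.ab v β ≤ μ) (hγ : S.ab v γ ≤ ν) (hδ : S.ab v δ ≤ ν) :
    S.ab v (denom N * unitIntegral (integrand N α β γ δ)) ≤
      Real.exp (S.w v * (35 * N)) * (μ ^ N * ν) := by
  have hμ : 0 ≤ μ := ((S.ab v).nonneg _).trans hα
  have hν : 0 ≤ ν := ((S.ab v).nonneg _).trans hγ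
  have hN' : (1 : ℝ) ≤ N := by exact_mod_cast hN
  rw [mul_unitIntegral_eq_sum _ (natDegree_integrand_lt N α β γ δ) fun k => dvd_denom]
  refine (S.ab_sum_le _ (by simp) _ v (Real.exp (S.w v * Real.log (denom N)) *
    (Real.exp (S.w v * (3 * N * Real.log 2)) * (μ ^ N * ν))) fun k hk => ?_).trans ?_
  · rw [map_mul]
    refine mul_le_mul ?_ (S.coeff_integrand_le N hα hβ hγ hδ k) ((S.ab v).nonneg _)
      (Real.exp_nonneg _)
    have hd := dvd_denom (Finset.mem_range.1 hk)
    have hpos : 0 < denom N / (k + 1) := Nat.div_pos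
      (Nat.le_of_dvd (Nat.pos_of_ne_zero (denom_ne_zero N)) hd) k.succ_pos
    refine (S.ab_natCast_le hpos.ne' v).trans (Real.exp_le_exp.2 ?_)
    refine mul_le_mul_of_nonneg_left (Real.log_le_log (by exact_mod_cast hpos) ?_) (S.w_nonneg v)
    exact_mod_cast Nat.div_le_self _ _
  · rw [← mul_assoc, ← mul_assoc, ← Real.exp_add, ← Real.exp_add]
    refine mul_le_mul_of_nonneg_right (Real.exp_le_exp.2 ?_) (by positivity)
    rw [← mul_add, ← mul_add]
    refine mul_le_mul_of_nonneg_left ?_ (S.w_nonneg v)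
    have h1 := log_denom_le hN
    have h2 : Real.log (Finset.range (3 * N + 2)).card ≤ 3 * N + 1 := by
      rw [Finset.card_range]
      refine (Real.log_le_sub_one_of_pos (by positivity)).trans ?_
      push_cast
      linarith
    have h3 := Real.log_two_lt_d9
    nlinarith

lemma L_le_of_add_eq_one {x y : K} (hy : y ≠ 0) (h : x + y = 1) (v : S.V) :
    S.L y v ≤ max 0 (S.L x v) + S.w v * Real.log 2 := by
  have hy' : y = ∑ i : Fin 2, ![1, -x] i := by simp [← h]
  have := S.L_sum_le Finset.univ ![1, -x] v (max 0 (S.L x v)) (hy' ▸ hy) (by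
    intro i _ _
    fin_cases i
    · simp [L_one]
    · simp [L_neg])
  rw [← hy'] at this
  simp only [Finset.card_univ, Fintype.card_fin] at this
  norm_num at this
  linarith

lemma max_L_of_add_eq_one {x y : K} (h : x + y = 1) (v : S.V) :
    0 ≤ max (S.L x v) (S.L y v) + S.w v * Real.log 2 := by
  have h' : 1 = ∑ i : Fin 2, ![x, y] i := by simp [← h]
  have := S.L_sum_le Finset.univ ![x, y] v (max (S.L x v) (S.L y v)) (h' ▸ one_ne_zero) (by
    intro i _ _
    fin_cases i
    · simp
    · simp)
  rw [← h'] at this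
  simp only [Finset.card_univ, Fintype.card_fin, L_one, Pi.zero_apply] at this
  norm_num at this
  linarith

set_option maxHeartbeats 1000000 in
/-- Two solutions of the unit equation in two variables cannot be close to an odd multiple
of one another. -/
theorem unit_pair_gap {x y x' y' : K} (hx : S.IsU x) (hy : S.IsU y) (hx' : S.IsU x')
    (hy' : S.IsU y') (h : x + y = 1) (h' : x' + y' = 1) {N : ℕ} (hN : 1 ≤ N) :
    N * S.nrm (S.L x) / 2 ≤ 43 * N * S.deg +
      S.nrm (S.L x' - (2 * N + 1 : ℝ) • S.L x) + S.nrm (S.L y' - (2 * N + 1 : ℝ) • S.L y) := by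
  have := S.charZero
  have hNR : (1 : ℝ) ≤ N := by exact_mod_cast hN
  have hl2 := Real.log_two_lt_d9
  have hl2' := Real.log_nonneg one_le_two
  obtain ⟨γ, δ, hγδ, hne⟩ := exists_form_ne_zero N hx.1 hy.1 h x'
  have hγO : γ ∈ S.O := by
    rcases hγδ with ⟨rfl, -⟩ | ⟨rfl, -⟩
    exacts [S.O.zero_mem, S.O.one_mem]
  have hδO : δ ∈ S.O := by
    rcases hγδ with ⟨-, rfl⟩ | ⟨-, rfl⟩
    exacts [S.O.one_mem, S.O.zero_mem]
  obtain ⟨H, hH, hH0⟩ := exists_derivative_eq (integrand N 1 (-x) γ δ)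
  obtain ⟨hI3, hI1, hI2⟩ := integrals_of_antiderivative N h γ δ hH hH0
  set I3 := unitIntegral (integrand N 1 (-x) γ δ)
  set I1 := unitIntegral (integrand N x (-1) (γ * x) δ)
  set I2 := unitIntegral (integrand N y x (γ * y) (γ * x + δ))
  have hO3 : denom N * I3 ∈ S.O := S.denom_mul_mem N S.O.one_mem (S.O.neg_mem hx.2.1) hγO hδO
  have hO1 : denom N * I1 ∈ S.O := S.denom_mul_mem N hx.2.1 (S.O.neg_mem S.O.one_mem)
    (S.O.mul_mem hγO hx.2.1) hδO
  set Z : K := denom N * (x' * I3 - x ^ (2 * N + 1) * I1) with hZ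
  have hZ1 : Z = x' * (denom N * I3) + -(x ^ (2 * N + 1) * (denom N * I1)) := by rw [hZ]; ring
  have hZ2 : Z = y ^ (2 * N + 1) * (denom N * I2) + -(y' * (denom N * I3)) := by
    have h3 : x' * I3 - x ^ (2 * N + 1) * I1 = y ^ (2 * N + 1) * I2 - y' * I3 := by
      rw [hI1, hI2, hI3]
      linear_combination (H.eval 1) * h'
    rw [hZ, h3]; ring
  have hZO : Z ∈ S.O := by
    rw [hZ1]
    exact S.O.add_mem (S.O.mul_mem hx'.2.1 hO3)
      (S.O.neg_mem (S.O.mul_mem (S.O.pow_mem hx.2.1 _) hO1))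
  have hZ0 : Z ≠ 0 := mul_ne_zero (by exact_mod_cast denom_ne_zero N) hne
  have hpr : 0 ≤ ∑ v, S.L Z v := S.prod Z hZO hZ0
  have key : ∀ v, S.L Z v ≤ (2 * N + 1) * ((S.L x v - max 0 (S.L x v)) +
      (S.L y v - max 0 (S.L y v))) + (3 * N + 2) * max 0 (S.L x v) +
      (|(S.L x' - (2 * N + 1 : ℝ) • S.L x) v| + |(S.L y' - (2 * N + 1 : ℝ) • S.L y) v|) +
      S.w v * (40 * N) := by
    intro v
    have ht1 := S.L_le_of_add_eq_one hy.1 h v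
    have ht2 := S.L_le_of_add_eq_one hx.1 (by rw [add_comm]; exact h) v
    have ht3 := S.max_L_of_add_eq_one h v
    have hγ1 : S.ab v γ ≤ 1 := by rcases hγδ with ⟨rfl, -⟩ | ⟨rfl, -⟩ <;> simp
    have hδ1 : S.ab v δ ≤ 1 := by rcases hγδ with ⟨-, rfl⟩ | ⟨-, rfl⟩ <;> simp
    have ea := S.exp_L hx.1 v
    have eb := S.exp_L hy.1 v
    have ea' := S.exp_L hx'.1 v
    have eb' := S.exp_L hy'.1 v
    have hea := le_abs_self ((S.L x' - (2 * N + 1 : ℝ) • S.L x) v)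
    have heb := le_abs_self ((S.L y' - (2 * N + 1 : ℝ) • S.L y) v)
    have hea0 := abs_nonneg ((S.L x' - (2 * N + 1 : ℝ) • S.L x) v)
    have heb0 := abs_nonneg ((S.L y' - (2 * N + 1 : ℝ) • S.L y) v)
    simp only [Pi.sub_apply, Pi.smul_apply, smul_eq_mul] at hea heb hea0 heb0 ⊢
    set a := S.L x v
    set b := S.L y v
    set a' := S.L x' v
    set b' := S.L y' v
    set w := S.w v with hw
    have hw0 : 0 ≤ w := S.w_nonneg v
    set E₁ := |a' - (2 * N + 1) * a|
    set E₂ := |b' - (2 * N + 1) * b|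
    have h1a : (1 : ℝ) ≤ Real.exp (max 0 a) := Real.one_le_exp (le_max_left _ _)
    have hxa : S.ab v x ≤ Real.exp (max 0 a) := ea ▸ Real.exp_le_exp.2 (le_max_right _ _)
    have hB3 : S.ab v (denom N * I3) ≤ Real.exp (w * (35 * N) + N * max 0 a) := by
      refine (S.denom_mul_le hN (μ := Real.exp (max 0 a)) (ν := 1) (by simp)
        (by rw [(S.ab v).map_neg]; exact hxa) hγ1 hδ1).trans_eq ?_
      rw [mul_one, ← Real.exp_nat_mul, ← Real.exp_add]
    have hfin : ∀ Q, S.ab v Z ≤ Real.exp (w * Real.log 2) * Real.exp Q →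
        S.L Z v ≤ w * Real.log 2 + Q := by
      intro Q hQ
      rw [← Real.exp_add] at hQ
      exact (Real.log_le_iff_le_exp (S.ab_pos hZ0 v)).2 hQ
    have hwl : 0 ≤ w * Real.log 2 := mul_nonneg hw0 hl2'
    have hNw : w * Real.log 2 ≤ N * (w * Real.log 2) := le_mul_of_one_le_left hwl hNR
    have hwN : (5 * N) * (w * Real.log 2) ≤ w * (4 * N) := by
      nlinarith [mul_nonneg hw0 (by linarith : (0 : ℝ) ≤ N)]
    have caseI : S.L Z v ≤ w * Real.log 2 +
        (w * (35 * N) + ((2 * N + 1) * a + (N + 1) * max 0 a + E₁)) := by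
      refine hfin _ ?_
      rw [hZ1]
      refine S.ab_add_le ?_ ?_
      · rw [map_mul, ← ea']
        refine (mul_le_mul_of_nonneg_left hB3 (Real.exp_nonneg _)).trans ?_
        rw [← Real.exp_add]
        refine Real.exp_le_exp.2 ?_
        linarith [le_max_left 0 a]
      · rw [(S.ab v).map_neg, map_mul, map_pow, ← ea, ← Real.exp_nat_mul]
        have hB1 := S.denom_mul_le hN (v := v) (α := x) (β := -1) (γ := γ * x) (δ := δ)
          (μ := Real.exp (max 0 a)) (ν := Real.exp (max 0 a)) hxa
          (by simp [(S.ab v).map_neg])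
          (by rw [map_mul]; exact (mul_le_of_le_one_left ((S.ab v).nonneg _) hγ1).trans hxa)
          (hδ1.trans h1a)
        refine (mul_le_mul_of_nonneg_left hB1 (Real.exp_nonneg _)).trans ?_
        rw [← Real.exp_nat_mul, ← Real.exp_add, ← Real.exp_add, ← Real.exp_add]
        refine Real.exp_le_exp.2 ?_
        push_cast
        linarith
    have caseIII : b ≤ 0 → S.L Z v ≤ w * Real.log 2 +
        (w * (35 * N) + ((2 * N + 1) * b + E₂ + (N + 1) * (w * Real.log 2))) := by
      intro hb
      have hxw : S.ab v x ≤ Real.exp (w * Real.log 2) := by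
        rw [← ea]
        refine Real.exp_le_exp.2 ?_
        rw [max_eq_left hb] at ht2
        linarith
      have haw : max 0 a ≤ w * Real.log 2 := by
        rw [max_eq_left hb] at ht2
        exact max_le hwl (by linarith)
      have h1w : (1 : ℝ) ≤ Real.exp (w * Real.log 2) := Real.one_le_exp hwl
      have hyw : S.ab v y ≤ Real.exp (w * Real.log 2) := by
        rw [← eb]
        exact Real.exp_le_exp.2 (hb.trans hwl)
      refine hfin _ ?_
      rw [hZ2]
      refine S.ab_add_le ?_ ?_
      · rw [map_mul, map_pow, ← eb, ← Real.exp_nat_mul]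
        have hB2 := S.denom_mul_le hN (v := v) (α := y) (β := x) (γ := γ * y) (δ := γ * x + δ)
          (μ := Real.exp (w * Real.log 2)) (ν := Real.exp (w * Real.log 2)) hyw hxw
          (by rw [map_mul]; exact (mul_le_of_le_one_left ((S.ab v).nonneg _) hγ1).trans hyw)
          (by
            rcases hγδ with ⟨rfl, rfl⟩ | ⟨rfl, rfl⟩
            · simpa using h1w
            · simpa using hxw)
        refine (mul_le_mul_of_nonneg_left hB2 (Real.exp_nonneg _)).trans ?_
        rw [← Real.exp_nat_mul, ← Real.exp_add, ← Real.exp_add, ← Real.exp_add]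
        refine Real.exp_le_exp.2 ?_
        push_cast
        linarith
      · rw [(S.ab v).map_neg, map_mul, ← eb']
        refine (mul_le_mul_of_nonneg_left hB3 (Real.exp_nonneg _)).trans ?_
        rw [← Real.exp_add]
        refine Real.exp_le_exp.2 ?_
        nlinarith
    have h2N : (0 : ℝ) ≤ 2 * N + 1 := by positivity
    have hwN0 : 0 ≤ w * N := by positivity
    rcases le_or_gt a 0 with ha | ha
    · rw [max_eq_left ha] at caseI ⊢
      rcases le_total a b with hab | hab
      · rw [max_eq_right hab] at ht3
        have : -(w * Real.log 2) ≤ b - max 0 b := by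
          rcases le_total b 0 with hb | hb
          · rw [max_eq_left hb]; linarith
          · rw [max_eq_right hb]; linarith
        linarith [mul_le_mul_of_nonneg_left this h2N]
      · rw [max_eq_left hab] at ht3
        have hb : b ≤ 0 := hab.trans ha
        have := caseIII hb
        rw [max_eq_left hb]
        linarith [mul_nonneg h2N ht3]
    · rw [max_eq_right ha.le] at caseI ⊢
      rcases le_or_gt b 0 with hb | hb
      · have := caseIII hb
        rw [max_eq_left hb]
        linarith [mul_nonneg h2N ha.le]
      · rw [max_eq_right hb.le]
        linarith
  have htot := Finset.sum_le_sum fun v (_ : v ∈ Finset.univ) => key v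
  simp only [Finset.sum_add_distrib, ← Finset.sum_mul, ← Finset.mul_sum, Finset.sum_sub_distrib,
    hx.sum_L, hy.sum_L] at htot
  have hX := S.nrm_eq_two_mul_sum_max _ hx.sum_L
  have hY := S.nrm_eq_two_mul_sum_max _ hy.sum_L
  have hXY := S.nrm_L_one_sub_le hy hx (by rw [add_comm]; exact h)
  have hd := S.deg_pos'
  change _ ≤ _ + (S.nrm _ + S.nrm _) + S.deg * _ at htot
  have hXY2 : S.nrm (S.L x) - 2 * S.deg ≤ S.nrm (S.L y) := by nlinarith
  nlinarith

end PlaceSystem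

namespace PlaceSystem

/-- In a normed space of dimension at most `ρ`, balls can be coloured with boundedly many colours
so that each colour class has small diameter. -/
lemma exists_ball_coloring {E : Type*} [NormedAddCommGroup E] [NormedSpace ℝ E]
    [FiniteDimensional ℝ E] {ρ : ℕ} (hρ : Module.finrank ℝ E ≤ ρ) (k : ℕ) :
    ∀ R : ℝ, 0 < R → ∃ c : E → Fin ((5 ^ ρ) ^ k), ∀ p q, ‖p‖ ≤ R → ‖q‖ ≤ R → c p = c q →
      ‖p - q‖ ≤ 2 * R / 2 ^ k := by
  induction k with
  | zero =>
    intro R _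
    refine ⟨fun _ => ⟨0, by simp⟩, fun p q hp hq _ => ?_⟩
    have := norm_sub_le p q
    simp only [pow_zero, div_one]
    linarith
  | succ k ih =>
    intro R hR
    obtain ⟨c, hc⟩ := ih (R / 2) (by positivity)
    classical
    let good : ℕ → Prop := fun n => ∃ s : Finset E, s.card = n ∧ (∀ a ∈ s, ‖a‖ ≤ R) ∧
      ∀ a ∈ s, ∀ b ∈ s, a ≠ b → R / 2 ≤ ‖a - b‖
    have hbd : ∀ s : Finset E, (∀ a ∈ s, ‖a‖ ≤ R) →
        (∀ a ∈ s, ∀ b ∈ s, a ≠ b → R / 2 ≤ ‖a - b‖) → s.card ≤ 5 ^ ρ := by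
      intro s h1 h2
      have hinj : Function.Injective fun a : E => (2 / R) • a :=
        smul_right_injective E (by positivity)
      have := Besicovitch.card_le_of_separated (s.image fun a : E => (2 / R) • a) (by
        intro a ha
        obtain ⟨b, hb, rfl⟩ := Finset.mem_image.1 ha
        rw [norm_smul, Real.norm_of_nonneg (by positivity)]
        calc 2 / R * ‖b‖ ≤ 2 / R * R := by gcongr; exact h1 b hb
          _ = 2 := by field_simp) (by
        intro a ha b hb hab
        obtain ⟨a, ha', rfl⟩ := Finset.mem_image.1 ha
        obtain ⟨b, hb', rfl⟩ := Finset.mem_image.1 hb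
        have hne : a ≠ b := fun h => hab (by rw [h])
        rw [← smul_sub, norm_smul, Real.norm_of_nonneg (by positivity)]
        calc (1 : ℝ) = 2 / R * (R / 2) := by field_simp
          _ ≤ _ := by gcongr; exact h2 a ha' b hb' hne)
      rw [Finset.card_image_of_injective _ hinj] at this
      exact this.trans (Nat.pow_le_pow_right (by norm_num) hρ)
    obtain ⟨s, hs, h1, h2⟩ : good (Nat.findGreatest good (5 ^ ρ)) :=
      Nat.findGreatest_spec (Nat.zero_le _) ⟨∅, by simp⟩
    have hnear : ∀ p : E, ∃ a : E, ‖p‖ ≤ R → a ∈ s ∧ ‖p - a‖ ≤ R / 2 := by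
      intro p
      by_cases hp : ‖p‖ ≤ R
      · by_contra! hcon
        have hps : p ∉ s := fun h => by
          have := (hcon p).2 h
          simp only [sub_self, norm_zero] at this
          linarith
        have hg1 : ∀ a ∈ insert p s, ‖a‖ ≤ R := by
          simpa [hp] using h1
        have hg2 : ∀ a ∈ insert p s, ∀ b ∈ insert p s, a ≠ b → R / 2 ≤ ‖a - b‖ := by
          intro a ha b hb hab
          rcases Finset.mem_insert.1 ha with rfl | ha' <;>
            rcases Finset.mem_insert.1 hb with rfl | hb'
          · exact absurd rfl hab
          · exact ((hcon b).2 hb').le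
          · rw [norm_sub_rev]; exact ((hcon a).2 ha').le
          · exact h2 a ha' b hb' hab
        have := Nat.le_findGreatest (P := good) (hbd _ hg1 hg2) ⟨_, rfl, hg1, hg2⟩
        rw [Finset.card_insert_of_notMem hps] at this
        omega
      · exact ⟨0, fun h => absurd h hp⟩
    choose a ha using hnear
    have hcard : s.card ≤ 5 ^ ρ := hs ▸ Nat.findGreatest_le _
    have hpos : 0 < 5 ^ ρ := by positivity
    let idx : E → Fin (5 ^ ρ) := fun p =>
      if h : p ∈ s then Fin.castLE hcard (s.equivFin ⟨p, h⟩) else ⟨0, hpos⟩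
    have hidx : ∀ p ∈ s, ∀ q ∈ s, idx p = idx q → p = q := by
      intro p hp q hq h
      simp only [idx, hp, hq, dif_pos] at h
      have := s.equivFin.injective (Fin.castLE_injective hcard h)
      simpa using this
    refine ⟨fun p => Fin.cast (by rw [pow_succ]) (finProdFinEquiv (c (p - a p), idx (a p))),
      fun p q hp hq hpq => ?_⟩
    have h3 := finProdFinEquiv.injective (Fin.cast_injective _ hpq)
    rw [Prod.mk.injEq] at h3
    have h4 := hidx _ (ha p hp).1 _ (ha q hq).1 h3.2
    have h5 := hc _ _ (ha p hp).2 (ha q hq).2 h3.1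
    rw [h4, sub_sub_sub_cancel_right] at h5
    refine h5.trans_eq ?_
    rw [pow_succ]
    field_simp

/-- `Γ` has rank at most `ρ`. -/
def RankLE {G : Type*} [CommGroup G] (Γ : Subgroup G) (ρ : ℕ) : Prop :=
  ∃ s : Finset G, s.card ≤ ρ ∧ ∀ x ∈ Γ, ∃ k : ℕ, 0 < k ∧ x ^ k ∈ Subgroup.closure (s : Set G)

lemma RankLE.mono {G : Type*} [CommGroup G] {Γ : Subgroup G} {ρ ρ' : ℕ} (h : RankLE Γ ρ)
    (hρ : ρ ≤ ρ') : RankLE Γ ρ' := by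
  obtain ⟨s, hs, h⟩ := h
  exact ⟨s, hs.trans hρ, h⟩

lemma RankLE.sup_closure {G : Type*} [CommGroup G] {Γ : Subgroup G} {ρ : ℕ} (h : RankLE Γ ρ)
    (t : Finset G) : RankLE (Γ ⊔ Subgroup.closure (t : Set G)) (ρ + t.card) := by
  classical
  obtain ⟨s, hs, h⟩ := h
  refine ⟨s ∪ t, (Finset.card_union_le _ _).trans (by omega), fun x hx => ?_⟩
  obtain ⟨y, hy, z, hz, rfl⟩ := Subgroup.mem_sup.1 hx
  obtain ⟨k, hk, hyk⟩ := h y hy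
  refine ⟨k, hk, ?_⟩
  rw [mul_pow]
  exact mul_mem (Subgroup.closure_mono (by simp) hyk)
    (Subgroup.closure_mono (by simp) (pow_mem hz k))

variable {K : Type} [Field K] (S : PlaceSystem K)

lemma L_mem_span {s : Set Kˣ} {x : Kˣ} {k : ℕ} (hk : 0 < k) (h : x ^ k ∈ Subgroup.closure s) :
    S.L (x : K) ∈ Submodule.span ℝ ((fun u : Kˣ => S.L (u : K)) '' s) := by
  have h1 : ∀ y ∈ Subgroup.closure s,
      S.L (y : K) ∈ Submodule.span ℝ ((fun u : Kˣ => S.L (u : K)) '' s) := by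
    intro y hy
    induction hy using Subgroup.closure_induction with
    | mem y hy => exact Submodule.subset_span ⟨y, hy, rfl⟩
    | one => simp [L_one]
    | mul y z _ _ hy hz =>
      rw [Units.val_mul, S.L_mul y.ne_zero z.ne_zero]
      exact add_mem hy hz
    | inv y _ hy =>
      rw [Units.val_inv_eq_inv_val, S.L_inv]
      exact neg_mem hy
  have h2 := h1 _ h
  rw [Units.val_pow_eq_pow_val, S.L_pow] at h2
  have hk' : (k : ℝ) ≠ 0 := by exact_mod_cast hk.ne'
  have h3 := Submodule.smul_mem _ (k : ℝ)⁻¹ h2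
  rwa [smul_smul, inv_mul_cancel₀ hk', one_smul] at h3

/-- The span of the logarithmic image of a group. -/
def logSpan (Γ : Subgroup Kˣ) : Submodule ℝ (S.V → ℝ) :=
  Submodule.span ℝ ((fun u : Kˣ => S.L (u : K)) '' Γ)

lemma L_mem_logSpan {Γ : Subgroup Kˣ} {x : Kˣ} (hx : x ∈ Γ) : S.L (x : K) ∈ S.logSpan Γ :=
  Submodule.subset_span ⟨x, hx, rfl⟩

lemma exists_log_coloring (ρ : ℕ) {κ : ℝ} (hκ : 0 < κ) :
    ∃ C : ℕ, ∀ (K : Type) [Field K] (S : PlaceSystem K) (Γ : Subgroup Kˣ), RankLE Γ ρ →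
      ∀ R : ℝ, 0 < R → ∃ c : (S.V → ℝ) → Fin C, ∀ p ∈ S.logSpan Γ, ∀ q ∈ S.logSpan Γ,
        S.nrm p ≤ R → S.nrm q ≤ R → c p = c q → S.nrm (p - q) ≤ κ * R := by
  obtain ⟨k, hk⟩ := exists_nat_gt (2 / κ)
  have hk2 : 2 / (2 : ℝ) ^ k ≤ κ := by
    have : (k : ℝ) < 2 ^ k := by exact_mod_cast k.lt_two_pow_self
    rw [div_le_iff₀ (by positivity), mul_comm, ← div_le_iff₀ hκ]
    linarith
  refine ⟨(5 ^ ρ) ^ k, fun K _ S Γ hΓ R hR => ?_⟩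
  classical
  obtain ⟨s, hs, hΓ⟩ := hΓ
  let e := (WithLp.linearEquiv 1 ℝ (S.V → ℝ)).symm
  let F := (Submodule.span ℝ ((fun u : Kˣ => S.L (u : K)) '' s))
  let E := F.map e.toLinearMap
  have hmem : ∀ p ∈ S.logSpan Γ, e p ∈ E := by
    intro p hp
    refine ⟨p, ?_, rfl⟩
    have : S.logSpan Γ ≤ F := by
      refine Submodule.span_le.2 ?_
      rintro _ ⟨x, hx, rfl⟩
      obtain ⟨j, hj, hx⟩ := hΓ x hx
      exact S.L_mem_span hj hx
    exact this hp
  have hfr : Module.finrank ℝ E ≤ ρ := by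
    refine (Submodule.finrank_map_le _ _).trans ?_
    have hF : F = Submodule.span ℝ ((s.image fun u : Kˣ => S.L (u : K) : Finset _) : Set _) := by
      rw [Finset.coe_image]
    rw [hF]
    exact (finrank_span_finset_le_card _).trans (Finset.card_image_le.trans hs)
  have hnorm : ∀ p : S.V → ℝ, ‖e p‖ = S.nrm p := by
    intro p
    rw [PiLp.norm_eq_of_L1]
    rfl
  obtain ⟨c, hc⟩ := exists_ball_coloring hfr k R hR
  refine ⟨fun p => if h : p ∈ S.logSpan Γ then c ⟨_, hmem p h⟩ else ⟨0, by positivity⟩,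
    fun p hp q hq hpR hqR hpq => ?_⟩
  simp only [hp, hq, dif_pos] at hpq
  have := hc _ _ (by rw [Submodule.coe_norm, hnorm]; exact hpR)
    (by rw [Submodule.coe_norm, hnorm]; exact hqR) hpq
  rw [Submodule.coe_norm, Submodule.coe_sub, ← map_sub, hnorm] at this
  refine this.trans ?_
  rw [mul_comm 2 R, mul_div_assoc, mul_comm κ]
  gcongr

/-- Colouring of tuples of group elements by the position of their logarithms. -/
lemma exists_tuple_coloring (r ρ : ℕ) {κ : ℝ} (hκ : 0 < κ) :
    ∃ C : ℕ, ∀ (ι : Type) [Fintype ι], Fintype.card ι = r →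
      ∀ (K : Type) [Field K] (S : PlaceSystem K) (Γ : Subgroup Kˣ), RankLE Γ ρ →
      ∀ R : ℝ, 0 < R → ∃ c : (ι → Kˣ) → Fin C, ∀ y z : ι → Kˣ, (∀ i, y i ∈ Γ) → (∀ i, z i ∈ Γ) →
        (∀ i, S.nrm (S.L (y i)) ≤ R) → (∀ i, S.nrm (S.L (z i)) ≤ R) → c y = c z →
        ∀ i, S.nrm (S.L (y i) - S.L (z i)) ≤ κ * R := by
  obtain ⟨C, hC⟩ := exists_log_coloring ρ hκ
  refine ⟨C ^ r, fun ι _ hι K _ S Γ hΓ R hR => ?_⟩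
  obtain ⟨c, hc⟩ := hC K S Γ hΓ R hR
  classical
  have e : (ι → Fin C) ≃ Fin (C ^ r) := Fintype.equivFinOfCardEq (by simp [hι])
  refine ⟨fun y => e fun i => c (S.L (y i)), fun y z hy hz hyR hzR hyz i => ?_⟩
  exact hc _ (S.L_mem_logSpan (hy i)) _ (S.L_mem_logSpan (hz i)) (hyR i) (hzR i)
    (congrFun (e.injective hyz) i)

/-- Colouring of group elements by the direction of their logarithms. -/
lemma exists_direction_coloring (ρ : ℕ) {κ : ℝ} (hκ : 0 < κ) :
    ∃ C : ℕ, ∀ (K : Type) [Field K] (S : PlaceSystem K) (Γ : Subgroup Kˣ), RankLE Γ ρ →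
      ∃ c : Kˣ → Fin C, ∀ x ∈ Γ, ∀ y ∈ Γ, 0 < S.nrm (S.L x) → 0 < S.nrm (S.L y) → c x = c y →
        S.nrm (S.L y - (S.nrm (S.L y) / S.nrm (S.L x)) • S.L x) ≤ κ * S.nrm (S.L y) := by
  obtain ⟨C, hC⟩ := exists_log_coloring ρ hκ
  refine ⟨C, fun K _ S Γ hΓ => ?_⟩
  obtain ⟨c, hc⟩ := hC K S Γ hΓ 1 one_pos
  refine ⟨fun x => c ((S.nrm (S.L x))⁻¹ • S.L x), fun x hx y hy hx0 hy0 hxy => ?_⟩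
  have hu : ∀ z : Kˣ, 0 < S.nrm (S.L z) → S.nrm ((S.nrm (S.L z))⁻¹ • S.L z) ≤ 1 := by
    intro z hz
    rw [S.nrm_smul, abs_of_pos (by positivity), inv_mul_cancel₀ hz.ne']
  have := hc _ (Submodule.smul_mem _ _ (S.L_mem_logSpan hy)) _
    (Submodule.smul_mem _ _ (S.L_mem_logSpan hx)) (hu y hy0) (hu x hx0) hxy.symm
  have h2 : S.L (y : K) - (S.nrm (S.L y) / S.nrm (S.L x)) • S.L (x : K) =
      S.nrm (S.L y) • ((S.nrm (S.L y))⁻¹ • S.L (y : K) - (S.nrm (S.L x))⁻¹ • S.L (x : K)) := by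
    rw [smul_sub, smul_smul, smul_smul, mul_inv_cancel₀ hy0.ne', one_smul, div_eq_mul_inv]
  rw [h2, S.nrm_smul, abs_of_pos hy0, mul_comm]
  gcongr
  linarith

lemma exists_hyperplanes_of_large (r ρ : ℕ) (M : ℝ) (hr : 1 ≤ r) (hM : 0 < M) :
    ∃ C : ℕ, ∀ (ι : Type) [Fintype ι], Fintype.card ι = r →
      ∀ (K : Type) [Field K] (S : PlaceSystem K) (Γ : Subgroup Kˣ), RankLE Γ ρ →
      ∀ (Y : Set (ι → Kˣ)) (H : ℝ), 4 * S.deg * Real.log r.factorial < H →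
      (∀ y ∈ Y, (∀ i, y i ∈ Γ) ∧ (∀ i, S.IsU (y i)) ∧ ∑ i, (y i : K) = 1 ∧
        (∃ i, H ≤ S.nrm (S.L (y i))) ∧ ∀ i, S.nrm (S.L (y i)) ≤ M * H) →
      ∃ B : Finset (ι → K), B.card ≤ C ∧ (∀ b ∈ B, b ≠ 0) ∧
        ∀ y ∈ Y, ∃ b ∈ B, ∑ i, b i * (y i : K) = 0 := by
  have hr0 : (0 : ℝ) < r := by exact_mod_cast hr
  obtain ⟨C, hC⟩ := exists_tuple_coloring r ρ (κ := 1 / (4 * (r : ℝ) ^ 2 * M)) (by positivity)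
  refine ⟨C, fun ι _ hι K _ S Γ hΓ Y H hH hY => ?_⟩
  classical
  have : Nonempty ι := Fintype.card_pos_iff.1 (by omega)
  have hH0 : 0 < H := by
    refine lt_of_le_of_lt ?_ hH
    have := S.deg_pos'
    have h1 : (1 : ℝ) ≤ r.factorial := by exact_mod_cast r.factorial_pos
    have := Real.log_nonneg h1
    positivity
  obtain ⟨c, hc⟩ := hC ι hι K S Γ hΓ (M * H) (by positivity)
  have key : ∀ k : Fin C, ∃ b : ι → K, b ≠ 0 ∧
      ∀ y ∈ Y, c y = k → ∑ i, b i * (y i : K) = 0 := by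
    intro k
    obtain ⟨b, hb, h⟩ := S.exists_hyperplane_of_close
      ((fun (y : ι → Kˣ) i => (y i : K)) '' {y ∈ Y | c y = k})
      (by rintro _ ⟨y, hy, rfl⟩; exact (hY y hy.1).2.1)
      (by rintro _ ⟨y, hy, rfl⟩; exact (hY y hy.1).2.2.1) H (by rw [hι]; exact hH)
      (by rintro _ ⟨y, hy, rfl⟩; exact (hY y hy.1).2.2.2.1)
      (by
        rintro _ ⟨y, hy, rfl⟩ _ ⟨z, hz, rfl⟩ i
        refine (hc y z (hY y hy.1).1 (hY z hz.1).1 (hY y hy.1).2.2.2.2 (hY z hz.1).2.2.2.2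
          (hy.2.trans hz.2.symm) i).trans_eq ?_
        rw [hι]
        field_simp)
    exact ⟨b, hb, fun y hy hyk => h _ ⟨y, ⟨hy, hyk⟩, rfl⟩⟩
  choose b hb hbY using key
  refine ⟨Finset.univ.image b, Finset.card_image_le.trans (by simp), ?_, fun y hy => ?_⟩
  · intro b' hb'
    obtain ⟨k, -, rfl⟩ := Finset.mem_image.1 hb'
    exact hb k
  · exact ⟨b (c y), Finset.mem_image_of_mem _ (Finset.mem_univ _), hbY _ y hy rfl⟩

lemma exists_hyperplanes_of_bounded (r ρ : ℕ) (M : ℝ) (hr : 2 ≤ r) (hM : 0 < M) :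
    ∃ C : ℕ, ∀ (ι : Type) [Fintype ι], Fintype.card ι = r →
      ∀ (K : Type) [Field K] (S : PlaceSystem K) (Γ : Subgroup Kˣ), RankLE Γ ρ →
      ∀ (Y : Set (ι → Kˣ)),
      (∀ y ∈ Y, (∀ i, y i ∈ Γ) ∧ (∀ i, S.IsU (y i)) ∧ ∑ i, (y i : K) = 1 ∧
        ∀ i, S.nrm (S.L (y i)) ≤ M * S.deg) →
      ∃ B : Finset (ι → K), B.card ≤ C ∧ (∀ b ∈ B, b ≠ 0) ∧
        ∀ y ∈ Y, ∃ b ∈ B, ∑ i, b i * (y i : K) = 0 := by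
  have hr0 : (0 : ℝ) < r := by exact_mod_cast (by omega : 0 < r)
  set A : ℝ := ((1 + (r + 1).factorial * (r + 1).factorial.factorial : ℕ) : ℝ) with hA
  set B : ℝ := ((r + 1).factorial : ℝ) with hB
  have hA0 : 0 < A := by simp only [hA]; positivity
  have hB0 : 0 < B := by simp only [hB]; exact_mod_cast Nat.factorial_pos _
  have hL : 0 < Real.log ((B + 1) / B) :=
    Real.log_pos (by rw [lt_div_iff₀ hB0]; linarith)
  set ε : ℝ := Real.log ((B + 1) / B) / (4 * A * B * r) with hε
  have hε0 : 0 < ε := by positivity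
  have hlt : A * (B * (2 * r * ε)) < Real.log ((B + 1) / B) := by
    have : A * (B * (2 * r * ε)) = Real.log ((B + 1) / B) / 2 := by
      rw [hε]; field_simp; ring
    linarith
  obtain ⟨C, hC⟩ := exists_tuple_coloring r ρ (κ := ε / M) (by positivity)
  set D := r * ((r + 1).factorial * (r + 1).factorial) * (r + 1).factorial.factorial
  refine ⟨C * D, fun ι _ hι K _ S Γ hΓ Y hY => ?_⟩
  classical
  have hd := S.deg_pos'
  obtain ⟨c, hc⟩ := hC ι hι K S Γ hΓ (M * S.deg) (by positivity)
  have key : ∀ k : Fin C, ∃ B : Finset (ι → K), B.card ≤ D ∧ (∀ b ∈ B, b ≠ 0) ∧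
      ∀ y ∈ Y, c y = k → ∃ b ∈ B, ∑ i, b i * (y i : K) = 0 := by
    intro k
    obtain ⟨B, hB, hb, h⟩ := S.exists_hyperplanes_of_small (by omega) ε hε0.le
      (by rw [hι]; exact hlt)
      ((fun (y : ι → Kˣ) i => (y i : K)) '' {y ∈ Y | c y = k})
      (by rintro _ ⟨y, hy, rfl⟩; exact (hY y hy.1).2.1)
      (by rintro _ ⟨y, hy, rfl⟩; exact (hY y hy.1).2.2.1)
      (by
        rintro _ ⟨y, hy, rfl⟩ _ ⟨z, hz, rfl⟩ i
        refine (hc y z (hY y hy.1).1 (hY z hz.1).1 (hY y hy.1).2.2.2 (hY z hz.1).2.2.2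
          (hy.2.trans hz.2.symm) i).trans_eq ?_
        field_simp)
    rw [hι] at hB
    exact ⟨B, hB, hb, fun y hy hyk => h _ ⟨y, ⟨hy, hyk⟩, rfl⟩⟩
  choose B hB hb hbY using key
  refine ⟨Finset.univ.biUnion B, ?_, ?_, fun y hy => ?_⟩
  · refine (Finset.card_biUnion_le_card_mul _ _ D fun k _ => hB k).trans (by simp)
  · intro b' hb'
    obtain ⟨k, -, hk⟩ := Finset.mem_biUnion.1 hb'
    exact hb k _ hk
  · obtain ⟨b, hb, h⟩ := hbY _ y hy rfl
    exact ⟨b, Finset.mem_biUnion.2 ⟨_, Finset.mem_univ _, hb⟩, h⟩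

end PlaceSystem

/-- Every finite set of nonzero elements consists of units for some system of places. -/
def HasPlaces (K : Type) [Field K] : Prop :=
  ∀ X : Finset Kˣ, ∃ S : PlaceSystem K, ∀ x ∈ X, S.IsU x

namespace PlaceSystem

open NumberField

lemma prod_embeddings_mul_finprod {K : Type} [Field K] [NumberField K] {x : K} (hx : x ≠ 0) :
    (∏ σ : K →ₐ[ℚ] ℂ, ‖σ x‖) * ∏ᶠ w : FinitePlace K, w x = 1 := by
  rw [FinitePlace.prod_eq_inv_abs_norm hx, ← norm_prod, ← Algebra.norm_eq_prod_embeddings]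
  have h : Algebra.norm ℚ x ≠ 0 := Algebra.norm_ne_zero_iff.2 hx
  have h2 : ‖(algebraMap ℚ ℂ) (Algebra.norm ℚ x)‖ = ((|Algebra.norm ℚ x| : ℚ) : ℝ) := by
    simp [Complex.norm_ratCast]
  rw [h2, ← Rat.cast_mul, mul_inv_cancel₀ (by simpa using h), Rat.cast_one]

/-- The system of all archimedean places and a finite set of finite places of a number field. -/
noncomputable def ofFinitePlaces (K : Type) [Field K] [NumberField K]
    (W : Finset (FinitePlace K)) : PlaceSystem K where
  V := (K →ₐ[ℚ] ℂ) ⊕ W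
  fin := inferInstance
  ab := Sum.elim (fun σ => NumberField.place σ.toRingHom) fun w => w.1.val
  w := Sum.elim (fun _ => 1) fun _ => 0
  place := by
    rintro (σ | w)
    · exact Or.inr ⟨rfl, fun n => by simp [NumberField.place_apply]⟩
    · exact Or.inl ⟨rfl, fun x y => w.1.add_le x y⟩
  O :=
    { carrier := {x | ∀ w : FinitePlace K, w ∉ W → w x ≤ 1}
      mul_mem' := fun {x y} hx hy w hw => by
        rw [map_mul]
        exact mul_le_one₀ (hx w hw) (apply_nonneg _ _) (hy w hw)
      one_mem' := fun w _ => by simp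
      add_mem' := fun {x y} hx hy w hw => (w.add_le x y).trans (max_le (hx w hw) (hy w hw))
      zero_mem' := fun w _ => by simp
      neg_mem' := fun {x} hx w hw => by
        have := hx w hw
        rw [FinitePlace.coe_apply] at this ⊢
        rwa [w.val.map_neg] }
  prod := by
    intro x hx hx0
    rw [← Real.log_prod (fun v _ => (AbsoluteValue.pos _ hx0).ne')]
    refine Real.log_nonneg ?_
    rw [← prod_embeddings_mul_finprod hx0, Fintype.prod_sum_type]
    refine mul_le_mul_of_nonneg_left ?_ (Finset.prod_nonneg fun _ _ => norm_nonneg _)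
    classical
    have hfin : (Function.mulSupport fun w : FinitePlace K => w x).Finite :=
      FinitePlace.hasFiniteMulSupport hx0
    rw [finprod_eq_prod_of_mulSupport_subset (s := W ∪ hfin.toFinset) _ (by
      intro w hw
      exact Finset.mem_coe.2 (Finset.mem_union_right _ (hfin.mem_toFinset.2 hw))), ← Finset.sdiff_union_of_subset (Finset.subset_union_left),
      Finset.prod_union Finset.sdiff_disjoint]
    have h1 : ∏ w ∈ (W ∪ hfin.toFinset) \ W, w x ≤ 1 :=
      Finset.prod_le_one (fun _ _ => apply_nonneg _ _)
        fun w hw => hx w (Finset.mem_sdiff.1 hw).2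
    have h2 : 0 ≤ ∏ w ∈ W, w x := Finset.prod_nonneg fun _ _ => apply_nonneg _ _
    refine (mul_le_of_le_one_left h2 h1).trans_eq ?_
    rw [← Finset.prod_coe_sort]
    rfl
  deg_pos := by
    simp [Fintype.sum_sum_type, Module.finrank_pos]

theorem hasPlaces_of_numberField (K : Type) [Field K] [NumberField K] : HasPlaces K := by
  intro X
  classical
  have hfin : ∀ x : Kˣ, (Function.mulSupport fun w : FinitePlace K => w x).Finite :=
    fun x => FinitePlace.hasFiniteMulSupport x.ne_zero
  let W := X.biUnion fun x => (hfin x).toFinset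
  refine ⟨ofFinitePlaces K W, fun x hx => ?_⟩
  have h1 : ∀ w : FinitePlace K, w ∉ W → w x = 1 := by
    intro w hw
    by_contra h
    exact hw (Finset.mem_biUnion.2 ⟨x, hx, (hfin x).mem_toFinset.2 h⟩)
  exact ⟨x.ne_zero, fun w hw => (h1 w hw).le, fun w hw => by rw [map_inv₀, h1 w hw, inv_one]⟩

end PlaceSystem

namespace PlaceSystem

lemma card_le_mul_of_cover {α β : Type*} (Y : Finset α) (B : Finset β) (R : α → β → Prop)
    (n : ℕ) (hR : ∀ y ∈ Y, ∃ b ∈ B, R y b)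
    (hn : ∀ b ∈ B, ∀ Z ⊆ Y, (∀ z ∈ Z, R z b) → Z.card ≤ n) : Y.card ≤ B.card * n := by
  classical
  have h : Y ⊆ B.biUnion fun b => Y.filter (R · b) := by
    intro y hy
    obtain ⟨b, hb, h⟩ := hR y hy
    exact Finset.mem_biUnion.2 ⟨b, hb, Finset.mem_filter.2 ⟨hy, h⟩⟩
  refine (Finset.card_le_card h).trans (Finset.card_biUnion_le_card_mul _ _ n fun b hb => ?_)
  exact hn b hb _ (Finset.filter_subset _ _) fun z hz => (Finset.mem_filter.1 hz).2

lemma card_le_mul_of_fin_cover {α : Type*} (Y : Finset α) {C : ℕ} (c : α → Fin C)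
    (n : ℕ) (hn : ∀ Z ⊆ Y, (∀ y ∈ Z, ∀ z ∈ Z, c y = c z) → Z.card ≤ n) : Y.card ≤ C * n := by
  have := card_le_mul_of_cover Y Finset.univ (fun y k => c y = k) n
    (fun y _ => ⟨c y, Finset.mem_univ _, rfl⟩)
    fun k _ Z hZ h => hn Z hZ fun y hy z hz => (h y hy).trans (h z hz).symm
  simpa using this

lemma pair_unique_of_form {K : Type} [Field K] {b : Fin 2 → K} (hb : b ≠ 0) {x y : Fin 2 → K}
    (hx : ∑ i, x i = 1) (hy : ∑ i, y i = 1) (hbx : ∑ i, b i * x i = 0)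
    (hby : ∑ i, b i * y i = 0) : x = y := by
  simp only [Fin.sum_univ_two] at hx hy hbx hby
  have h : (b 0 - b 1) * (x 0 - y 0) = 0 := by
    linear_combination hbx - hby - b 1 * hx + b 1 * hy
  rcases mul_eq_zero.1 h with h | h
  · exfalso
    have h0 : b 0 = b 1 := sub_eq_zero.1 h
    have h1 : b 1 = 0 := by linear_combination hbx - b 1 * hx - x 0 * h
    exact hb (funext fun i => by fin_cases i <;> simp [h0, h1])
  · have h0 : x 0 = y 0 := sub_eq_zero.1 h
    have h1 : x 1 = y 1 := by linear_combination hx - hy - h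
    exact funext fun i => by fin_cases i <;> assumption

lemma card_le_one_of_form {K : Type} [Field K] {b : Fin 2 → K} (hb : b ≠ 0)
    (Z : Finset (Fin 2 → Kˣ)) (hZ : ∀ z ∈ Z, ∑ i, (z i : K) = 1)
    (hbZ : ∀ z ∈ Z, ∑ i, b i * (z i : K) = 0) : Z.card ≤ 1 := by
  refine Finset.card_le_one.2 fun y hy z hz => ?_
  have := pair_unique_of_form hb (hZ y hy) (hZ z hz) (hbZ y hy) (hbZ z hz)
  exact funext fun i => Units.ext (congrFun this i)

/-- Solutions of the two-variable unit equation pointing in the same direction have comparable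
heights. -/
lemma nrm_le_of_same_direction {K : Type} [Field K] (S : PlaceSystem K) {x y x' y' : K}
    (hx : S.IsU x) (hy : S.IsU y) (hx' : S.IsU x')
    (hy' : S.IsU y') (h : x + y = 1) (h' : x' + y' = 1)
    (hbig : 2000 * S.deg ≤ S.nrm (S.L x))
    (h1 : S.nrm (S.L x' - (S.nrm (S.L x') / S.nrm (S.L x)) • S.L x) ≤ 1 / 16 * S.nrm (S.L x'))
    (h2 : S.nrm (S.L y' - (S.nrm (S.L y') / S.nrm (S.L y)) • S.L y) ≤ 1 / 16 * S.nrm (S.L y')) :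
    S.nrm (S.L x') ≤ 22 * S.nrm (S.L x) := by
  by_contra! hcon
  have hd := S.deg_pos'
  have hl := Real.log_two_lt_d9
  have e1 := S.nrm_L_one_sub_le hx hy h
  have e2 := S.nrm_L_one_sub_le hy hx (by rw [add_comm]; exact h)
  have e3 := S.nrm_L_one_sub_le hx' hy' h'
  have e4 := S.nrm_L_one_sub_le hy' hx' (by rw [add_comm]; exact h')
  have hdl : 2 * S.deg * Real.log 2 ≤ 1.4 * S.deg := by nlinarith
  set a := S.nrm (S.L x)
  set b := S.nrm (S.L y)
  set a' := S.nrm (S.L x')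
  set b' := S.nrm (S.L y')
  set d := S.deg
  have ha : 0 < a := by linarith
  have hb : 0 < b := by linarith
  set l := a' / a with hl'
  have hla : l * a = a' := by rw [hl']; field_simp
  have hl22 : 22 ≤ l := by rw [hl', le_div_iff₀ ha]; exact hcon.le
  obtain ⟨N, hN⟩ : ∃ N : ℕ, N = ⌊l / 2⌋₊ := ⟨_, rfl⟩
  have hN1 : (N : ℝ) ≤ l / 2 := hN ▸ Nat.floor_le (by positivity)
  have hN2 : l / 2 < N + 1 := hN ▸ Nat.lt_floor_add_one _
  have hN10 : (10 : ℝ) ≤ N := by linarith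
  have gap := S.unit_pair_gap hx hy hx' hy' h h' (N := N)
    (by exact_mod_cast (by linarith : (1 : ℝ) ≤ N))
  have habs : |l - (2 * N + 1)| ≤ 1 := abs_le.2 ⟨by linarith, by linarith⟩
  have f1 : S.nrm (S.L x' - (2 * N + 1 : ℝ) • S.L x) ≤ 1 / 16 * a' + a := by
    have : S.L x' - (2 * N + 1 : ℝ) • S.L x =
        (S.L x' - l • S.L x) + (l - (2 * N + 1)) • S.L x := by module
    rw [this]
    refine (S.nrm_add _ _).trans (add_le_add h1 ?_)
    rw [S.nrm_smul]
    exact mul_le_of_le_one_left ha.le habs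
  have f2 : S.nrm (S.L y' - (2 * N + 1 : ℝ) • S.L y) ≤ 1 / 16 * b' + |b' - l * b| + b := by
    have : S.L y' - (2 * N + 1 : ℝ) • S.L y =
        (S.L y' - (b' / b) • S.L y) + (b' / b - l) • S.L y + (l - (2 * N + 1)) • S.L y := by
      module
    rw [this]
    refine (S.nrm_add _ _).trans (add_le_add ((S.nrm_add _ _).trans (add_le_add h2 ?_)) ?_)
    · rw [S.nrm_smul]
      change |b' / b - l| * b ≤ _
      rw [← abs_of_pos hb, ← abs_mul, abs_of_pos hb, sub_mul, div_mul_cancel₀ _ hb.ne']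
    · rw [S.nrm_smul]
      exact mul_le_of_le_one_left hb.le habs
  have f3 : |b' - l * b| ≤ 1.4 * d * (1 + l) := by
    have l0 : 0 ≤ l := by linarith
    have g1 := mul_le_mul_of_nonneg_left (e1.trans (add_le_add_right hdl _)) l0
    have g2 := mul_le_mul_of_nonneg_left (e2.trans (add_le_add_right hdl _)) l0
    rw [abs_le]
    constructor <;> nlinarith
  have hlN : l ≤ 2 * N + 2 := by linarith
  have hla' : l * a ≤ (2 * N + 2) * a := mul_le_mul_of_nonneg_right hlN ha.le
  have hld : d * l ≤ d * (2 * N + 2) := mul_le_mul_of_nonneg_left hlN hd.le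
  have hNa : 2000 * d * N ≤ a * N := mul_le_mul_of_nonneg_right hbig (by linarith)
  have hNd : d * 10 ≤ d * N := mul_le_mul_of_nonneg_left hN10 hd.le
  have hNa' : a * 10 ≤ a * N := mul_le_mul_of_nonneg_left hN10 ha.le
  nlinarith

/-- The two-variable unit equation has boundedly many solutions in a group of given rank. -/
theorem exists_card_pair_le (ρ : ℕ) : ∃ C : ℕ, ∀ (K : Type) [Field K], HasPlaces K →
    ∀ Γ : Subgroup Kˣ, RankLE Γ ρ → ∀ Y : Finset (Fin 2 → Kˣ),
    (∀ y ∈ Y, (∀ i, y i ∈ Γ) ∧ ∑ i, (y i : K) = 1) → Y.card ≤ C := by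
  obtain ⟨Cs, hCs⟩ := exists_hyperplanes_of_bounded 2 ρ 2002 le_rfl (by norm_num)
  obtain ⟨Cl, hCl⟩ := exists_hyperplanes_of_large 2 ρ 23 (by norm_num) (by norm_num)
  obtain ⟨Cd, hCd⟩ := exists_direction_coloring ρ (κ := 1 / 16) (by norm_num)
  refine ⟨Cs + Cd * (Cd * Cl), fun K _ hK Γ hΓ Y hY => ?_⟩
  classical
  obtain ⟨S, hS⟩ := hK (Y.biUnion fun y => Finset.univ.image y)
  have hU : ∀ y ∈ Y, ∀ i, S.IsU (y i : K) := fun y hy i =>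
    hS _ (Finset.mem_biUnion.2 ⟨y, hy, Finset.mem_image_of_mem _ (Finset.mem_univ _)⟩)
  have hd := S.deg_pos'
  have hl := Real.log_two_lt_d9
  have hdl : 2 * S.deg * Real.log 2 ≤ 1.4 * S.deg := by nlinarith
  have hsum : ∀ y ∈ Y, (y 0 : K) + y 1 = 1 := fun y hy => by
    rw [← Fin.sum_univ_two fun i => (y i : K)]; exact (hY y hy).2
  have hh : ∀ y ∈ Y, S.nrm (S.L (y 1)) ≤ S.nrm (S.L (y 0)) + 1.4 * S.deg := fun y hy =>
    (S.nrm_L_one_sub_le (hU y hy 0) (hU y hy 1) (hsum y hy)).trans (add_le_add_right hdl _)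
  have hh' : ∀ y ∈ Y, S.nrm (S.L (y 0)) ≤ S.nrm (S.L (y 1)) + 1.4 * S.deg := fun y hy =>
    (S.nrm_L_one_sub_le (hU y hy 1) (hU y hy 0)
      (by rw [add_comm]; exact hsum y hy)).trans (add_le_add_right hdl _)
  rw [← Finset.card_filter_add_card_filter_not
    (fun y : Fin 2 → Kˣ => S.nrm (S.L (y 0)) < 2000 * S.deg)]
  refine add_le_add ?_ ?_
  · obtain ⟨B, hB, hb, hBY⟩ := hCs (Fin 2) rfl K S Γ hΓ
      (Y.filter fun y : Fin 2 → Kˣ => S.nrm (S.L (y 0)) < 2000 * S.deg) (by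
        intro y hy
        obtain ⟨hy, hs⟩ := Finset.mem_filter.1 (Finset.mem_coe.1 hy)
        refine ⟨(hY y hy).1, hU y hy, (hY y hy).2, fun i => ?_⟩
        have := hh y hy
        fin_cases i <;> simp only [Fin.zero_eta, Fin.mk_one] <;> linarith)
    refine (card_le_mul_of_cover _ B (fun y b => ∑ i, b i * (y i : K) = 0) 1 hBY ?_).trans
      (by omega)
    intro b hb' Z hZ h
    exact card_le_one_of_form (hb b hb') Z
      (fun z hz => (hY z (Finset.mem_filter.1 (hZ hz)).1).2) h
  · obtain ⟨c, hc⟩ := hCd K S Γ hΓ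
    refine card_le_mul_of_fin_cover _ (fun y => c (y 0)) _ fun Z₁ hZ₁ h₁ => ?_
    refine card_le_mul_of_fin_cover _ (fun y => c (y 1)) _ fun Z hZ h₂ => ?_
    rcases Z.eq_empty_or_nonempty with rfl | hne
    · simp
    obtain ⟨z, hz, hmin⟩ := Z.exists_min_image (fun y => S.nrm (S.L (y 0))) hne
    have hZY : ∀ y ∈ Z, y ∈ Y ∧ 2000 * S.deg ≤ S.nrm (S.L (y 0)) := fun y hy => by
      have := Finset.mem_filter.1 (hZ₁ (hZ hy))
      exact ⟨this.1, not_lt.1 this.2⟩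
    have hzbig := (hZY z hz).2
    obtain ⟨B, hB, hb, hBY⟩ := hCl (Fin 2) rfl K S Γ hΓ Z (S.nrm (S.L (z 0))) (by
        simp only [Nat.factorial_two, Nat.cast_ofNat]
        linarith) (by
        intro y hy
        obtain ⟨hyY, hybig⟩ := hZY y hy
        refine ⟨(hY y hyY).1, hU y hyY, (hY y hyY).2, ⟨0, hmin y hy⟩, ?_⟩
        have h22 := S.nrm_le_of_same_direction (hU z (hZY z hz).1 0) (hU z (hZY z hz).1 1)
          (hU y hyY 0) (hU y hyY 1) (hsum z (hZY z hz).1) (hsum y hyY) hzbig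
          (hc _ ((hY z (hZY z hz).1).1 0) _ ((hY y hyY).1 0) (by linarith) (by linarith)
            (h₁ z (hZ hz) y (hZ hy)))
          (hc _ ((hY z (hZY z hz).1).1 1) _ ((hY y hyY).1 1)
            (by linarith [hh' z (hZY z hz).1]) (by linarith [hh' y hyY]) (h₂ z hz y hy))
        have := hh y hyY
        intro i
        fin_cases i <;> simp only [Fin.zero_eta, Fin.mk_one] <;> linarith)
    refine (card_le_mul_of_cover _ B (fun y b => ∑ i, b i * (y i : K) = 0) 1 hBY ?_).trans
      (by omega)
    intro b hb' Z' hZ' h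
    exact card_le_one_of_form (hb b hb') Z' (fun z hz => (hY z (hZY z (hZ' hz)).1).2) h

end PlaceSystem

namespace PlaceSystem

/-- The monomial `m ^ (r - e) * t ^ e`. -/
def mono (m t r e : ℕ) : ℕ := m ^ (r - e) * t ^ e

lemma mono_mul {m t r e r' e' : ℕ} (h : e ≤ r) (h' : e' ≤ r') :
    mono m t r e * mono m t r' e' = mono m t (r + r') (e + e') := by
  unfold mono
  rw [show r + r' - (e + e') = (r - e) + (r' - e') by omega, pow_add, pow_add]
  ring

lemma mono_le_mono {m t r e e' : ℕ} (hm : m ≤ t) (h : e ≤ e') (h' : e' ≤ r) :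
    mono m t r e ≤ mono m t r e' := by
  unfold mono
  rw [show r - e = (r - e') + (e' - e) by omega, pow_add, mul_assoc]
  refine Nat.mul_le_mul_left _ ?_
  calc m ^ (e' - e) * t ^ e ≤ t ^ (e' - e) * t ^ e := by gcongr
    _ = t ^ e' := by rw [← pow_add]; congr 1; omega

/-- A finite set `T` with unit-valued functions on it, all of whose fibres are small. -/
structure Family (K : Type) [Field K] (ρ : ℕ) (ι α : Type) (m t : ℕ) where
  Γ : Subgroup Kˣ
  rank : RankLE Γ ρ
  T : Finset α
  g : ι → α → Kˣ
  mem : ∀ i x, g i x ∈ Γ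
  le : m ≤ t
  card_le : T.card ≤ t
  fibre : ∀ i u, ∀ Z ⊆ T, (∀ x ∈ Z, g i x = u) → Z.card ≤ m

namespace Family

variable {K : Type} [Field K] {ρ : ℕ} {ι α : Type} {m t : ℕ}

/-- Tuples in `T` whose values have sum `w`. -/
def Sol [Fintype ι] (F : Family K ρ ι α m t) (w : K) (y : ι → α) : Prop :=
  (∀ i, y i ∈ F.T) ∧ ∑ i, (F.g i (y i) : K) = w

/-- No nonempty subsum vanishes. -/
def Nondeg (F : Family K ρ ι α m t) (y : ι → α) : Prop :=
  ∀ J : Finset ι, J.Nonempty → ∑ i ∈ J, (F.g i (y i) : K) ≠ 0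

/-- Restriction to a subset of the variables. -/
def restrict (F : Family K ρ ι α m t) (p : ι → Prop) : Family K ρ {i // p i} α m t where
  Γ := F.Γ
  rank := F.rank
  T := F.T
  g i := F.g i
  mem i := F.mem i
  le := F.le
  card_le := F.card_le
  fibre i := F.fibre i

/-- Multiplication of the functions by constants. -/
def twist [Fintype ι] [DecidableEq Kˣ] (F : Family K ρ ι α m t) (c : ι → Kˣ) :
    Family K (ρ + Fintype.card ι) ι α m t where
  Γ := F.Γ ⊔ Subgroup.closure ((Finset.univ.image c : Finset Kˣ) : Set Kˣ)
  rank := (F.rank.sup_closure _).mono (Nat.add_le_add_left Finset.card_image_le _)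
  T := F.T
  g i x := F.g i x * c i
  mem i x := Subgroup.mul_mem_sup (F.mem i x) (Subgroup.subset_closure (by simp))
  le := F.le
  card_le := F.card_le
  fibre i u Z hZ h := F.fibre i (u * (c i)⁻¹) Z hZ fun x hx => by
    rw [← h x hx, mul_inv_cancel_right]

/-- Restriction to a subset of `T`. -/
def shrink (F : Family K ρ ι α m t) (T' : Finset α) (hT : T' ⊆ F.T) :
    Family K ρ ι α (min m T'.card) T'.card where
  Γ := F.Γ
  rank := F.rank
  T := T'
  g := F.g
  mem := F.mem
  le := min_le_right _ _
  card_le := le_rfl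
  fibre i u Z hZ h := le_min (F.fibre i u Z (hZ.trans hT) h) (Finset.card_le_card hZ)

end Family

lemma card_le_of_split {ι α : Type} [Fintype ι] (p : ι → Prop) (Y : Finset (ι → α))
    (Q : Finset ({i // p i} → α)) (hQ : ∀ y ∈ Y, (fun i => y i.1) ∈ Q) (n : ℕ)
    (hn : ∀ z ∈ Q, ∀ Z : Finset ({i // ¬ p i} → α),
      (∀ z' ∈ Z, ∃ y ∈ Y, (fun i => y i.1) = z ∧ (fun i => y i.1) = z') → Z.card ≤ n) :
    Y.card ≤ Q.card * n := by
  classical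
  refine card_le_mul_of_cover Y Q (fun y z => (fun i => y i.1) = z) n
    (fun y hy => ⟨_, hQ y hy, rfl⟩) fun z hz W hW h => ?_
  have := hn z hz (W.image fun y i => y i.1) (by
    intro z' hz'
    obtain ⟨y, hy, rfl⟩ := Finset.mem_image.1 hz'
    exact ⟨y, hW hy, h y hy, rfl⟩)
  rwa [Finset.card_image_of_injOn] at this
  intro y hy y' hy' hyy'
  have h1 := (h y hy).trans (h y' hy').symm
  funext i
  by_cases hi : p i
  · exact congrFun h1 ⟨i, hi⟩
  · exact congrFun hyy' ⟨i, hi⟩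

/-- The bound for the number of solutions with sum one. -/
def CountOne (r : ℕ) : Prop :=
  ∀ ρ, ∃ C : ℕ, ∀ (K : Type) [Field K], HasPlaces K → ∀ (ι : Type) [Fintype ι],
    Fintype.card ι = r → ∀ (α : Type) (m t : ℕ) (F : Family K ρ ι α m t) (Y : Finset (ι → α)),
    (∀ y ∈ Y, F.Sol 1 y) → Y.card ≤ C * mono m t r ((r - 1) / 2)

lemma card_le_of_card_image_le {K : Type} [Field K] {ρ : ℕ} {ι α : Type} [Fintype ι] {m t : ℕ}
    (F : Family K ρ ι α m t) (Y : Finset (ι → α)) (hY : ∀ y ∈ Y, ∀ i, y i ∈ F.T)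
    (Q : Finset (ι → Kˣ)) (hQ : ∀ y ∈ Y, (fun i => F.g i (y i)) ∈ Q) :
    Y.card ≤ Q.card * m ^ Fintype.card ι := by
  classical
  refine card_le_mul_of_cover Y Q (fun y z => (fun i => F.g i (y i)) = z) _
    (fun y hy => ⟨_, hQ y hy, rfl⟩) fun z _ W hW h => ?_
  have hsub : W ⊆ Fintype.piFinset fun i => F.T.filter fun x => F.g i x = z i := by
    intro y hy
    refine Fintype.mem_piFinset.2 fun i => Finset.mem_filter.2 ⟨hY y (hW hy) i, ?_⟩
    exact congrFun (h y hy) i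
  refine (Finset.card_le_card hsub).trans ?_
  rw [Fintype.card_piFinset]
  refine (Finset.prod_le_pow_card _ _ m fun i _ => ?_).trans (by simp)
  exact F.fibre i (z i) _ (Finset.filter_subset _ _) fun x hx => (Finset.mem_filter.1 hx).2

lemma countOne_zero : CountOne 0 := by
  intro ρ
  refine ⟨0, fun K _ _ ι _ hι α m t F Y hY => ?_⟩
  have : IsEmpty ι := Fintype.card_eq_zero_iff.1 hι
  rw [Finset.card_eq_zero.2 (Finset.eq_empty_of_forall_notMem fun y hy => ?_)]
  · simp
  · have := (hY y hy).2
    simp at this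

lemma countOne_one : CountOne 1 := by
  intro ρ
  refine ⟨1, fun K _ _ ι _ hι α m t F Y hY => ?_⟩
  classical
  have := card_le_of_card_image_le F Y (fun y hy => (hY y hy).1) {1} (by
    intro y hy
    have h := (hY y hy).2
    obtain ⟨i, hi⟩ := Fintype.card_eq_one_iff.1 hι
    rw [Finset.sum_eq_single i (by intro j _ hj; exact absurd (hi j) hj) (by simp)] at h
    rw [Finset.mem_singleton]
    funext j
    rw [hi j]
    exact Units.ext h)
  simpa [mono, hι] using this

lemma countOne_two : CountOne 2 := by
  intro ρ
  obtain ⟨C, hC⟩ := exists_card_pair_le ρ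
  refine ⟨C, fun K _ hK ι _ hι α m t F Y hY => ?_⟩
  classical
  have e : ι ≃ Fin 2 := Fintype.equivFinOfCardEq hι
  have h1 := card_le_of_card_image_le F Y (fun y hy => (hY y hy).1)
    (Y.image fun y i => F.g i (y i)) (fun y hy => Finset.mem_image_of_mem _ hy)
  have h2 := hC K hK F.Γ F.rank (Y.image fun y k => F.g (e.symm k) (y (e.symm k))) (by
    intro z hz
    obtain ⟨y, hy, rfl⟩ := Finset.mem_image.1 hz
    refine ⟨fun i => F.mem _ _, ?_⟩
    rw [← (hY y hy).2]
    exact e.symm.sum_comp fun i => (F.g i (y i) : K))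
  have h3 : (Y.image fun y i => F.g i (y i)).card ≤
      (Y.image fun y k => F.g (e.symm k) (y (e.symm k))).card := by
    have himg : (Y.image fun y k => F.g (e.symm k) (y (e.symm k))) =
        (Y.image fun y i => F.g i (y i)).image fun z k => z (e.symm k) := by
      rw [Finset.image_image]; rfl
    have hinj : Function.Injective fun (z : ι → Kˣ) (k : Fin 2) => z (e.symm k) := by
      intro z z' h
      funext i
      simpa using congrFun h (e i)
    rw [himg, Finset.card_image_of_injective _ hinj]
  rw [hι] at h1
  refine h1.trans ?_
  simp only [mono]
  norm_num
  exact Nat.mul_le_mul_right _ (h3.trans h2)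

/-- Nonzero coefficients and an arbitrary nonzero sum. -/
lemma CountOne.twist {r : ℕ} (h : CountOne r) (ρ : ℕ) :
    ∃ C : ℕ, ∀ (K : Type) [Field K], HasPlaces K → ∀ (ι : Type) [Fintype ι],
    Fintype.card ι = r → ∀ (α : Type) (m t : ℕ) (F : Family K ρ ι α m t) (Y : Finset (ι → α))
    (c : ι → K) (w : K), (∀ i, c i ≠ 0) → w ≠ 0 →
    (∀ y ∈ Y, (∀ i, y i ∈ F.T) ∧ ∑ i, c i * (F.g i (y i) : K) = w) →
    Y.card ≤ C * mono m t r ((r - 1) / 2) := by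
  obtain ⟨C, hC⟩ := h (ρ + r)
  refine ⟨C, fun K _ hK ι _ hι α m t F Y c w hc hw hY => ?_⟩
  subst hι
  classical
  refine hC K hK ι rfl α m t (F.twist fun i => Units.mk0 (c i / w) (div_ne_zero (hc i) hw)) Y
    fun y hy => ⟨(hY y hy).1, ?_⟩
  have h1 := (hY y hy).2
  simp only [Family.twist, Units.val_mul, Units.val_mk0]
  rw [← div_self hw]
  nth_rw 2 [← h1]
  rw [Finset.sum_div]
  exact Finset.sum_congr rfl fun i _ => by ring

/-- Fixing one variable so that the remaining sum is nonzero. -/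
lemma CountOne.fix {r : ℕ} (h : CountOne r) (ρ : ℕ) :
    ∃ C : ℕ, ∀ (K : Type) [Field K], HasPlaces K → ∀ (ι : Type) [Fintype ι],
    Fintype.card ι = r + 1 → ∀ (α : Type) (m t : ℕ) (F : Family K ρ ι α m t) (Y : Finset (ι → α))
    (i : ι) (w : K), (∀ y ∈ Y, F.Sol w y ∧ w - F.g i (y i) ≠ 0) →
    Y.card ≤ C * mono m t (r + 1) ((r - 1) / 2 + 1) := by
  obtain ⟨C, hC⟩ := h.twist ρ
  refine ⟨C, fun K _ hK ι _ hι α m t F Y i w hY => ?_⟩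
  classical
  have := card_le_of_split (· = i) Y (F.T.image fun a _ => a) (by
    intro y hy
    refine Finset.mem_image.2 ⟨y i, (hY y hy).1.1 i, ?_⟩
    funext ⟨j, hj⟩
    exact congrArg y hj.symm) (C * mono m t r ((r - 1) / 2)) (by
    intro z _ Z hZ
    have hcard : Fintype.card {j // ¬ j = i} = r := by
      rw [Fintype.card_subtype_compl, hι, Fintype.card_subtype_eq]; rfl
    by_cases hz : w - F.g i (z ⟨i, rfl⟩) = 0
    · rw [Finset.card_eq_zero.2 (Finset.eq_empty_of_forall_notMem fun z' hz' => ?_)]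
      · simp
      · obtain ⟨y, hy, rfl, -⟩ := hZ z' hz'
        exact (hY y hy).2 hz
    refine hC K hK _ hcard α m t (F.restrict _) Z (fun _ => 1) _ (fun _ => one_ne_zero) hz ?_
    intro z' hz'
    obtain ⟨y, hy, rfl, rfl⟩ := hZ z' hz'
    refine ⟨fun j => (hY y hy).1.1 _, ?_⟩
    have h1 := (hY y hy).1.2
    rw [Fintype.sum_eq_add_sum_subtype_ne _ i] at h1
    simp only [Family.restrict, one_mul]
    rw [← h1, add_sub_cancel_left])
  refine this.trans ?_
  calc _ ≤ t * (C * mono m t r ((r - 1) / 2)) :=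
        Nat.mul_le_mul_right _ (Finset.card_image_le.trans F.card_le)
    _ = C * (mono m t 1 1 * mono m t r ((r - 1) / 2)) := by simp [mono]; ring
    _ = _ := by
      rw [mono_mul le_rfl (by omega), add_comm 1 r, add_comm 1]

/-- The bound for the number of solutions with sum zero. -/
lemma CountOne.zero {r : ℕ} (h : CountOne (r - 1)) (ρ : ℕ) :
    ∃ C : ℕ, ∀ (K : Type) [Field K], HasPlaces K → ∀ (ι : Type) [Fintype ι],
    Fintype.card ι = r → ∀ (α : Type) (m t : ℕ) (F : Family K ρ ι α m t) (Y : Finset (ι → α)),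
    (∀ y ∈ Y, F.Sol 0 y) → Y.card ≤ C * mono m t r (r / 2) := by
  rcases r with _ | _ | r
  · refine ⟨1, fun K _ _ ι _ hι α m t F Y _ => ?_⟩
    have : IsEmpty ι := Fintype.card_eq_zero_iff.1 hι
    simpa [mono] using Finset.card_le_one_of_subsingleton Y
  · refine ⟨0, fun K _ _ ι _ hι α m t F Y hY => ?_⟩
    rw [Finset.card_eq_zero.2 (Finset.eq_empty_of_forall_notMem fun y hy => ?_)]
    · simp
    · have h := (hY y hy).2
      obtain ⟨i, hi⟩ := Fintype.card_eq_one_iff.1 hι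
      rw [Finset.sum_eq_single i (by intro j _ hj; exact absurd (hi j) hj) (by simp)] at h
      exact (F.g i (y i)).ne_zero h
  · obtain ⟨C, hC⟩ := h.fix ρ
    refine ⟨C, fun K _ hK ι _ hι α m t F Y hY => ?_⟩
    have : Nonempty ι := Fintype.card_pos_iff.1 (by omega)
    obtain ⟨i⟩ := this
    refine (hC K hK ι (by omega) α m t F Y i 0 fun y hy => ⟨hY y hy, by simp⟩).trans_eq ?_
    congr 2
    omega

end PlaceSystem

namespace PlaceSystem

lemma exists_uniform {P : ℕ → ℕ → Prop} (hP : ∀ n C C', C ≤ C' → P n C → P n C') (r : ℕ)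
    (h : ∀ n < r, ∃ C, P n C) : ∃ C, ∀ n < r, P n C := by
  induction r with
  | zero => exact ⟨0, fun n hn => absurd hn (Nat.not_lt_zero n)⟩
  | succ r ih =>
    obtain ⟨C, hC⟩ := ih fun n hn => h n (hn.trans r.lt_succ_self)
    obtain ⟨C', hC'⟩ := h r r.lt_succ_self
    refine ⟨max C C', fun n hn => ?_⟩
    rcases Nat.lt_succ_iff_lt_or_eq.1 hn with hn | rfl
    · exact hP n _ _ (le_max_left _ _) (hC n hn)
    · exact hP n _ _ (le_max_right _ _) hC'

lemma CountOne.twist_uniform {r : ℕ} (h : ∀ n < r, CountOne n) (ρ : ℕ) :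
    ∃ C : ℕ, ∀ n < r, ∀ (K : Type) [Field K], HasPlaces K → ∀ (ι : Type) [Fintype ι],
    Fintype.card ι = n → ∀ (α : Type) (m t : ℕ) (F : Family K ρ ι α m t) (Y : Finset (ι → α))
    (c : ι → K) (w : K), (∀ i, c i ≠ 0) → w ≠ 0 →
    (∀ y ∈ Y, (∀ i, y i ∈ F.T) ∧ ∑ i, c i * (F.g i (y i) : K) = w) →
    Y.card ≤ C * mono m t n ((n - 1) / 2) := by
  refine exists_uniform ?_ r fun n hn => (h n hn).twist ρ
  intro n C C' hCC h K _ hK ι _ hι α m t F Y c w hc hw hY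
  exact (h K hK ι hι α m t F Y c w hc hw hY).trans (Nat.mul_le_mul_right _ hCC)

lemma CountOne.zero_uniform {r : ℕ} (h : ∀ n < r, CountOne n) (ρ : ℕ) :
    ∃ C : ℕ, ∀ n < r, ∀ (K : Type) [Field K], HasPlaces K → ∀ (ι : Type) [Fintype ι],
    Fintype.card ι = n → ∀ (α : Type) (m t : ℕ) (F : Family K ρ ι α m t) (Y : Finset (ι → α)),
    (∀ y ∈ Y, F.Sol 0 y) → Y.card ≤ C * mono m t n (n / 2) := by
  refine exists_uniform ?_ r fun n hn => CountOne.zero (h (n - 1) (by omega)) ρ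
  intro n C C' hCC h K _ hK ι _ hι α m t F Y hY
  exact (h K hK ι hι α m t F Y hY).trans (Nat.mul_le_mul_right _ hCC)

/-- The bound for solutions with a vanishing subsum. -/
lemma exists_card_degenerate_le {r : ℕ} (h : ∀ n < r, CountOne n) (ρ : ℕ) :
    ∃ C : ℕ, ∀ (K : Type) [Field K], HasPlaces K → ∀ (ι : Type) [Fintype ι],
    Fintype.card ι = r → ∀ (α : Type) (m t : ℕ) (F : Family K ρ ι α m t) (Y : Finset (ι → α)),
    (∀ y ∈ Y, F.Sol 1 y ∧ ¬ F.Nondeg y) → Y.card ≤ C * mono m t r ((r - 1) / 2) := by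
  obtain ⟨C₁, hC₁⟩ := CountOne.zero_uniform h ρ
  obtain ⟨C₂, hC₂⟩ := CountOne.twist_uniform h ρ
  refine ⟨2 ^ r * (C₁ * C₂), fun K _ hK ι _ hι α m t F Y hY => ?_⟩
  classical
  subst hι
  have := card_le_mul_of_cover Y (Finset.univ : Finset (Finset ι))
    (fun y J => J.Nonempty ∧ ∑ i ∈ J, (F.g i (y i) : K) = 0)
    (C₁ * C₂ * mono m t (Fintype.card ι) ((Fintype.card ι - 1) / 2)) (by
      intro y hy
      have := (hY y hy).2
      simp only [Family.Nondeg, not_forall, not_not] at this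
      obtain ⟨J, hJ, h0⟩ := this
      exact ⟨J, Finset.mem_univ _, hJ, h0⟩) (by
    intro J _ Z hZ hJ
    rcases Z.eq_empty_or_nonempty with rfl | ⟨y₀, hy₀⟩
    · simp
    have hJne := (hJ y₀ hy₀).1
    have hJlt : J.card < Fintype.card ι := by
      rw [Finset.card_lt_iff_ne_univ]
      rintro rfl
      have h1 := (hJ y₀ hy₀).2
      rw [(hY y₀ (hZ hy₀)).1.2] at h1
      exact one_ne_zero h1
    have hJpos := hJne.card_pos
    have hc : Fintype.card {i // ¬ i ∈ J} = Fintype.card ι - J.card := by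
      rw [Fintype.card_of_subtype Jᶜ (by simp), Finset.card_compl]
    have hQ := hC₁ J.card hJlt K hK {i // i ∈ J} (Fintype.card_of_subtype J (by simp)) α m t
      (F.restrict _) (Z.image fun y i => y i.1) (by
        intro z hz
        obtain ⟨y, hy, rfl⟩ := Finset.mem_image.1 hz
        refine ⟨fun i => (hY y (hZ hy)).1.1 _, ?_⟩
        rw [← (hJ y hy).2]
        exact (Finset.sum_subtype J (by simp) fun i => (F.g i (y i) : K)).symm)
    refine (card_le_of_split (· ∈ J) Z _ (fun y hy => Finset.mem_image_of_mem _ hy)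
      (C₂ * mono m t (Fintype.card ι - J.card) ((Fintype.card ι - J.card - 1) / 2)) ?_).trans ?_
    · intro z _ W hW
      refine hC₂ _ (by omega) K hK _ hc α m t (F.restrict _) W (fun _ => 1) 1
        (fun _ => one_ne_zero) one_ne_zero fun z' hz' => ?_
      obtain ⟨y, hy, rfl, rfl⟩ := hW z' hz'
      refine ⟨fun i => (hY y (hZ hy)).1.1 _, ?_⟩
      have h1 := (hY y (hZ hy)).1.2
      rw [← Finset.sum_add_sum_compl J, (hJ y hy).2, zero_add,
        Finset.sum_subtype (p := fun i => ¬ i ∈ J) Jᶜ (by simp)] at h1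
      simpa [Family.restrict] using h1
    · refine (Nat.mul_le_mul_right _ hQ).trans ?_
      calc _ = C₁ * C₂ * (mono m t J.card (J.card / 2) *
            mono m t (Fintype.card ι - J.card) ((Fintype.card ι - J.card - 1) / 2)) := by ring
        _ ≤ _ := by
          rw [mono_mul (by omega) (by omega), Nat.add_sub_cancel' hJlt.le]
          exact Nat.mul_le_mul_left _ (mono_le_mono F.le (by omega) (by omega)))
  refine this.trans_eq ?_
  rw [Finset.card_univ, Fintype.card_finset]
  ring

/-- The bound for nondegenerate solutions on a hyperplane. -/
lemma exists_card_le_of_form {r : ℕ} (h : ∀ n < r, CountOne n) (ρ : ℕ) :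
    ∃ C : ℕ, ∀ (K : Type) [Field K], HasPlaces K → ∀ (ι : Type) [Fintype ι],
    Fintype.card ι = r → ∀ (α : Type) (m t : ℕ) (F : Family K ρ ι α m t) (Y : Finset (ι → α))
    (b : ι → K), b ≠ 0 →
    (∀ y ∈ Y, (F.Sol 1 y ∧ F.Nondeg y) ∧ ∑ i, b i * (F.g i (y i) : K) = 0) →
    Y.card ≤ C * mono m t r ((r - 2) / 2) := by
  obtain ⟨C, hC⟩ := CountOne.twist_uniform h ρ
  refine ⟨C * C, fun K _ hK ι _ hι α m t F Y b hb hY => ?_⟩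
  classical
  subst hι
  rcases Y.eq_empty_or_nonempty with rfl | ⟨y₀, hy₀⟩
  · simp
  obtain ⟨k, hk⟩ := Function.ne_iff.1 hb
  rw [Pi.zero_apply] at hk
  obtain ⟨J, hJ⟩ : ∃ J : Finset ι, ∀ j, j ∈ J ↔ b j ≠ b k :=
    ⟨Finset.univ.filter fun j => b j ≠ b k, by simp⟩
  have hsum : ∀ y ∈ Y, ∑ j ∈ J, (b k - b j) / b k * (F.g j (y j) : K) = 1 := by
    intro y hy
    rw [Finset.sum_subset (Finset.subset_univ J) (fun j _ hj => by
      rw [hJ, not_not] at hj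
      rw [hj, sub_self, zero_div, zero_mul])]
    have h1 : ∀ j, (b k - b j) / b k * (F.g j (y j) : K) =
        F.g j (y j) - (b k)⁻¹ * (b j * F.g j (y j)) := fun j => by field_simp
    rw [Finset.sum_congr rfl fun j _ => h1 j, Finset.sum_sub_distrib, ← Finset.mul_sum,
      (hY y hy).2, (hY y hy).1.1.2, mul_zero, sub_zero]
  have hJlt : J.card < Fintype.card ι := by
    rw [Finset.card_lt_iff_ne_univ]
    rintro rfl
    exact (hJ k).1 (Finset.mem_univ _) rfl
  have hJpos : 0 < J.card := by
    rw [Finset.card_pos, Finset.nonempty_iff_ne_empty]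
    rintro rfl
    simpa using hsum y₀ hy₀
  have hc : Fintype.card {i // ¬ i ∈ J} = Fintype.card ι - J.card := by
    rw [Fintype.card_of_subtype Jᶜ (by simp), Finset.card_compl]
  have hQ := hC J.card hJlt K hK {i // i ∈ J} (Fintype.card_of_subtype J (by simp)) α m t
    (F.restrict _) (Y.image fun y i => y i.1) (fun i => (b k - b i.1) / b k) 1
    (fun i => div_ne_zero (sub_ne_zero.2 ((hJ i.1).1 i.2).symm) hk) one_ne_zero (by
      intro z hz
      obtain ⟨y, hy, rfl⟩ := Finset.mem_image.1 hz
      refine ⟨fun i => (hY y hy).1.1.1 _, ?_⟩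
      rw [← hsum y hy]
      exact (Finset.sum_subtype J (by simp)
        fun i => (b k - b i) / b k * (F.g i (y i) : K)).symm)
  refine (card_le_of_split (· ∈ J) Y _ (fun y hy => Finset.mem_image_of_mem _ hy)
    (C * mono m t (Fintype.card ι - J.card) ((Fintype.card ι - J.card - 1) / 2)) ?_).trans ?_
  · intro z _ W hW
    rcases W.eq_empty_or_nonempty with rfl | ⟨z₀, hz₀⟩
    · simp
    have hrest : ∀ y ∈ Y, ∑ i : {i // ¬ i ∈ J}, (F.g i.1 (y i.1) : K) =
        1 - ∑ i : {i // i ∈ J}, (F.g i.1 (y i.1) : K) := by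
      intro y hy
      have h1 := (hY y hy).1.1.2
      rw [← Finset.sum_add_sum_compl J, Finset.sum_subtype (p := fun i => ¬ i ∈ J) Jᶜ (by simp),
        Finset.sum_subtype (p := fun i => i ∈ J) J (by simp)] at h1
      rw [← h1, add_sub_cancel_left]
    refine hC _ (by omega) K hK _ hc α m t (F.restrict _) W (fun _ => 1)
      (1 - ∑ i : {i // i ∈ J}, (F.g i.1 (z i) : K)) (fun _ => one_ne_zero) ?_ fun z' hz' => ?_
    · obtain ⟨y, hy, rfl, -⟩ := hW z₀ hz₀
      rw [← hrest y hy, ← Finset.sum_subtype (p := fun i => ¬ i ∈ J) Jᶜ (by simp)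
        fun i => (F.g i (y i) : K)]
      refine (hY y hy).1.2 _ (Finset.card_pos.1 ?_)
      rw [Finset.card_compl]
      omega
    · obtain ⟨y, hy, rfl, rfl⟩ := hW z' hz'
      refine ⟨fun i => (hY y hy).1.1.1 _, ?_⟩
      rw [← hrest y hy]
      simp [Family.restrict]
  · refine (Nat.mul_le_mul_right _ hQ).trans ?_
    calc _ = C * C * (mono m t J.card ((J.card - 1) / 2) *
          mono m t (Fintype.card ι - J.card) ((Fintype.card ι - J.card - 1) / 2)) := by ring
      _ ≤ _ := by
        rw [mono_mul (by omega) (by omega), Nat.add_sub_cancel' hJlt.le]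
        exact Nat.mul_le_mul_left _ (mono_le_mono F.le (by omega) (by omega))

end PlaceSystem

namespace PlaceSystem

/-- Nondegenerate solutions with one prescribed entry dominating the others, such that the
remaining terms are not proportional. -/
lemma exists_card_le_of_top {r : ℕ} (hr : 1 ≤ r) (h : ∀ n < r, CountOne n) (ρ : ℕ) :
    ∃ C : ℕ, ∀ (K : Type) [Field K], HasPlaces K → ∀ (S : PlaceSystem K) (ι : Type) [Fintype ι],
    Fintype.card ι = r + 1 → ∀ (α : Type) (m t : ℕ) (F : Family K ρ ι α m t) (Y : Finset (ι → α))
    (i : ι) (a : α), S.IsU (1 - F.g i a : K) →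
    16 * S.deg * Real.log r.factorial < S.nrm (S.L (F.g i a)) →
    2 * S.deg ≤ S.nrm (S.L (F.g i a)) →
    (∀ y ∈ Y, (F.Sol 1 y ∧ F.Nondeg y) ∧ y i = a ∧ (∀ j, S.IsU (F.g j (y j) : K)) ∧
      (∀ j, S.nrm (S.L (F.g j (y j))) ≤ S.nrm (S.L (F.g i a))) ∧
      ∃ j, j ≠ i ∧ S.nrm (S.L (F.g i a)) / 4 ≤ S.nrm (S.L (F.g j (y j) / (1 - F.g i a)))) →
    Y.card ≤ C * mono m t r ((r - 2) / 2) := by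
  obtain ⟨C, hC⟩ := exists_hyperplanes_of_large r (ρ + r) 12 hr (by norm_num)
  obtain ⟨C', hC'⟩ := exists_card_le_of_form h (ρ + r)
  refine ⟨C * C', fun K _ hK S ι _ hι α m t F Y i a hη hbig hbig' hY => ?_⟩
  classical
  have hcard : Fintype.card {j // ¬ j = i} = r := by
    rw [Fintype.card_subtype_compl, hι, Fintype.card_subtype_eq]; rfl
  subst hcard
  rcases Y.eq_empty_or_nonempty with rfl | hne
  · simp
  set H := S.nrm (S.L (F.g i a)) with hH
  set F' := (F.restrict fun j => ¬ j = i).twist fun _ => (Units.mk0 _ hη.1)⁻¹ with hF'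
  have hg : ∀ (j : {j // ¬ j = i}) (x : α), (F'.g j x : K) = F.g j.1 x / (1 - F.g i a) :=
    fun j x => by simp [hF', Family.twist, Family.restrict, div_eq_mul_inv]
  have hsumJ : ∀ (y : ι → α) (J : Finset {j // ¬ j = i}),
      ∑ j ∈ J, (F'.g j (y j.1) : K) =
        (∑ j ∈ J.map (Function.Embedding.subtype _), (F.g j (y j) : K)) / (1 - F.g i a) := by
    intro y J
    rw [Finset.sum_map, Finset.sum_div]
    exact Finset.sum_congr rfl fun j _ => hg j _
  have hsol : ∀ y ∈ Y, F'.Sol 1 fun j => y j.1 := by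
    intro y hy
    refine ⟨fun j => (hY y hy).1.1.1 _, ?_⟩
    have h1 := (hY y hy).1.1.2
    rw [Fintype.sum_eq_add_sum_subtype_ne _ i, (hY y hy).2.1] at h1
    rw [Finset.sum_congr rfl fun j _ => hg j _, ← Finset.sum_div, div_eq_one_iff_eq hη.1, ← h1,
      add_sub_cancel_left]
  have hnd : ∀ y ∈ Y, F'.Nondeg fun j => y j.1 := by
    intro y hy J hJ
    rw [hsumJ]
    exact div_ne_zero ((hY y hy).1.2 _ (hJ.map)) hη.1
  have hηle : S.nrm (S.L (1 - F.g i a : K)) ≤ 2 * H := by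
    obtain ⟨y, hy⟩ := hne
    have h1 := (hY y hy).2.2.1 i
    rw [(hY y hy).2.1] at h1
    have := S.nrm_L_one_sub_le h1 hη (by ring)
    have hl := Real.log_two_lt_d9
    have hd := S.deg_pos'
    nlinarith
  have hcardY : Y.card = (Y.image fun y (j : {j // ¬ j = i}) => y j.1).card := by
    refine (Finset.card_image_of_injOn ?_).symm
    intro y hy y' hy' hyy'
    funext j
    by_cases hj : j = i
    · rw [hj, (hY y hy).2.1, (hY y' hy').2.1]
    · exact congrFun hyy' ⟨j, hj⟩
  obtain ⟨B, hB, hb, hBY⟩ := hC {j // ¬ j = i} rfl K S F'.Γ F'.rank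
    ((fun (y : ι → α) (j : {j // ¬ j = i}) => F'.g j (y j.1)) '' (Y : Set (ι → α))) (H / 4)
    (by linarith) (by
      rintro _ ⟨y, hy, rfl⟩
      obtain ⟨_, hya, hU, hle, j, hj, hjH⟩ := hY y hy
      refine ⟨fun j => F'.mem _ _, fun j => ?_, (hsol y hy).2, ⟨⟨j, hj⟩, ?_⟩, fun j => ?_⟩
      · rw [hg]
        exact (hU _).div hη
      · rw [hg]
        exact hjH
      · rw [hg, S.L_div (hU _).1 hη.1]
        have := S.nrm_sub (S.L (F.g j.1 (y j.1))) (S.L (1 - F.g i a : K))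
        have := hle j.1
        linarith)
  rw [hcardY]
  refine (card_le_mul_of_cover _ B (fun z b => ∑ j, b j * (F'.g j (z j) : K) = 0)
    (C' * mono m t (Fintype.card {j // ¬ j = i}) ((Fintype.card {j // ¬ j = i} - 2) / 2)) ?_ ?_).trans ?_
  · intro z hz
    obtain ⟨y, hy, rfl⟩ := Finset.mem_image.1 hz
    exact hBY _ ⟨y, hy, rfl⟩
  · intro b hb' Z hZ hZb
    refine hC' K hK _ rfl α m t F' Z b (hb b hb') fun z hz => ⟨?_, hZb z hz⟩
    obtain ⟨y, hy, rfl⟩ := Finset.mem_image.1 (hZ hz)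
    exact ⟨hsol y hy, hnd y hy⟩
  · rw [mul_assoc]
    exact Nat.mul_le_mul_right _ hB

/-- Nondegenerate solutions of comparable large heights. -/
lemma exists_card_le_of_comparable {r : ℕ} (hr : 1 ≤ r) (h : ∀ n < r, CountOne n) (ρ : ℕ) :
    ∃ C : ℕ, ∀ (K : Type) [Field K], HasPlaces K → ∀ (S : PlaceSystem K) (ι : Type) [Fintype ι],
    Fintype.card ι = r → ∀ (α : Type) (m t : ℕ) (F : Family K ρ ι α m t) (Y : Finset (ι → α))
    (H : ℝ), 4 * S.deg * Real.log r.factorial < H →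
    (∀ y ∈ Y, (F.Sol 1 y ∧ F.Nondeg y) ∧ (∀ j, S.IsU (F.g j (y j) : K)) ∧
      (∃ i, H ≤ S.nrm (S.L (F.g i (y i)))) ∧ ∀ j, S.nrm (S.L (F.g j (y j))) ≤ 2 * H) →
    Y.card ≤ C * mono m t r ((r - 2) / 2) := by
  obtain ⟨C, hC⟩ := exists_hyperplanes_of_large r ρ 2 hr (by norm_num)
  obtain ⟨C', hC'⟩ := exists_card_le_of_form h ρ
  refine ⟨C * C', fun K _ hK S ι _ hι α m t F Y H hH hY => ?_⟩
  obtain ⟨B, hB, hb, hBY⟩ := hC ι hι K S F.Γ F.rank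
    ((fun y j => F.g j (y j)) '' (Y : Set (ι → α))) H hH (by
      rintro _ ⟨y, hy, rfl⟩
      obtain ⟨hs, hU, htop, hle⟩ := hY y hy
      exact ⟨fun j => F.mem _ _, hU, hs.1.2, htop, hle⟩)
  refine (card_le_mul_of_cover _ B (fun y b => ∑ j, b j * (F.g j (y j) : K) = 0)
    (C' * mono m t r ((r - 2) / 2)) (fun y hy => hBY _ ⟨y, hy, rfl⟩) ?_).trans ?_
  · intro b hb' Z hZ hZb
    exact hC' K hK _ hι α m t F Z b (hb b hb') fun z hz => ⟨(hY z (hZ hz)).1, hZb z hz⟩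
  · rw [mul_assoc]
    exact Nat.mul_le_mul_right _ hB

/-- Nondegenerate solutions of bounded height. -/
lemma exists_card_le_of_bounded {r : ℕ} (hr : 2 ≤ r) (h : ∀ n < r, CountOne n) (ρ : ℕ) {M : ℝ}
    (hM : 0 < M) :
    ∃ C : ℕ, ∀ (K : Type) [Field K], HasPlaces K → ∀ (S : PlaceSystem K) (ι : Type) [Fintype ι],
    Fintype.card ι = r → ∀ (α : Type) (m t : ℕ) (F : Family K ρ ι α m t) (Y : Finset (ι → α)),
    (∀ y ∈ Y, (F.Sol 1 y ∧ F.Nondeg y) ∧ (∀ j, S.IsU (F.g j (y j) : K)) ∧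
      ∀ j, S.nrm (S.L (F.g j (y j))) ≤ M * S.deg) →
    Y.card ≤ C * mono m t r ((r - 2) / 2) := by
  obtain ⟨C, hC⟩ := exists_hyperplanes_of_bounded r ρ M hr hM
  obtain ⟨C', hC'⟩ := exists_card_le_of_form h ρ
  refine ⟨C * C', fun K _ hK S ι _ hι α m t F Y hY => ?_⟩
  obtain ⟨B, hB, hb, hBY⟩ := hC ι hι K S F.Γ F.rank
    ((fun y j => F.g j (y j)) '' (Y : Set (ι → α))) (by
      rintro _ ⟨y, hy, rfl⟩
      obtain ⟨hs, hU, hle⟩ := hY y hy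
      exact ⟨fun j => F.mem _ _, hU, hs.1.2, hle⟩)
  refine (card_le_mul_of_cover _ B (fun y b => ∑ j, b j * (F.g j (y j) : K) = 0)
    (C' * mono m t r ((r - 2) / 2)) (fun y hy => hBY _ ⟨y, hy, rfl⟩) ?_).trans ?_
  · intro b hb' Z hZ hZb
    exact hC' K hK _ hι α m t F Z b (hb b hb') fun z hz => ⟨(hY z (hZ hz)).1, hZb z hz⟩
  · rw [mul_assoc]
    exact Nat.mul_le_mul_right _ hB

lemma sum_pow_le {β : Type*} (s : Finset β) (a : β → ℕ) {e : ℕ} (he : 1 ≤ e) :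
    ∑ k ∈ s, a k ^ e ≤ (∑ k ∈ s, a k) ^ e := by
  obtain ⟨e, rfl⟩ := Nat.exists_eq_add_of_le' he
  rw [pow_succ', Finset.sum_mul]
  refine Finset.sum_le_sum fun k hk => ?_
  rw [pow_succ']
  gcongr
  exact Finset.single_le_sum (fun _ _ => Nat.zero_le _) hk

lemma card_dyadic_le (s : Finset ℕ) {d h : ℝ} (hd : 0 < d)
    (hs : ∀ k ∈ s, 2 ^ k * d ≤ 2 * h ∧ h < 2 ^ (k + 1) * d) : s.card ≤ 2 := by
  rcases s.eq_empty_or_nonempty with rfl | hne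
  · simp
  obtain ⟨k₀, hk₀, hmin⟩ := s.exists_min_image id hne
  have hsub : s ⊆ {k₀, k₀ + 1} := by
    intro k hk
    have h1 := (hs k hk).1
    have h2 := (hs k₀ hk₀).2
    have h3 : (2 : ℝ) ^ k < 2 ^ (k₀ + 2) := by
      refine lt_of_mul_lt_mul_right (a := d) ?_ hd.le
      rw [pow_succ (2 : ℝ) (k₀ + 1)]
      linarith
    have h4 := (pow_lt_pow_iff_right₀ (by norm_num : (1 : ℝ) < 2)).1 h3
    have h5 : k₀ ≤ k := hmin k hk
    rw [Finset.mem_insert, Finset.mem_singleton]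
    omega
  exact (Finset.card_le_card hsub).trans Finset.card_le_two

/-- The members of `T` with some value of height about `2 ^ k`. -/
noncomputable def Family.level {K : Type} [Field K] {ρ : ℕ} {ι α : Type} {m t : ℕ}
    (F : Family K ρ ι α m t) (S : PlaceSystem K) (k : ℕ) : Finset α :=
  open scoped Classical in
  F.T.filter fun x => ∃ j, 2 ^ k * S.deg ≤ 2 * S.nrm (S.L (F.g j x)) ∧
    S.nrm (S.L (F.g j x)) < 2 ^ (k + 1) * S.deg

lemma Family.sum_card_level_le {K : Type} [Field K] {ρ : ℕ} {ι α : Type} [Fintype ι] {m t : ℕ}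
    (F : Family K ρ ι α m t) (S : PlaceSystem K) (s : Finset ℕ) :
    ∑ k ∈ s, (F.level S k).card ≤ 2 * Fintype.card ι * t := by
  classical
  have h := Finset.sum_card_bipartiteAbove_eq_sum_card_bipartiteBelow (s := s) (t := F.T)
    (fun k x => ∃ j, 2 ^ k * S.deg ≤ 2 * S.nrm (S.L (F.g j x)) ∧
      S.nrm (S.L (F.g j x)) < 2 ^ (k + 1) * S.deg)
  refine (Eq.trans ?_ h).le.trans
    ((Finset.sum_le_card_nsmul _ _ (2 * Fintype.card ι) fun x _ => ?_).trans ?_)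
  · refine Finset.sum_congr rfl fun k _ => ?_
    simp only [Family.level, Finset.bipartiteAbove]
    congr
  · have hsub : (s.filter fun k => ∃ j, 2 ^ k * S.deg ≤ 2 * S.nrm (S.L (F.g j x)) ∧
        S.nrm (S.L (F.g j x)) < 2 ^ (k + 1) * S.deg) ⊆
        Finset.univ.biUnion fun j => s.filter fun k => 2 ^ k * S.deg ≤ 2 * S.nrm (S.L (F.g j x)) ∧
        S.nrm (S.L (F.g j x)) < 2 ^ (k + 1) * S.deg := by
      intro k hk
      obtain ⟨hk, j, hj⟩ := Finset.mem_filter.1 hk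
      exact Finset.mem_biUnion.2 ⟨j, Finset.mem_univ _, Finset.mem_filter.2 ⟨hk, hj⟩⟩
    refine (Finset.card_le_card hsub).trans
      ((Finset.card_biUnion_le_card_mul _ _ 2 fun j _ => ?_).trans ?_)
    · exact card_dyadic_le _ S.deg_pos' fun k hk => (Finset.mem_filter.1 hk).2
    · rw [Finset.card_univ, mul_comm]
  · rw [smul_eq_mul, mul_comm]
    exact Nat.mul_le_mul_left _ F.card_le

end PlaceSystem

namespace PlaceSystem

lemma Family.mem_level {K : Type} [Field K] {ρ : ℕ} {ι α : Type} {m t : ℕ}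
    {F : Family K ρ ι α m t} {S : PlaceSystem K} {k : ℕ} {x : α} :
    x ∈ F.level S k ↔ x ∈ F.T ∧ ∃ j, 2 ^ k * S.deg ≤ 2 * S.nrm (S.L (F.g j x)) ∧
      S.nrm (S.L (F.g j x)) < 2 ^ (k + 1) * S.deg := by
  simp [Family.level]

lemma exists_places_of_family {K : Type} [Field K] (hK : HasPlaces K) {ρ : ℕ} {ι α : Type}
    [Fintype ι] {m t : ℕ} (F : Family K ρ ι α m t) :
    ∃ S : PlaceSystem K, ∀ i, ∀ x ∈ F.T, S.IsU (F.g i x : K) ∧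
      (1 - F.g i x ≠ (0 : K) → S.IsU (1 - F.g i x : K)) := by
  classical
  obtain ⟨S, hS⟩ := hK ((Finset.univ.biUnion fun i => F.T.image (F.g i)) ∪
    Finset.univ.biUnion fun i => F.T.image fun x =>
      if h : 1 - F.g i x ≠ (0 : K) then Units.mk0 _ h else 1)
  refine ⟨S, fun i x hx => ⟨hS _ (Finset.mem_union_left _ ?_), fun h => ?_⟩⟩
  · exact Finset.mem_biUnion.2 ⟨i, Finset.mem_univ _, Finset.mem_image_of_mem _ hx⟩
  · have := hS (Units.mk0 _ h) (Finset.mem_union_right _ (Finset.mem_biUnion.2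
      ⟨i, Finset.mem_univ _, Finset.mem_image.2 ⟨x, hx, dif_pos h⟩⟩))
    simpa using this

/-- The trichotomy for a nondegenerate solution according to its heights. -/
lemma height_trichotomy {K : Type} [Field K] (S : PlaceSystem K) {ι : Type} [Fintype ι]
    [Nonempty ι] {τ : ι → K} (hτ : ∀ i, S.IsU (τ i)) (hη : ∀ i, S.IsU (1 - τ i)) {M : ℝ}
    (hM : 8 ≤ M) :
    (∀ j, S.nrm (S.L (τ j)) ≤ M * S.deg) ∨
    (∃ i, M * S.deg < S.nrm (S.L (τ i)) ∧ (∀ j, S.nrm (S.L (τ j)) ≤ S.nrm (S.L (τ i))) ∧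
      ∃ j, j ≠ i ∧ S.nrm (S.L (τ i)) / 4 ≤ S.nrm (S.L (τ j / (1 - τ i)))) ∨
    ∃ k : ℕ, M < 2 ^ (k + 1) ∧ (∃ i, 2 ^ k * S.deg ≤ S.nrm (S.L (τ i))) ∧
      ∀ j, 2 ^ k * S.deg ≤ 2 * S.nrm (S.L (τ j)) ∧ S.nrm (S.L (τ j)) < 2 ^ (k + 1) * S.deg := by
  obtain ⟨i, hi⟩ := Finite.exists_max fun j => S.nrm (S.L (τ j))
  have hd := S.deg_pos'
  set H := S.nrm (S.L (τ i)) with hH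
  by_cases h0 : H ≤ M * S.deg
  · exact Or.inl fun j => (hi j).trans h0
  push Not at h0
  by_cases h1 : ∃ j, j ≠ i ∧ H / 4 ≤ S.nrm (S.L (τ j / (1 - τ i)))
  · exact Or.inr (Or.inl ⟨i, h0, hi, h1⟩)
  push Not at h1
  have hMd : 8 * S.deg ≤ M * S.deg := by gcongr
  obtain ⟨k, hk, hk'⟩ := exists_nat_pow_near (x := H / S.deg) (y := 2)
    (by rw [le_div_iff₀ hd]; linarith) (by norm_num)
  rw [le_div_iff₀ hd] at hk
  rw [div_lt_iff₀ hd] at hk'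
  refine Or.inr (Or.inr ⟨k, lt_of_mul_lt_mul_right (h0.trans hk') hd.le, ⟨i, hk⟩, fun j =>
    ⟨hk.trans ?_, (hi j).trans_lt hk'⟩⟩)
  by_cases hj : j = i
  · rw [hj]
    linarith
  have h2 := h1 j hj
  have h3 := S.nrm_L_one_sub_le (hη i) (hτ i) (by ring)
  have hl := Real.log_two_lt_d9
  have hdl : 2 * S.deg * Real.log 2 ≤ 2 * S.deg := by nlinarith
  rw [S.L_div (hτ j).1 (hη i).1] at h2
  have h4 := S.nrm_sub (S.L (τ j)) (S.L (τ j) - S.L (1 - τ i))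
  rw [sub_sub_cancel] at h4
  linarith

/-- The bound for nondegenerate solutions with an even number of variables. -/
lemma exists_card_nondegenerate_le {r : ℕ} (hr : 3 ≤ r) (hodd : r % 2 = 1)
    (h : ∀ n < r + 1, CountOne n) (ρ : ℕ) :
    ∃ C : ℕ, ∀ (K : Type) [Field K], HasPlaces K → ∀ (ι : Type) [Fintype ι],
    Fintype.card ι = r + 1 → ∀ (α : Type) (m t : ℕ) (F : Family K ρ ι α m t)
    (Y : Finset (ι → α)), (∀ y ∈ Y, F.Sol 1 y ∧ F.Nondeg y) →
    Y.card ≤ C * mono m t (r + 1) (r / 2) := by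
  set M : ℝ := 20 * (Real.log r.factorial + Real.log (r + 1).factorial + 1) with hM
  have hlog1 : 0 ≤ Real.log r.factorial := Real.log_natCast_nonneg _
  have hlog2 : 0 ≤ Real.log (r + 1).factorial := Real.log_natCast_nonneg _
  obtain ⟨C₀, hC₀⟩ := exists_card_le_of_bounded (r := r + 1) (by omega) h ρ (M := M)
    (by positivity)
  obtain ⟨C₁, hC₁⟩ := exists_card_le_of_top (r := r) (by omega) (fun n hn => h n (by omega)) ρ
  obtain ⟨C₂, hC₂⟩ := exists_card_le_of_comparable (r := r + 1) (by omega) h ρ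
  have he : (r + 1 - 2) / 2 = r / 2 := by omega
  refine ⟨C₀ + (r + 1) * C₁ + C₂ * (2 * (r + 1)) ^ (r / 2), fun K _ hK ι _ hι α m t F Y hY => ?_⟩
  classical
  obtain ⟨S, hS⟩ := exists_places_of_family hK F
  have hd := S.deg_pos'
  have hne : Nonempty ι := Fintype.card_pos_iff.1 (by omega)
  have hU : ∀ y ∈ Y, ∀ i, S.IsU (F.g i (y i) : K) := fun y hy i => (hS i _ ((hY y hy).1.1 i)).1
  have hη : ∀ y ∈ Y, ∀ i, S.IsU (1 - F.g i (y i) : K) := by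
    intro y hy i
    refine (hS i _ ((hY y hy).1.1 i)).2 ?_
    have h1 := (hY y hy).1.2
    rw [← Finset.add_sum_erase _ _ (Finset.mem_univ i)] at h1
    rw [← h1, add_sub_cancel_left]
    refine (hY y hy).2 _ (Finset.card_pos.1 ?_)
    rw [Finset.card_erase_of_mem (Finset.mem_univ i), Finset.card_univ]
    omega
  set Y₀ := Y.filter fun y => ∀ j, S.nrm (S.L (F.g j (y j))) ≤ M * S.deg with hY₀
  set P₁ : (ι → α) → ι → Prop := fun y i => M * S.deg < S.nrm (S.L (F.g i (y i))) ∧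
      (∀ j, S.nrm (S.L (F.g j (y j))) ≤ S.nrm (S.L (F.g i (y i)))) ∧
      ∃ j, j ≠ i ∧ S.nrm (S.L (F.g i (y i))) / 4 ≤ S.nrm (S.L (F.g j (y j) / (1 - F.g i (y i))))
    with hP₁
  set Y₁ := Y.filter fun y => ∃ i, P₁ y i with hY₁
  set P₂ : (ι → α) → ℕ → Prop := fun y k => M < 2 ^ (k + 1) ∧
      (∃ i, 2 ^ k * S.deg ≤ S.nrm (S.L (F.g i (y i)))) ∧
      ∀ j, 2 ^ k * S.deg ≤ 2 * S.nrm (S.L (F.g j (y j))) ∧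
        S.nrm (S.L (F.g j (y j))) < 2 ^ (k + 1) * S.deg with hP₂
  set Y₂ := Y.filter fun y => ∃ k, P₂ y k with hY₂
  have hcover : Y ⊆ Y₀ ∪ Y₁ ∪ Y₂ := by
    intro y hy
    simp only [Finset.mem_union, hY₀, hY₁, hY₂, Finset.mem_filter, hy, true_and, or_assoc]
    exact S.height_trichotomy (hU y hy) (hη y hy) (by linarith)
  have h₀ : Y₀.card ≤ C₀ * mono m t (r + 1) (r / 2) := by
    rw [← he]
    refine hC₀ K hK S ι hι α m t F Y₀ fun y hy => ?_
    obtain ⟨hy, hle⟩ := Finset.mem_filter.1 hy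
    exact ⟨hY y hy, hU y hy, hle⟩
  have h₁ : Y₁.card ≤ (r + 1) * C₁ * mono m t (r + 1) (r / 2) := by
    refine (card_le_mul_of_cover Y₁ ((Finset.univ : Finset ι) ×ˢ F.T)
      (fun y p => y p.1 = p.2 ∧ P₁ y p.1) (C₁ * mono m t r ((r - 2) / 2)) ?_ ?_).trans ?_
    · intro y hy
      obtain ⟨hy, i, hi⟩ := Finset.mem_filter.1 hy
      exact ⟨(i, y i), Finset.mem_product.2 ⟨Finset.mem_univ _, (hY y hy).1.1 i⟩, rfl, hi⟩
    · rintro ⟨i, a⟩ _ Z hZ hZP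
      rcases Z.eq_empty_or_nonempty with rfl | ⟨y₀, hy₀⟩
      · simp
      have hZY : ∀ y ∈ Z, y ∈ Y := fun y hy => (Finset.mem_filter.1 (hZ hy)).1
      obtain ⟨ha, hP, -⟩ := hZP y₀ hy₀
      simp only at ha hP
      subst ha
      have hdM : 20 * S.deg * (Real.log r.factorial + Real.log (r + 1).factorial + 1) =
        M * S.deg := by rw [hM]; ring
      have e1 : 0 ≤ S.deg * Real.log r.factorial := by positivity
      have e2 : 0 ≤ S.deg * Real.log (r + 1).factorial := by positivity
      refine hC₁ K hK S ι hι α m t F Z i (y₀ i) (hη y₀ (hZY _ hy₀) i) (by linarith)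
        (by linarith) fun y hy => ?_
      obtain ⟨hyi, hP1, hP2, hP3⟩ := hZP y hy
      simp only at hyi hP1 hP2 hP3
      rw [hyi] at hP2 hP3
      exact ⟨hY y (hZY y hy), hyi, hU y (hZY y hy), hP2, hP3⟩
    · rw [Finset.card_product, Finset.card_univ, hι]
      calc (r + 1) * F.T.card * (C₁ * mono m t r ((r - 2) / 2))
          ≤ (r + 1) * t * (C₁ * mono m t r ((r - 2) / 2)) := by
            gcongr
            exact F.card_le
        _ = (r + 1) * C₁ * (mono m t 1 1 * mono m t r ((r - 2) / 2)) := by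
            simp [mono]; ring
        _ = _ := by
          rw [mono_mul le_rfl (by omega), show 1 + (r - 2) / 2 = r / 2 by omega, add_comm 1 r]
  have h₂ : Y₂.card ≤ C₂ * (2 * (r + 1)) ^ (r / 2) * mono m t (r + 1) (r / 2) := by
    have hex : ∀ y ∈ Y₂, ∃ k, P₂ y k := fun y hy => (Finset.mem_filter.1 hy).2
    choose! κ hκ using hex
    rw [Finset.card_eq_sum_card_image κ Y₂]
    have hk : ∀ k ∈ Y₂.image κ, (Y₂.filter fun y => κ y = k).card ≤
        C₂ * m ^ (r + 1 - r / 2) * (F.level S k).card ^ (r / 2) := by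
      intro k _
      rcases (Y₂.filter fun y => κ y = k).eq_empty_or_nonempty with h0 | ⟨y₀, hy₀⟩
      · rw [h0]; simp
      have hMk : M < 2 ^ (k + 1) := by
        obtain ⟨h1, rfl⟩ := Finset.mem_filter.1 hy₀
        exact (hκ y₀ h1).1
      have hsub : F.level S k ⊆ F.T := fun x hx => (Family.mem_level.1 hx).1
      have := hC₂ K hK S ι hι α _ _ (F.shrink (F.level S k) hsub) (Y₂.filter fun y => κ y = k)
        (2 ^ k * S.deg) (by
          have : 4 * Real.log (r + 1).factorial < 2 ^ k := by
            rw [pow_succ] at hMk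
            linarith
          nlinarith) (by
        intro y hy
        obtain ⟨hy2, rfl⟩ := Finset.mem_filter.1 hy
        obtain ⟨-, hi, hj⟩ := hκ y hy2
        have hyY := (Finset.mem_filter.1 hy2).1
        refine ⟨⟨⟨fun i => ?_, (hY y hyY).1.2⟩, (hY y hyY).2⟩, hU y hyY, hi, fun j => ?_⟩
        · exact Family.mem_level.2 ⟨(hY y hyY).1.1 i, i, hj i⟩
        · have := (hj j).2
          rw [pow_succ] at this
          change S.nrm (S.L (F.g j (y j))) ≤ _
          linarith)
      rw [he] at this
      refine this.trans ?_
      unfold mono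
      rw [← mul_assoc]
      gcongr
      exact min_le_left _ _
    refine (Finset.sum_le_sum hk).trans ?_
    rw [← Finset.mul_sum]
    calc _ ≤ C₂ * m ^ (r + 1 - r / 2) * (∑ k ∈ Y₂.image κ, (F.level S k).card) ^ (r / 2) :=
          Nat.mul_le_mul_left _ (sum_pow_le _ _ (by omega))
      _ ≤ C₂ * m ^ (r + 1 - r / 2) * (2 * (r + 1) * t) ^ (r / 2) := by
          gcongr
          rw [← hι]
          exact F.sum_card_level_le S _
      _ = _ := by
          rw [mul_pow (2 * (r + 1))]
          unfold mono
          ring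
  calc Y.card ≤ (Y₀ ∪ Y₁ ∪ Y₂).card := Finset.card_le_card hcover
    _ ≤ Y₀.card + Y₁.card + Y₂.card :=
        (Finset.card_union_le _ _).trans (Nat.add_le_add_right (Finset.card_union_le _ _) _)
    _ ≤ _ := by
        refine (Nat.add_le_add (Nat.add_le_add h₀ h₁) h₂).trans_eq ?_
        ring

theorem countOne (r : ℕ) : CountOne r := by
  induction r using Nat.strong_induction_on with
  | _ r ih =>
  rcases Nat.lt_or_ge r 3 with hr | hr
  · interval_cases r
    exacts [countOne_zero, countOne_one, countOne_two]
  obtain ⟨r, rfl⟩ := Nat.exists_eq_add_of_le' (by omega : 1 ≤ r)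
  intro ρ
  have hnd : ∃ C : ℕ, ∀ (K : Type) [Field K], HasPlaces K → ∀ (ι : Type) [Fintype ι],
      Fintype.card ι = r + 1 → ∀ (α : Type) (m t : ℕ) (F : Family K ρ ι α m t)
      (Y : Finset (ι → α)), (∀ y ∈ Y, F.Sol 1 y ∧ F.Nondeg y) →
      Y.card ≤ C * mono m t (r + 1) (r / 2) := by
    rcases Nat.mod_two_eq_zero_or_one r with hpar | hpar
    · obtain ⟨C, hC⟩ := (ih r (by omega)).fix ρ
      refine ⟨C, fun K _ hK ι _ hι α m t F Y hY => ?_⟩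
      classical
      obtain ⟨i⟩ : Nonempty ι := Fintype.card_pos_iff.1 (by omega)
      rw [show r / 2 = (r - 1) / 2 + 1 by omega]
      refine hC K hK ι hι α m t F Y i 1 fun y hy => ⟨(hY y hy).1, ?_⟩
      have h1 := (hY y hy).1.2
      rw [← Finset.add_sum_erase _ _ (Finset.mem_univ i)] at h1
      rw [← h1, add_sub_cancel_left]
      refine (hY y hy).2 _ (Finset.card_pos.1 ?_)
      rw [Finset.card_erase_of_mem (Finset.mem_univ i), Finset.card_univ]
      omega
    · exact exists_card_nondegenerate_le (by omega) hpar ih ρ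
  obtain ⟨C, hC⟩ := hnd
  obtain ⟨C', hC'⟩ := exists_card_degenerate_le ih ρ
  refine ⟨C + C', fun K _ hK ι _ hι α m t F Y hY => ?_⟩
  classical
  rw [← Finset.card_filter_add_card_filter_not (fun y => F.Nondeg y), add_mul]
  refine add_le_add (hC K hK ι hι α m t F _ fun y hy => ?_)
    (hC' K hK ι hι α m t F _ fun y hy => ?_)
  · exact ⟨hY y (Finset.mem_filter.1 hy).1, (Finset.mem_filter.1 hy).2⟩
  · exact ⟨hY y (Finset.mem_filter.1 hy).1, (Finset.mem_filter.1 hy).2⟩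

end PlaceSystem

namespace PlaceSystem

/-- A nontrivial finitely generated algebra over the rationals maps to a number field. -/
lemma exists_hom_numberField (B : Type) [CommRing B] [Nontrivial B] [Algebra ℚ B]
    [Algebra.FiniteType ℚ B] :
    ∃ (K : Type) (_ : Field K) (_ : NumberField K), Nonempty (B →+* K) := by
  obtain ⟨M, hM⟩ := Ideal.exists_maximal B
  let := Ideal.Quotient.field M
  have hfin : Module.Finite ℚ (B ⧸ M) := finite_of_finite_type_of_isJacobsonRing ℚ (B ⧸ M)
  have hc : CharZero (B ⧸ M) := algebraRat.charZero _
  have hnum : NumberField (B ⧸ M) := by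
    refine @NumberField.mk _ _ hc ?_
    convert hfin
    exact Subsingleton.elim _ _
  exact ⟨B ⧸ M, inferInstance, hnum, ⟨Ideal.Quotient.mk M⟩⟩

/-- Finitely many elements of a field of characteristic zero, together with their inverses, lie in
a subring that maps to a number field. -/
lemma exists_specialization (E : Type) [Field E] [CharZero E] (X : Finset E) :
    ∃ (R : Subring E) (K : Type) (_ : Field K) (_ : NumberField K) (_ : R →+* K),
      ∀ x ∈ X, x ∈ R ∧ x⁻¹ ∈ R := by
  classical
  let B : Subalgebra ℚ E := Algebra.adjoin ℚ ((X ∪ X.image fun x => x⁻¹ : Finset E) : Set E)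
  have hfin : Algebra.FiniteType ℚ B :=
    (Subalgebra.fg_iff_finiteType _).1 (Subalgebra.fg_adjoin_finset _)
  obtain ⟨K, hK, hnum, ⟨φ⟩⟩ := exists_hom_numberField B
  refine ⟨B.toSubring, K, hK, hnum, φ, fun x hx => ⟨?_, ?_⟩⟩
  · exact Algebra.subset_adjoin (by simp [hx])
  · exact Algebra.subset_adjoin (by simp [hx])

lemma RankLE.map_comap {G H L : Type*} [CommGroup G] [CommGroup H] [CommGroup L] {Γ : Subgroup G}
    {s : Finset G} (f : H →* G) (hf : Function.Injective f) (hs : ∀ x ∈ s, ∃ v, f v = x)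
    (h : ∀ x ∈ Γ, ∃ k : ℕ, 0 < k ∧ x ^ k ∈ Subgroup.closure (s : Set G)) (φ : H →* L) :
    RankLE ((Γ.comap f).map φ) s.card := by
  classical
  choose! l hl using hs
  refine ⟨(s.image l).image φ, Finset.card_image_le.trans Finset.card_image_le, ?_⟩
  rintro _ ⟨v, hv, rfl⟩
  obtain ⟨k, hk, hvk⟩ := h _ hv
  refine ⟨k, hk, ?_⟩
  have hcl : (s : Set G) = f '' ((s.image l : Finset H) : Set H) := by
    rw [Finset.coe_image, Set.image_image]
    ext x
    constructor
    · exact fun hx => ⟨x, hx, hl x hx⟩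
    · rintro ⟨y, hy, rfl⟩
      simpa only [hl y hy] using hy
  rw [hcl, ← MonoidHom.map_closure, ← map_pow] at hvk
  obtain ⟨w, hw, hwv⟩ := hvk
  rw [hf hwv] at hw
  rw [Finset.coe_image, ← MonoidHom.map_closure, ← map_pow]
  exact Subgroup.mem_map_of_mem φ hw

/-- A family over a field of characteristic zero specializes to a number field. -/
lemma Family.exists_specialization {E : Type} [Field E] [CharZero E] {ρ : ℕ} {ι α : Type}
    [Fintype ι] {m t : ℕ} (F : Family E ρ ι α m t) :
    ∃ (K : Type) (_ : Field K) (F' : Family K ρ ι α m t), HasPlaces K ∧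
      (∀ y, F.Sol 1 y → F'.Sol 1 y) ∧ ∀ y, F.Sol 0 y → F'.Sol 0 y := by
  classical
  obtain ⟨s, hs, hΓ⟩ := F.rank
  obtain ⟨R, K, hK, hnum, φ, hR⟩ := PlaceSystem.exists_specialization E
    (s.image (fun u : Eˣ => (u : E)) ∪
      ((Finset.univ ×ˢ F.T).image fun p : ι × α => (F.g p.1 p.2 : E)) ∪
      ((Finset.univ ×ˢ F.T ×ˢ F.T).image fun p : ι × α × α =>
        (F.g p.1 p.2.1 : E) - F.g p.1 p.2.2))
  let f : Rˣ →* Eˣ := Units.map (R.subtype : R →* E)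
  have hf : Function.Injective f := Units.map_injective R.subtype_injective
  have hlift : ∀ u : Eˣ, (u : E) ∈ R → (u : E)⁻¹ ∈ R → ∃ v : Rˣ, f v = u := by
    intro u h1 h2
    refine ⟨⟨⟨u, h1⟩, ⟨_, h2⟩, Subtype.ext (by simp), Subtype.ext (by simp)⟩, Units.ext rfl⟩
  have hsl : ∀ x ∈ s, ∃ v, f v = x := fun x hx =>
    have h := hR x (by
      simp only [Finset.mem_union, Finset.mem_image]
      exact Or.inl (Or.inl ⟨x, hx, rfl⟩))
    hlift x h.1 h.2
  have hgl : ∀ i, ∀ x, ∃ v : Rˣ, f v ∈ F.Γ ∧ (x ∈ F.T → f v = F.g i x) := by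
    intro i x
    by_cases hx : x ∈ F.T
    · have h := hR (F.g i x) (by
        simp only [Finset.mem_union, Finset.mem_image]
        exact Or.inl (Or.inr ⟨(i, x), by simp [hx], rfl⟩))
      obtain ⟨v, hv⟩ := hlift _ h.1 h.2
      exact ⟨v, hv ▸ F.mem i x, fun _ => hv⟩
    · exact ⟨1, by rw [map_one]; exact one_mem _, fun h => absurd h hx⟩
  choose v hv hvg using hgl
  have hval : ∀ i, ∀ x ∈ F.T, ((v i x : R) : E) = F.g i x := fun i x hx =>
    congrArg Units.val (hvg i x hx)
  have hinj : ∀ i, ∀ x ∈ F.T, ∀ x' ∈ F.T, φ (v i x) = φ (v i x') → F.g i x = F.g i x' := by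
    intro i x hx x' hx' h
    by_contra hne
    have hd : (F.g i x : E) - F.g i x' ≠ 0 := sub_ne_zero.2 fun h => hne (Units.ext h)
    have h2 := (hR _ (by
      simp only [Finset.mem_union, Finset.mem_image]
      exact Or.inr ⟨(i, x, x'), by simp [hx, hx'], rfl⟩)).2
    have h3 : ((v i x : R) - v i x') * ⟨_, h2⟩ = 1 := by
      refine Subtype.ext ?_
      simp only [Subring.coe_mul, AddSubgroupClass.coe_sub, Subring.coe_one]
      rw [hval i x hx, hval i x' hx']
      exact mul_inv_cancel₀ hd
    have h4 := congrArg φ h3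
    rw [map_mul, map_sub, h, sub_self, zero_mul, map_one] at h4
    exact zero_ne_one h4
  have hsum : ∀ w : R, ∀ y, F.Sol w y →
      (∀ i, y i ∈ F.T) ∧ ∑ i, φ (v i (y i)) = φ w := by
    intro w y hy
    refine ⟨hy.1, ?_⟩
    rw [← map_sum]
    congr 1
    refine Subtype.ext ?_
    rw [← hy.2]
    push_cast
    exact Finset.sum_congr rfl fun i _ => hval i _ (hy.1 i)
  refine ⟨K, hK, {
    Γ := (F.Γ.comap f).map (Units.map (φ : R →* K))
    rank := (RankLE.map_comap f hf hsl hΓ _).mono hs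
    T := F.T
    g := fun i x => Units.map (φ : R →* K) (v i x)
    mem := fun i x => Subgroup.mem_map_of_mem _ (hv i x)
    le := F.le
    card_le := F.card_le
    fibre := fun i u Z hZ h => ?_ }, hasPlaces_of_numberField K, fun y hy => ?_, fun y hy => ?_⟩
  · rcases Z.eq_empty_or_nonempty with rfl | ⟨x₀, hx₀⟩
    · simp
    · refine F.fibre i (F.g i x₀) Z hZ fun x hx => hinj i x (hZ hx) x₀ (hZ hx₀) ?_
      exact congrArg Units.val ((h x hx).trans (h x₀ hx₀).symm)
  · have := hsum 1 y (by simpa using hy)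
    rw [map_one] at this
    exact this
  · have := hsum 0 y (by simpa using hy)
    rw [map_zero] at this
    exact this

/-- Counting solutions of an inhomogeneous linear equation in characteristic zero. -/
theorem exists_card_sum_eq_le (r ρ : ℕ) :
    ∃ C : ℕ, ∀ (E : Type) [Field E] [CharZero E] (ι : Type) [Fintype ι], Fintype.card ι = r →
    ∀ (α : Type) (m t : ℕ) (F : Family E ρ ι α m t) (Y : Finset (ι → α))
    (c : ι → E) (w : E), (∀ i, c i ≠ 0) → w ≠ 0 →
    (∀ y ∈ Y, (∀ i, y i ∈ F.T) ∧ ∑ i, c i * (F.g i (y i) : E) = w) →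
    Y.card ≤ C * mono m t r ((r - 1) / 2) := by
  obtain ⟨C, hC⟩ := countOne r (ρ + r)
  refine ⟨C, fun E _ _ ι _ hι α m t F Y c w hc hw hY => ?_⟩
  subst hι
  classical
  obtain ⟨K, _, F', hK, h1, -⟩ :=
    (F.twist fun i => Units.mk0 (c i / w) (div_ne_zero (hc i) hw)).exists_specialization
  refine hC K hK ι rfl α m t F' Y fun y hy => h1 y ⟨(hY y hy).1, ?_⟩
  have h2 := (hY y hy).2
  refine Eq.trans ?_ (div_self hw)
  conv_rhs => arg 1; rw [← h2]
  rw [Finset.sum_div]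
  refine Finset.sum_congr rfl fun i _ => ?_
  simp only [Family.twist, Units.val_mul, Units.val_mk0]
  ring

/-- Counting solutions of a homogeneous linear equation in characteristic zero. -/
theorem exists_card_sum_eq_zero_le (r ρ : ℕ) :
    ∃ C : ℕ, ∀ (E : Type) [Field E] [CharZero E] (ι : Type) [Fintype ι], Fintype.card ι = r →
    ∀ (α : Type) (m t : ℕ) (F : Family E ρ ι α m t) (Y : Finset (ι → α)),
    (∀ y ∈ Y, (∀ i, y i ∈ F.T) ∧ ∑ i, (F.g i (y i) : E) = 0) →
    Y.card ≤ C * mono m t r (r / 2) := by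
  obtain ⟨C, hC⟩ := (countOne (r - 1)).zero ρ
  refine ⟨C, fun E _ _ ι _ hι α m t F Y hY => ?_⟩
  obtain ⟨K, _, F', hK, -, h0⟩ := F.exists_specialization
  exact hC K hK ι hι α m t F' Y fun y hy => h0 y (hY y hy)

end PlaceSystem

namespace PlaceSystem

/-- Pairs of indices above the diagonal. -/
abbrev UpperPair (n : ℕ) : Type := {p : Fin n × Fin n // p.1 < p.2}

lemma sum_sum_eq_diag_add_upper {M : Type*} [AddCommMonoid M] {n : ℕ} (f : Fin n → Fin n → M) :
    ∑ i, ∑ j, f i j =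
      ∑ i, f i i + ∑ p : UpperPair n, (f p.1.1 p.1.2 + f p.1.2 p.1.1) := by
  classical
  rw [← Finset.sum_subtype (Finset.univ.filter fun p : Fin n × Fin n => p.1 < p.2) (by simp)
    fun p : Fin n × Fin n => f p.1 p.2 + f p.2 p.1, Finset.sum_filter, Fintype.sum_prod_type]
  have h : ∀ i j : Fin n, f i j =
      (if i = j then f i j else 0) + ((if i < j then f i j else 0) +
        if j < i then f i j else 0) := by
    intro i j
    rcases lt_trichotomy i j with h | h | h
    · simp [h, h.ne, h.not_gt]
    · simp [h]
    · simp [h, h.ne', h.not_gt]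
  simp_rw [ite_add_zero, Finset.sum_add_distrib]
  rw [Finset.sum_comm (f := fun i j => if i < j then f j i else 0), ← Finset.sum_add_distrib,
    ← Finset.sum_add_distrib]
  refine Finset.sum_congr rfl fun i _ => ?_
  rw [Finset.sum_congr rfl fun j _ => h i j, Finset.sum_add_distrib, Finset.sum_add_distrib]
  simp

lemma card_upperPair (n : ℕ) : Fintype.card (UpperPair n) = n * (n - 1) / 2 := by
  have h := sum_sum_eq_diag_add_upper (n := n) fun _ _ => 1
  simp only [Finset.sum_const, Finset.card_univ, Fintype.card_fin, smul_eq_mul, mul_one] at h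
  have h2 : n * (n - 1) + n = n * n := by
    cases n
    · rfl
    · simp only [Nat.add_sub_cancel]; ring
  omega

lemma charpoly_coeff_sub_two {R : Type*} [CommRing R] {n : ℕ} (hn : 2 ≤ n)
    (X : Matrix (Fin n) (Fin n) R) :
    X.charpoly.coeff (n - 2) = ∑ p : UpperPair n,
      (X p.1.1 p.1.1 * X p.1.2 p.1.2 - X p.1.1 p.1.2 * X p.1.2 p.1.1) := by
  classical
  have h := X.charpoly_coeff_eq_sum_minors 2 (by simpa using hn)
  rw [Fintype.card_fin, neg_one_sq, one_mul] at h
  rw [h]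
  symm
  refine Finset.sum_bij (fun p _ => {p.1.1, p.1.2}) ?_ ?_ ?_ ?_
  · rintro ⟨⟨i, j⟩, hij⟩ -
    exact Finset.mem_powersetCard_univ.2 (Finset.card_pair (ne_of_lt hij))
  · rintro ⟨⟨i, j⟩, hij⟩ - ⟨⟨i', j'⟩, hij'⟩ - h
    have h2 : ({i, j} : Set (Fin n)) = {i', j'} := by
      rw [← Finset.coe_pair, ← Finset.coe_pair]
      exact congrArg _ h
    rcases Set.pair_eq_pair_iff.1 h2 with ⟨rfl, rfl⟩ | ⟨rfl, rfl⟩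
    · rfl
    · exact absurd hij (not_lt_of_gt hij')
  · intro s hs
    obtain ⟨i, j, hij, rfl⟩ := Finset.card_eq_two.1 (Finset.mem_powersetCard_univ.1 hs)
    rcases lt_or_gt_of_ne hij with h | h
    · exact ⟨⟨(i, j), h⟩, Finset.mem_univ _, rfl⟩
    · exact ⟨⟨(j, i), h⟩, Finset.mem_univ _, Finset.pair_comm _ _⟩
  · rintro ⟨⟨i, j⟩, hij⟩ -
    have hne : i ≠ j := ne_of_lt hij
    let e : Fin 2 → ({i, j} : Finset (Fin n)) := ![⟨i, by simp⟩, ⟨j, by simp⟩]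
    have he : Function.Bijective e := by
      constructor
      · intro a b hab
        fin_cases a <;> fin_cases b <;> simp_all [e]
      · rintro ⟨x, hx⟩
        rcases Finset.mem_insert.1 hx with rfl | hx'
        · exact ⟨0, rfl⟩
        · exact ⟨1, Subtype.ext (Finset.mem_singleton.1 hx').symm⟩
    rw [← Matrix.det_submatrix_equiv_self (Equiv.ofBijective e he), Matrix.det_fin_two]
    rfl

/-- If the trace of `X ^ 2` vanishes, the products of opposite entries sum to a negative multiple
of the sum of the squares of the diagonal entries. -/
lemma sum_upper_eq_of_coeff {n : ℕ} (hn : 2 ≤ n) (X : Matrix (Fin n) (Fin n) ℝ)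
    (h : X.charpoly.coeff (n - 1) ^ 2 = 2 * X.charpoly.coeff (n - 2)) :
    ∑ p : UpperPair n, 2 * (X p.1.1 p.1.2 * X p.1.2 p.1.1) = -∑ i, X i i ^ 2 := by
  have : Nonempty (Fin n) := ⟨⟨0, by omega⟩⟩
  have ht := X.trace_eq_neg_charpoly_coeff
  rw [Fintype.card_fin] at ht
  have h1 : X.charpoly.coeff (n - 1) = -∑ i, X i i := by
    rw [← neg_eq_iff_eq_neg, ← ht]
    rfl
  have h2 := sum_sum_eq_diag_add_upper fun i j => X i i * X j j
  rw [h1, neg_sq, sq, Finset.sum_mul_sum, h2, charpoly_coeff_sub_two hn, Finset.mul_sum] at h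
  simp only [sq]
  rw [eq_neg_iff_add_eq_zero, add_comm, ← sub_eq_zero.2 h, add_sub_assoc, add_right_inj,
    ← Finset.sum_sub_distrib]
  exact Finset.sum_congr rfl fun p _ => by ring

/-- The elements of a finite subset of a group of units. -/
lemma exists_family_single {Γ : Subgroup ℝˣ} {ρ : ℕ} (hΓ : RankLE Γ ρ) (A : Finset ℝ)
    (hA : ∀ a ∈ A, ∃ u : ℝˣ, u ∈ Γ ∧ (u : ℝ) = a) (hne : A.Nonempty) (ι : Type) :
    ∃ F : Family ℝ ρ ι ℝ 1 A.card, F.T = A ∧ ∀ i, ∀ a ∈ A, (F.g i a : ℝ) = a := by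
  have hu : ∀ a : ℝ, ∃ u : ℝˣ, u ∈ Γ ∧ (a ∈ A → (u : ℝ) = a) := by
    intro a
    by_cases ha : a ∈ A
    · obtain ⟨u, hu, h⟩ := hA a ha
      exact ⟨u, hu, fun _ => h⟩
    · exact ⟨1, one_mem _, fun h => absurd h ha⟩
  choose u hu hua using hu
  refine ⟨{
    Γ := Γ
    rank := hΓ
    T := A
    g := fun _ => u
    mem := fun _ => hu
    le := hne.card_pos
    card_le := le_rfl
    fibre := fun i v Z hZ h => Finset.card_le_one.2 fun a ha b hb => ?_ }, rfl, fun _ => hua⟩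
  rw [← hua a (hZ ha), ← hua b (hZ hb), h a ha, h b hb]

/-- The products of pairs of elements of a finite subset of a group of units. -/
lemma exists_family_mul {Γ : Subgroup ℝˣ} {ρ : ℕ} (hΓ : RankLE Γ ρ) (A : Finset ℝ)
    (hA : ∀ a ∈ A, ∃ u : ℝˣ, u ∈ Γ ∧ (u : ℝ) = a) (hne : A.Nonempty) (ι : Type) :
    ∃ F : Family ℝ ρ ι (ℝ × ℝ) A.card (A.card ^ 2), F.T = A ×ˢ A ∧
      ∀ i, ∀ a ∈ A, ∀ b ∈ A, (F.g i (a, b) : ℝ) = a * b := by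
  obtain ⟨F, hT, hF⟩ := exists_family_single hΓ A hA hne Unit
  refine ⟨{
    Γ := F.Γ
    rank := F.rank
    T := A ×ˢ A
    g := fun _ x => F.g () x.1 * F.g () x.2
    mem := fun _ x => mul_mem (F.mem _ _) (F.mem _ _)
    le := Nat.le_self_pow two_ne_zero _
    card_le := by rw [Finset.card_product, sq]
    fibre := fun i v Z hZ h => ?_ }, rfl, fun i a ha b hb => ?_⟩
  · refine Finset.card_le_card_of_injOn Prod.fst
      (fun x hx => (Finset.mem_product.1 (hZ hx)).1) fun x hx y hy hxy => ?_
    have h1 := (h x hx).trans (h y hy).symm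
    rw [hxy, mul_right_inj] at h1
    refine Prod.ext hxy ?_
    rw [← hF () _ (Finset.mem_product.1 (hZ hx)).2, h1, hF () _ (Finset.mem_product.1 (hZ hy)).2]
  · rw [Units.val_mul, hF () a ha, hF () b hb]

/-- Counting the matrices whose square has trace zero. -/
lemma exists_card_matrix_le (n ρ : ℕ) (hn : 2 ≤ n) :
    ∃ C : ℕ, ∀ Γ : Subgroup ℝˣ, RankLE Γ ρ → ∀ f : Polynomial ℝ, ∀ A : Finset ℝ,
      (∀ a ∈ A, ∃ u : ℝˣ, u ∈ Γ ∧ (u : ℝ) = a) → A.Nonempty →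
      f.coeff (n - 1) ^ 2 = 2 * f.coeff (n - 2) →
      (f.coeff (n - 1) ≠ 0 ∨ (n - 1) / 2 = n / 2) →
      ∀ Y : Finset (Matrix (Fin n) (Fin n) ℝ),
      (∀ X ∈ Y, (∀ i j, X i j ∈ A) ∧ X.charpoly = f) →
      Y.card ≤ C * A.card ^
        ((n - 1) / 2 + (n * (n - 1) / 2 + (n * (n - 1) / 2 - 1) / 2)) := by
  obtain ⟨C₁, h₁⟩ := exists_card_sum_eq_le n ρ
  obtain ⟨C₀, h₀⟩ := exists_card_sum_eq_zero_le n ρ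
  obtain ⟨C₂, h₂⟩ := exists_card_sum_eq_le (n * (n - 1) / 2) ρ
  refine ⟨C₂ * (C₁ + C₀), fun Γ hΓ f A hA hne hf hcase Y hY => ?_⟩
  classical
  have : Nonempty (Fin n) := ⟨⟨0, by omega⟩⟩
  have hA0 : ∀ a ∈ A, a ≠ 0 := by
    intro a ha
    obtain ⟨u, -, rfl⟩ := hA a ha
    exact u.ne_zero
  obtain ⟨F, hT, hF⟩ := exists_family_single hΓ A hA hne (Fin n)
  obtain ⟨G, hU, hG⟩ := exists_family_mul hΓ A hA hne (UpperPair n)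
  have htr : ∀ d ∈ Y.image Matrix.diag, (∀ i, d i ∈ A) ∧ ∑ i, d i = -f.coeff (n - 1) := by
    intro d hd
    obtain ⟨X, hX, rfl⟩ := Finset.mem_image.1 hd
    refine ⟨fun i => (hY X hX).1 i i, ?_⟩
    have := X.trace_eq_neg_charpoly_coeff
    rwa [Fintype.card_fin, (hY X hX).2] at this
  have hdiag : (Y.image Matrix.diag).card ≤ (C₁ + C₀) * A.card ^ ((n - 1) / 2) := by
    rw [add_mul]
    by_cases h0 : f.coeff (n - 1) = 0
    · refine le_add_left ((h₀ ℝ (Fin n) (Fintype.card_fin n) ℝ 1 _ F _ fun d hd => ?_).trans_eq ?_)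
      · refine ⟨fun i => by rw [hT]; exact (htr d hd).1 i, ?_⟩
        rw [Finset.sum_congr rfl fun i _ => hF i _ ((htr d hd).1 i), (htr d hd).2, h0, neg_zero]
      · rw [mono, one_pow, one_mul, hcase.resolve_left (not_not.2 h0)]
    · refine le_add_right ((h₁ ℝ (Fin n) (Fintype.card_fin n) ℝ 1 _ F _ (fun _ => 1) _
        (fun _ => one_ne_zero) (neg_ne_zero.2 h0) fun d hd => ?_).trans_eq ?_)
      · refine ⟨fun i => by rw [hT]; exact (htr d hd).1 i, ?_⟩
        simp only [one_mul]
        rw [Finset.sum_congr rfl fun i _ => hF i _ ((htr d hd).1 i), (htr d hd).2]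
      · rw [mono, one_pow, one_mul]
  have hoff : ∀ d ∈ Y.image Matrix.diag, (Y.filter fun X => X.diag = d).card ≤
      C₂ * A.card ^ (n * (n - 1) / 2 + (n * (n - 1) / 2 - 1) / 2) := by
    intro d hd
    let off : Matrix (Fin n) (Fin n) ℝ → UpperPair n → ℝ × ℝ :=
      fun X p => (X p.1.1 p.1.2, X p.1.2 p.1.1)
    have hinj : Set.InjOn off (Y.filter fun X => X.diag = d : Finset _) := by
      intro X hX X' hX' h
      have hXd := (Finset.mem_filter.1 hX).2.trans (Finset.mem_filter.1 hX').2.symm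
      ext i j
      rcases lt_trichotomy i j with hij | rfl | hij
      · exact congrArg Prod.fst (congrFun h ⟨(i, j), hij⟩)
      · exact congrFun hXd i
      · exact congrArg Prod.snd (congrFun h ⟨(j, i), hij⟩)
    rw [← Finset.card_image_of_injOn hinj]
    have hd0 : -∑ i, d i ^ 2 ≠ 0 := by
      refine neg_ne_zero.2 (ne_of_gt (Finset.sum_pos (fun i _ => ?_) Finset.univ_nonempty))
      have := hA0 _ ((htr d hd).1 i)
      positivity
    refine (h₂ ℝ (UpperPair n) (card_upperPair n) (ℝ × ℝ) _ _ G _ (fun _ => 2) _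
      (fun _ => two_ne_zero) hd0 fun y hy => ?_).trans_eq ?_
    · obtain ⟨X, hX, rfl⟩ := Finset.mem_image.1 hy
      obtain ⟨hXY, rfl⟩ := Finset.mem_filter.1 hX
      have hXA := (hY X hXY).1
      refine ⟨fun p => by rw [hU]; exact Finset.mem_product.2 ⟨hXA _ _, hXA _ _⟩, ?_⟩
      rw [Finset.sum_congr rfl fun p _ => by rw [hG p _ (hXA _ _) _ (hXA _ _)]]
      exact sum_upper_eq_of_coeff hn X (by rw [(hY X hXY).2, hf])
    · rw [mono, ← pow_mul, ← pow_add]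
      congr 2
      omega
  refine (Finset.card_le_mul_card_image Y _ hoff).trans ?_
  calc _ ≤ C₂ * A.card ^ (n * (n - 1) / 2 + (n * (n - 1) / 2 - 1) / 2) *
        ((C₁ + C₀) * A.card ^ ((n - 1) / 2)) := Nat.mul_le_mul_left _ hdiag
    _ = _ := by
      rw [pow_add]
      ring

lemma exponent_eq {n : ℕ} (hn : 3 ≤ n) :
    (n % 4 = 0 → (((n - 1) / 2 + (n * (n - 1) / 2 + (n * (n - 1) / 2 - 1) / 2) : ℕ) : ℝ) =
      betaExp n - 2) ∧
    (n % 4 = 1 → (((n - 1) / 2 + (n * (n - 1) / 2 + (n * (n - 1) / 2 - 1) / 2) : ℕ) : ℝ) =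
      betaExp n - 3 / 2) := by
  constructor
  · intro h
    obtain ⟨k, rfl⟩ : ∃ k, n = 4 * (k + 1) := ⟨n / 4 - 1, by omega⟩
    have h1 : 4 * (k + 1) * (4 * (k + 1) - 1) / 2 = 2 * ((k + 1) * (4 * k + 3)) := by
      rw [show 4 * (k + 1) - 1 = 4 * k + 3 by omega,
        show 4 * (k + 1) * (4 * k + 3) = 2 * (2 * ((k + 1) * (4 * k + 3))) by ring]
      omega
    have h2 : (2 * ((k + 1) * (4 * k + 3)) - 1) / 2 = 4 * k ^ 2 + 7 * k + 2 := by
      rw [show (k + 1) * (4 * k + 3) = 4 * k ^ 2 + 7 * k + 3 by ring]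
      omega
    rw [h1, h2, show (4 * (k + 1) - 1) / 2 = 2 * k + 1 by omega, betaExp]
    push_cast
    ring
  · intro h
    obtain ⟨k, rfl⟩ : ∃ k, n = 4 * (k + 1) + 1 := ⟨n / 4 - 1, by omega⟩
    have h1 : (4 * (k + 1) + 1) * (4 * (k + 1) + 1 - 1) / 2 = 2 * ((k + 1) * (4 * k + 5)) := by
      rw [show 4 * (k + 1) + 1 - 1 = 4 * (k + 1) by omega,
        show (4 * (k + 1) + 1) * (4 * (k + 1)) = 2 * (2 * ((k + 1) * (4 * k + 5))) by ring]
      omega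
    have h2 : (2 * ((k + 1) * (4 * k + 5)) - 1) / 2 = 4 * k ^ 2 + 9 * k + 4 := by
      rw [show (k + 1) * (4 * k + 5) = 4 * k ^ 2 + 9 * k + 5 by ring]
      omega
    rw [h1, h2, show (4 * (k + 1) + 1 - 1) / 2 = 2 * (k + 1) by omega, betaExp]
    push_cast
    ring

lemma exists_ncard_matrix_le (n ρ : ℕ) (hn : 2 ≤ n) :
    ∃ C : ℝ, 0 < C ∧ ∀ Γ : Subgroup ℝˣ, FinRank Γ ρ → ∀ f : Polynomial ℝ, ∀ A : Finset ℝ,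
      (∀ a ∈ A, ∃ u : ℝˣ, u ∈ Γ ∧ (u : ℝ) = a) →
      f.coeff (n - 1) ^ 2 = 2 * f.coeff (n - 2) →
      (f.coeff (n - 1) ≠ 0 ∨ (n - 1) / 2 = n / 2) →
      ({X : Matrix (Fin n) (Fin n) ℝ | (∀ i j, X i j ∈ A) ∧ X.charpoly = f}.ncard : ℝ) ≤
      C * (A.card : ℝ) ^
        (((n - 1) / 2 + (n * (n - 1) / 2 + (n * (n - 1) / 2 - 1) / 2) : ℕ) : ℝ) := by
  obtain ⟨C, hC⟩ := exists_card_matrix_le n ρ hn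
  refine ⟨C + 1, by positivity, fun Γ ⟨S, hS, _, hΓ⟩ f A hA hf hcase => ?_⟩
  rw [Real.rpow_natCast]
  set Z := {X : Matrix (Fin n) (Fin n) ℝ | (∀ i j, X i j ∈ A) ∧ X.charpoly = f} with hZ
  have hfin : Z.Finite := by
    refine Set.Finite.subset (Set.Finite.pi' fun _ => Set.Finite.pi' fun _ => A.finite_toSet) ?_
    exact fun X hX => hX.1
  rcases A.eq_empty_or_nonempty with rfl | hne
  · have : Z = ∅ := by
      refine Set.eq_empty_of_forall_notMem fun X hX => ?_
      exact absurd (hX.1 ⟨0, by omega⟩ ⟨0, by omega⟩) (Finset.notMem_empty _)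
    rw [this, Set.ncard_empty, Nat.cast_zero]
    positivity
  · have h := hC Γ ⟨S, hS.le, hΓ⟩ f A hA hne hf hcase hfin.toFinset
      fun X hX => hfin.mem_toFinset.1 hX
    rw [← Set.ncard_eq_toFinset_card Z hfin] at h
    calc (Z.ncard : ℝ) ≤ C * (A.card : ℝ) ^ _ := by exact_mod_cast h
      _ ≤ _ := by gcongr; linarith

end PlaceSystem

theorem count_real_matrices_charpoly_refined (n ρ : ℕ) (hn : 3 ≤ n)
    (hmod : n % 4 = 0 ∨ n % 4 = 1) :
    ∃ C : ℝ, 0 < C ∧ ∀ Γ : Subgroup ℝˣ,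
      FinRank Γ ρ →
      ∀ f : Polynomial ℝ, f.Monic → f.natDegree = n →
      ∀ A : Finset ℝ, (∀ a ∈ A, ∃ u : ℝˣ, u ∈ Γ ∧ (u : ℝ) = a) →
      ((f.coeff (n - 1) ≠ 0 ∧ f.coeff (n - 1) ^ 2 = 2 * f.coeff (n - 2) →
          (n % 4 = 0 →
            ({X : Matrix (Fin n) (Fin n) ℝ | (∀ i j, X i j ∈ A) ∧ X.charpoly = f}.ncard : ℝ) ≤
              C * (A.card : ℝ) ^ (betaExp n - 2)) ∧
          (n % 4 = 1 →
            ({X : Matrix (Fin n) (Fin n) ℝ | (∀ i j, X i j ∈ A) ∧ X.charpoly = f}.ncard : ℝ) ≤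
              C * (A.card : ℝ) ^ (betaExp n - 3 / 2))) ∧
       (n = 5 → f.coeff 4 = 0 → f.coeff 3 = 0 →
          ({X : Matrix (Fin n) (Fin n) ℝ | (∀ i j, X i j ∈ A) ∧ X.charpoly = f}.ncard : ℝ) ≤
            C * (A.card : ℝ) ^ (betaExp 5 - 3 / 2))) := by
  obtain ⟨C, hC, h⟩ := PlaceSystem.exists_ncard_matrix_le n ρ (by omega)
  obtain ⟨e0, e1⟩ := PlaceSystem.exponent_eq hn
  refine ⟨C, hC, fun Γ hΓ f _ _ A hA => ⟨fun ⟨h0, h2⟩ => ⟨fun hmod0 => ?_, fun hmod1 => ?_⟩, ?_⟩⟩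
  · rw [← e0 hmod0]
    exact h Γ hΓ f A hA h2 (Or.inl h0)
  · rw [← e1 hmod1]
    exact h Γ hΓ f A hA h2 (Or.inl h0)
  · rintro rfl h4 h3
    rw [← e1 rfl]
    exact h Γ hΓ f A hA (by norm_num [h4, h3]) (Or.inr rfl)
end

section
/- Let K be a field and fix integers n ≥ m ≥ r ≥ 1. Then there exists a constant C > 0, depending only on m, n and r, such that for every finite subset A of K of cardinality A = #A, the number of m×n matrices over A of rank exactly r satisfies #R_{m,n}(A; r) ≤ C·A^{nr + mr − r²}. -/
namespace Matrix

variable {K m n : Type*} [Field K] [Fintype m] [Fintype n]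

/-- A matrix over a field factors through linearly independent rows of its own. -/
theorem exists_rows_linearIndependent_eq_mul (X : Matrix m n K) :
    ∃ f : Fin X.rank → m, Function.Injective f ∧ LinearIndependent K (X.submatrix f id).row ∧
      ∃ B : Matrix m (Fin X.rank) K, X = B * X.submatrix f id := by
  obtain ⟨κ, a, ha, hspan, hli⟩ := exists_linearIndependent' K X.row
  have : Finite κ := Finite.of_injective a ha
  have := Fintype.ofFinite κ
  have hcard : Fintype.card κ = X.rank := by
    rw [X.rank_eq_finrank_span_row, ← hspan, finrank_span_eq_card hli]
  let e : Fin X.rank ≃ κ := (Fintype.equivFinOfCardEq hcard).symm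
  refine ⟨a ∘ e, ha.comp e.injective, hli.comp e e.injective, ?_⟩
  have hmem (i : m) : ∃ c : Fin X.rank → K, ∑ k, c k • X.row (a (e k)) = X.row i := by
    rw [← Submodule.mem_span_range_iff_exists_fun, show (fun k ↦ X.row (a (e k))) =
      (X.row ∘ a) ∘ e from rfl, e.surjective.range_comp, hspan]
    exact Submodule.subset_span ⟨i, rfl⟩
  choose B hB using hmem
  refine ⟨of B, ?_⟩
  ext i j
  simpa [mul_apply] using (congrFun (hB i) j).symm

/-- The skeleton (CUR) decomposition of a matrix over a field. -/
theorem exists_eq_submatrix_mul_inv_mul_submatrix (X : Matrix m n K) :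
    ∃ (f : Fin X.rank → m) (g : Fin X.rank → n), Function.Injective f ∧ Function.Injective g ∧
      X = X.submatrix id g * (X.submatrix f g)⁻¹ * X.submatrix f id := by
  obtain ⟨f, hf, hli, B, hB⟩ := X.exists_rows_linearIndependent_eq_mul
  have hrank : (X.submatrix f id)ᵀ.rank = X.rank := by
    rw [rank_transpose, hli.rank_matrix, Fintype.card_fin]
  obtain ⟨g, hg, hli', -⟩ := (X.submatrix f id)ᵀ.exists_rows_linearIndependent_eq_mul
  let e : Fin X.rank ≃ Fin (X.submatrix f id)ᵀ.rank := finCongr hrank.symm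
  have hunit : IsUnit (X.submatrix f (g ∘ e)) :=
    linearIndependent_cols_iff_isUnit.1 (hli'.comp e e.injective)
  have hcols : X.submatrix id (g ∘ e) = B * X.submatrix f (g ∘ e) := by
    ext i k
    exact congrFun (congrFun hB i) (g (e k))
  refine ⟨f, g ∘ e, hf, hg.comp e.injective, ?_⟩
  rw [hcols, mul_nonsing_inv_cancel_right _ _ ((isUnit_iff_isUnit_det _).1 hunit)]
  exact hB

/-- The matrices over `A` with a skeleton decomposition on prescribed rows and columns. -/
theorem ncard_skeleton_le [DecidableEq m] [DecidableEq n] {r : ℕ} (A : Finset K)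
    {f : Fin r → m} {g : Fin r → n} (hf : Function.Injective f) (hg : Function.Injective g) :
    {X : Matrix m n K | (∀ i j, X i j ∈ A) ∧
      X = X.submatrix id g * (X.submatrix f g)⁻¹ * X.submatrix f id}.ncard ≤
      A.card ^ (Fintype.card n * r + Fintype.card m * r - r ^ 2) := by
  let s : Finset (m × n) := Finset.univ.image f ×ˢ Finset.univ
  let t : Finset (m × n) := Finset.univ ×ˢ Finset.univ.image g
  have hcard : (s ∪ t).card = Fintype.card n * r + Fintype.card m * r - r ^ 2 := by
    have hinter : s ∩ t = Finset.univ.image f ×ˢ Finset.univ.image g := by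
      rw [Finset.product_inter_product, Finset.inter_univ, Finset.univ_inter]
    have := Finset.card_union_add_card_inter s t
    rw [hinter] at this
    simp only [s, t, Finset.card_product, Finset.card_image_of_injective _ hf,
      Finset.card_image_of_injective _ hg, Finset.card_univ, Fintype.card_fin] at this ⊢
    rw [mul_comm (Fintype.card n), ← this, ← sq, Nat.add_sub_cancel]
  have hpi : ((Fintype.piFinset fun _ : ↥(s ∪ t) ↦ A : Finset _) : Set (↥(s ∪ t) → K)).ncard =
      A.card ^ (Fintype.card n * r + Fintype.card m * r - r ^ 2) := by
    rw [Set.ncard_coe_finset, Fintype.card_piFinset, Finset.prod_const, Finset.card_univ,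
      Fintype.card_coe, hcard]
  rw [← hpi]
  refine Set.ncard_le_ncard_of_injOn (fun X p ↦ X p.1.1 p.1.2) ?_ ?_ (Finset.finite_toSet _)
  · intro X hX
    simpa using fun i j _ ↦ hX.1 i j
  · intro X hX Y hY hXY
    have hrow (k : Fin r) (j : n) : X (f k) j = Y (f k) j :=
      congrFun hXY ⟨(f k, j), by simp [s]⟩
    have hcol (i : m) (k : Fin r) : X i (g k) = Y i (g k) :=
      congrFun hXY ⟨(i, g k), by simp [t]⟩
    have hf' : X.submatrix f id = Y.submatrix f id := by ext k j; exact hrow k j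
    have hg' : X.submatrix id g = Y.submatrix id g := by ext i k; exact hcol i k
    have hfg : X.submatrix f g = Y.submatrix f g := by ext k l; exact hrow k (g l)
    rw [hX.2, hY.2, hf', hg', hfg]

end Matrix

theorem count_matrices_of_rank_trivial (m n r : ℕ) (hr : 1 ≤ r) (hrm : r ≤ m) (hmn : m ≤ n) :
    ∃ C : ℝ, 0 < C ∧ ∀ (K : Type*) [Field K] (A : Finset K),
      ({X : Matrix (Fin m) (Fin n) K | (∀ i j, X i j ∈ A) ∧ X.rank = r}.ncard : ℝ) ≤
        C * (A.card : ℝ) ^ (n * r + m * r - r ^ 2) := by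
  let I := (Fin r ↪ Fin m) × (Fin r ↪ Fin n)
  refine ⟨Fintype.card I + 1, by positivity, fun K _ A ↦ ?_⟩
  let S (p : I) : Set (Matrix (Fin m) (Fin n) K) := {X | (∀ i j, X i j ∈ A) ∧
    X = X.submatrix id p.2 * (X.submatrix p.1 p.2)⁻¹ * X.submatrix p.1 id}
  have hfin : {X : Matrix (Fin m) (Fin n) K | ∀ i j, X i j ∈ A}.Finite :=
    (Set.Finite.pi' fun _ ↦ Set.Finite.pi' fun _ ↦ A.finite_toSet)
  have hsub : {X : Matrix (Fin m) (Fin n) K | (∀ i j, X i j ∈ A) ∧ X.rank = r} ⊆ ⋃ p, S p := by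
    rintro X ⟨hXA, rfl⟩
    obtain ⟨f, g, hf, hg, hX⟩ := X.exists_eq_submatrix_mul_inv_mul_submatrix
    exact Set.mem_iUnion.2 ⟨(⟨f, hf⟩, ⟨g, hg⟩), hXA, hX⟩
  have hle : {X : Matrix (Fin m) (Fin n) K | (∀ i j, X i j ∈ A) ∧ X.rank = r}.ncard ≤
      Fintype.card I * A.card ^ (n * r + m * r - r ^ 2) := by
    calc _ ≤ (⋃ p, S p).ncard :=
          Set.ncard_le_ncard hsub (Set.finite_iUnion fun p ↦ hfin.subset fun X hX ↦ hX.1)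
      _ ≤ ∑ p, (S p).ncard := Set.ncard_iUnion_le_of_fintype S
      _ ≤ ∑ _p : I, A.card ^ (n * r + m * r - r ^ 2) := Finset.sum_le_sum fun p _ ↦ by
          simpa using Matrix.ncard_skeleton_le A p.1.injective p.2.injective
      _ = _ := by rw [Finset.sum_const, Finset.card_univ, smul_eq_mul]
  calc _ ≤ (Fintype.card I : ℝ) * (A.card : ℝ) ^ (n * r + m * r - r ^ 2) := mod_cast hle
    _ ≤ _ := by gcongr; linarith
end

section
/- Let K be a field and n ≥ 1 an integer. Then there exists a constant C > 0, depending only on n, such that for every d ∈ K and every finite subset A of K of cardinality A = #A, the number of n×n matrices over A with determinant d satisfies #D_n(A; d) ≤ C·A^{n² − 1}. -/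
/-- Schwartz–Zippel lemma over a finite grid, with variables indexed by a nonempty finite type. -/
theorem MvPolynomial.ncard_zeros_le_totalDegree_mul {σ R : Type*} [Fintype σ] [Nonempty σ]
    [CommRing R] [IsDomain R] {p : MvPolynomial σ R} (hp : p ≠ 0) (S : Finset R) :
    {x : σ → R | (∀ i, x i ∈ S) ∧ MvPolynomial.eval x p = 0}.ncard ≤
      p.totalDegree * S.card ^ (Fintype.card σ - 1) := by
  classical
  rcases S.eq_empty_or_nonempty with rfl | hS
  · simp
  set e := Fintype.equivFin σ
  set q := MvPolynomial.rename e p with hq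
  have hq0 : q ≠ 0 := by
    rwa [hq, Ne, MvPolynomial.rename_eq_zero_iff_of_injective p e.injective]
  have hSZ := MvPolynomial.schwartz_zippel_totalDegree hq0 S
  have hS0 : (0 : ℚ≥0) < S.card := by exact_mod_cast hS.card_pos
  have hpow : (S.card : ℚ≥0) ^ Fintype.card σ = S.card ^ (Fintype.card σ - 1) * S.card := by
    rw [← pow_succ, Nat.sub_add_cancel Fintype.card_pos]
  rw [div_le_div_iff₀ (by positivity) hS0, hpow, ← mul_assoc] at hSZ
  have hcount := le_of_mul_le_mul_right hSZ hS0
  norm_cast at hcount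
  refine le_trans ?_ (hcount.trans (Nat.mul_le_mul_right _ (MvPolynomial.totalDegree_rename_le e p)))
  rw [← Set.ncard_coe_finset]
  refine Set.ncard_le_ncard_of_injOn (fun x ↦ x ∘ e.symm) ?_
    (e.symm.surjective.injective_comp_right.injOn) (Finset.finite_toSet _)
  rintro x ⟨hxS, hx⟩
  simp only [Finset.coe_filter, Fintype.mem_piFinset, Set.mem_ofPred_eq]
  refine ⟨fun i ↦ hxS _, ?_⟩
  rw [hq, MvPolynomial.eval_rename]
  simpa [Function.comp_assoc] using hx

theorem Matrix.totalDegree_det_mvPolynomialX_le (m R : Type*) [Fintype m] [DecidableEq m]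
    [CommRing R] :
    (Matrix.mvPolynomialX m m R).det.totalDegree ≤ Fintype.card m := by
  refine MvPolynomial.IsHomogeneous.totalDegree_le ?_
  rw [Matrix.det_apply']
  refine MvPolynomial.IsHomogeneous.sum _ _ _ fun τ _ ↦ ?_
  rw [← zero_add (Fintype.card m)]
  refine MvPolynomial.IsHomogeneous.mul ?_ ?_
  · simpa using MvPolynomial.isHomogeneous_C (m × m) ((Equiv.Perm.sign τ : ℤ) : R)
  · simpa using MvPolynomial.IsHomogeneous.prod Finset.univ
      (fun i ↦ Matrix.mvPolynomialX m m R (τ i) i) (fun _ ↦ 1)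
      fun i _ ↦ MvPolynomial.isHomogeneous_X _ _

theorem Matrix.det_mvPolynomialX_sub_C_ne_zero (m : Type*) {R : Type*} [Fintype m] [DecidableEq m]
    [Nonempty m] [CommRing R] [Nontrivial R] (d : R) :
    (Matrix.mvPolynomialX m m R).det - MvPolynomial.C d ≠ 0 := by
  intro h
  have hdet (M : Matrix m m R) : M.det = d := by
    have := congrArg (MvPolynomial.eval fun ij : m × m ↦ M ij.1 ij.2) h
    rw [map_sub, Matrix.eval_det_mvPolynomialX, MvPolynomial.eval_C, map_zero, sub_eq_zero] at this
    exact this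
  have h01 := (hdet 0).trans (hdet 1).symm
  rw [Matrix.det_zero, Matrix.det_one] at h01
  exact zero_ne_one h01

theorem count_matrices_of_det_trivial (n : ℕ) (hn : 1 ≤ n) :
    ∃ C : ℝ, 0 < C ∧ ∀ (K : Type*) [Field K] (d : K) (A : Finset K),
      ({X : Matrix (Fin n) (Fin n) K | (∀ i j, X i j ∈ A) ∧ X.det = d}.ncard : ℝ) ≤
        C * (A.card : ℝ) ^ (n ^ 2 - 1) := by
  refine ⟨n, by exact_mod_cast hn, fun K _ d A ↦ ?_⟩
  have : Nonempty (Fin n) := ⟨⟨0, hn⟩⟩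
  set p := (Matrix.mvPolynomialX (Fin n) (Fin n) K).det - MvPolynomial.C d with hp
  have hzeros := MvPolynomial.ncard_zeros_le_totalDegree_mul
    (Matrix.det_mvPolynomialX_sub_C_ne_zero (Fin n) d) A
  have hdeg : p.totalDegree ≤ n := by
    simpa using (MvPolynomial.totalDegree_sub_C_le _ d).trans
      (Matrix.totalDegree_det_mvPolynomialX_le (Fin n) K)
  rw [Fintype.card_prod, Fintype.card_fin, ← sq] at hzeros
  have hset : {X : Matrix (Fin n) (Fin n) K | (∀ i j, X i j ∈ A) ∧ X.det = d}.ncard ≤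
      {x : Fin n × Fin n → K | (∀ i, x i ∈ A) ∧ MvPolynomial.eval x p = 0}.ncard := by
    refine Set.ncard_le_ncard_of_injOn (fun X ij ↦ X ij.1 ij.2) ?_ ?_ ?_
    · rintro X ⟨hXA, hX⟩
      refine ⟨fun ij ↦ hXA _ _, ?_⟩
      rw [hp, map_sub, Matrix.eval_det_mvPolynomialX, MvPolynomial.eval_C, sub_eq_zero]
      exact hX
    · intro X _ Y _ hXY
      ext i j
      exact congrFun hXY (i, j)
    · exact (Set.Finite.pi' fun _ ↦ A.finite_toSet).subset fun x hx ↦ hx.1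
  exact_mod_cast hset.trans (hzeros.trans (Nat.mul_le_mul_right _ hdeg))
end
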